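/- Fix integers n, m ≥ 1 and k₁, k₂ ≥ 0. Then there exist δ₁ > 0 and a real-analytic function ρ : (−δ₁, δ₁) → ℝ with ρ(0) = 1 and ρ′(0) = 0 such that the following holds: for every ε > 0 there exist δ₀ ∈ (0, δ₁) and M > 0 such that for all (x, t) ∈ ℝ^{2n} × ℝ^m with x ≠ 0, t ≠ 0, |x|² + |t| ≥ M and δ ≤ δ₀, one has |p_{1,k₁,k₂}(x,t) − P(x,t)| ≤ ε |P(x,t)|, where P(x,t) = ((−1)^{k₂} π^{k₁+k₂} / 2^{n−k₁+1+(m−1)/2}) · |t|^{n+k₁−(m+1)/2} · e^{−d(x,t)²/4} · e^{−κρ(δ)} · Ĩ_{n+k₁−1}(κρ(δ)). -/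

import Mathlib

open Real Complex MeasureTheory
open scoped Classical

/-- θ(y) = (2y − sin(2y))/(2 sin²(y)) for y ≠ 0, θ(0) = 0. -/
noncomputable def theta (y : ℝ) : ℝ :=
  if y = 0 then 0 else (2 * y - Real.sin (2 * y)) / (2 * Real.sin y ^ 2)

/-- The radial derivative p_{1,k₁,k₂} of the heat kernel at time 1 on an H-type group
with centre of dimension m, with R = |x|²/4 (integrand extended by continuity at λ = 0). -/
noncomputable def pT (n m k₁ k₂ : ℕ) (hm : 0 < m)
    (x : EuclideanSpace ℝ (Fin (2 * n))) (t : EuclideanSpace ℝ (Fin m)) : ℂ :=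
  ((-1 : ℂ) ^ k₁ * Complex.I ^ k₂ / ((4 * (π : ℂ)) ^ n * (2 * (π : ℂ)) ^ m)) *
    ∫ lam : EuclideanSpace ℝ (Fin m),
      if lam = 0 then (if k₂ = 0 then Complex.exp (-((‖x‖ ^ 2 / 4 : ℝ) : ℂ)) else 0)
      else
        Complex.exp (Complex.I * ((‖t‖ : ℝ) : ℂ) * ((lam ⟨0, hm⟩ : ℝ) : ℂ)
            - ((‖x‖ ^ 2 / 4 * ‖lam‖ * Real.cosh ‖lam‖ / Real.sinh ‖lam‖ : ℝ) : ℂ)) *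
          (((‖lam‖ : ℝ) : ℂ) ^ (n + k₁) * ((Real.cosh ‖lam‖ : ℝ) : ℂ) ^ k₁
            / ((Real.sinh ‖lam‖ : ℝ) : ℂ) ^ (n + k₁)) *
          ((lam ⟨0, hm⟩ : ℝ) : ℂ) ^ k₂

/-- Ĩ_ν(ζ) = Σ_{k≥0} ζ^{2k}/(2^{2k+ν} k! (k+ν)!). -/
noncomputable def besselItilde (ν : ℕ) (ζ : ℝ) : ℝ :=
  ∑' k : ℕ, ζ ^ (2 * k) /
    ((2 : ℝ) ^ (2 * k + ν) * (Nat.factorial k) * (Nat.factorial (k + ν)))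

section HeatKernelAsymptotics

open Filter Topology Set

theorem complexSqrt_pow_two (w : ℂ) : Complex.sqrt w ^ 2 = w := by
  rw [Complex.sqrt]; exact Complex.cpow_ofNat_inv_pow w 2

/-- The entire function `w ↦ cosh (√w)`. -/
noncomputable def coshSqrt (w : ℂ) : ℂ := Complex.cosh (Complex.sqrt w)

/-- The entire function `w ↦ sinh (√w) / √w`. -/
noncomputable def sinhcSqrt (w : ℂ) : ℂ := 2 * deriv coshSqrt w

theorem coshSqrt_sq (z : ℂ) : coshSqrt (z ^ 2) = Complex.cosh z := by
  have h : Complex.sqrt (z ^ 2) ^ 2 = z ^ 2 := complexSqrt_pow_two _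
  rcases sq_eq_sq_iff_eq_or_eq_neg.1 h with h | h <;> simp [coshSqrt, h]

theorem coshSqrt_eq_cos (w : ℂ) : coshSqrt w = Complex.cos (Complex.sqrt (-w)) := by
  have h : (Complex.I * Complex.sqrt (-w)) ^ 2 = w := by
    rw [mul_pow, Complex.I_sq, complexSqrt_pow_two]; ring
  rw [← Complex.cosh_mul_I, ← coshSqrt_sq, mul_comm _ Complex.I, h]

theorem differentiable_coshSqrt : Differentiable ℂ coshSqrt := by
  have h0 : ∀ w : ℂ, w ≠ 0 → DifferentiableAt ℂ coshSqrt w := by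
    intro w hw
    by_cases h : w ∈ Complex.slitPlane
    · exact (Complex.differentiableAt_sqrt h).ccosh
    · have h' : -w ∈ Complex.slitPlane := by
        rw [Complex.mem_slitPlane_iff] at h ⊢
        push Not at h
        left
        have : w.re ≠ 0 := fun h1 => hw (Complex.ext h1 h.2)
        simp only [Complex.neg_re]
        have := lt_of_le_of_ne h.1 this
        linarith
      have : coshSqrt = fun w => Complex.cos (Complex.sqrt (-w)) := funext coshSqrt_eq_cos
      rw [this]
      exact (DifferentiableAt.comp w (Complex.differentiableAt_sqrt h') differentiableAt_id.neg).ccos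
  have hc : ContinuousAt coshSqrt 0 := by
    have : ContinuousAt Complex.sqrt 0 := Complex.continuousAt_sqrt (by simp)
    exact Complex.continuous_cosh.continuousAt.comp this
  have := (Complex.differentiableOn_compl_singleton_and_continuousAt_iff (s := univ)
    (f := coshSqrt) (c := 0) univ_mem).1
    ⟨fun w hw => (h0 w (by simpa using hw)).differentiableWithinAt, hc⟩
  exact differentiableOn_univ.1 this

theorem differentiable_sinhcSqrt : Differentiable ℂ sinhcSqrt :=
  (differentiable_coshSqrt.deriv).const_mul 2

theorem mul_sinhcSqrt_sq (z : ℂ) : z * sinhcSqrt (z ^ 2) = Complex.sinh z := by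
  have h1 : HasDerivAt (fun z => coshSqrt (z ^ 2)) (deriv coshSqrt (z ^ 2) * (2 * z)) z := by
    have := (differentiable_coshSqrt (z ^ 2)).hasDerivAt.comp z (hasDerivAt_pow 2 z)
    simpa [Function.comp_def] using this
  have h2 : HasDerivAt (fun z => coshSqrt (z ^ 2)) (Complex.sinh z) z := by
    simp only [coshSqrt_sq]; exact Complex.hasDerivAt_cosh z
  rw [← h1.unique h2, sinhcSqrt]; ring

theorem sinhcSqrt_zero : sinhcSqrt 0 = 1 := by
  have h1 : HasDerivAt (fun z => z * sinhcSqrt (z ^ 2)) (sinhcSqrt 0) (0 : ℂ) := by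
    have hd : DifferentiableAt ℂ (fun z : ℂ => sinhcSqrt (z ^ 2)) 0 :=
      (differentiable_sinhcSqrt _).comp (0 : ℂ) (differentiableAt_id.pow 2)
    have := (hasDerivAt_id' (0 : ℂ)).fun_mul hd.hasDerivAt
    simpa using this
  have h2 : HasDerivAt (fun z => z * sinhcSqrt (z ^ 2)) 1 (0 : ℂ) := by
    simp only [mul_sinhcSqrt_sq]; simpa using Complex.hasDerivAt_sinh 0
  exact h1.unique h2

theorem coshSqrt_neg_sq (y : ℂ) : coshSqrt (-y ^ 2) = Complex.cos y := by
  rw [← Complex.cosh_mul_I, ← coshSqrt_sq, mul_pow, Complex.I_sq]; congr 1; ring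

theorem mul_sinhcSqrt_neg_sq (y : ℂ) : y * sinhcSqrt (-y ^ 2) = Complex.sin y := by
  have := mul_sinhcSqrt_sq (y * Complex.I)
  rw [Complex.sinh_mul_I, mul_pow, Complex.I_sq] at this
  have h2 : Complex.I * (y * sinhcSqrt (-y ^ 2)) = Complex.I * Complex.sin y := by
    rw [mul_comm Complex.I (Complex.sin y), ← this]; ring_nf
  exact mul_left_cancel₀ Complex.I_ne_zero h2

theorem sinhcSqrt_neg_sq_ne_zero {y : ℂ} (hy : Complex.sin y ≠ 0) : sinhcSqrt (-y ^ 2) ≠ 0 := by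
  intro h; apply hy; rw [← mul_sinhcSqrt_neg_sq, h, mul_zero]

theorem sinhcSqrt_neg_sq {y : ℂ} (hy : Complex.sin y ≠ 0) :
    sinhcSqrt (-y ^ 2) = Complex.sin y / y := by
  have : y ≠ 0 := by rintro rfl; simp at hy
  rw [← mul_sinhcSqrt_neg_sq]; field_simp

/-- The Mehler-type kernel `(√w / sinh √w)^N (cosh √w)^k exp (-R √w coth √w)`. -/
noncomputable def mehler (N k : ℕ) (R : ℝ) (w : ℂ) : ℂ :=
  (1 / sinhcSqrt w) ^ N * coshSqrt w ^ k * Complex.exp (-(R * (coshSqrt w / sinhcSqrt w)))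

theorem differentiableAt_mehler (N k : ℕ) (R : ℝ) {w : ℂ} (hw : sinhcSqrt w ≠ 0) :
    DifferentiableAt ℂ (mehler N k R) w := by
  have h1 := differentiable_coshSqrt w
  have h2 := differentiable_sinhcSqrt w
  unfold mehler
  fun_prop (disch := assumption)

theorem mehler_neg_sq (N k : ℕ) (R : ℝ) {y : ℂ} (hy : Complex.sin y ≠ 0) :
    mehler N k R (-y ^ 2) = (y / Complex.sin y) ^ N * Complex.cos y ^ k *
      Complex.exp (-(R * (y * Complex.cos y / Complex.sin y))) := by
  have : y ≠ 0 := by rintro rfl; simp at hy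
  rw [mehler, coshSqrt_neg_sq, sinhcSqrt_neg_sq hy]
  rw [one_div_div, div_div_eq_mul_div, mul_comm (Complex.cos y) y]

theorem mehler_sq (N k : ℕ) (R : ℝ) {z : ℂ} (hz : Complex.sinh z ≠ 0) :
    mehler N k R (z ^ 2) = (z / Complex.sinh z) ^ N * Complex.cosh z ^ k *
      Complex.exp (-(R * (z * Complex.cosh z / Complex.sinh z))) := by
  have : z ≠ 0 := by rintro rfl; simp at hz
  have h : sinhcSqrt (z ^ 2) = Complex.sinh z / z := by
    rw [← mul_sinhcSqrt_sq]; field_simp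
  rw [mehler, coshSqrt_sq, h]
  rw [one_div_div, div_div_eq_mul_div, mul_comm (Complex.cosh z) z]

theorem measurable_mehler (N k : ℕ) (R : ℝ) : Measurable (mehler N k R) := by
  have h1 := differentiable_coshSqrt.continuous.measurable
  have h2 := differentiable_sinhcSqrt.continuous.measurable
  unfold mehler
  fun_prop

/-- The branch `√(y² + r²)` that is holomorphic on the right half-plane. -/
noncomputable def shiftRoot (r : ℝ) (y : ℂ) : ℂ := Complex.sqrt (y ^ 2 + (r : ℂ) ^ 2)

theorem shiftRoot_sq (r : ℝ) (y : ℂ) : shiftRoot r y ^ 2 = y ^ 2 + (r : ℂ) ^ 2 :=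
  complexSqrt_pow_two _

theorem sq_add_sq_mem_slitPlane (r : ℝ) {y : ℂ} (hy : 0 < y.re) :
    y ^ 2 + (r : ℂ) ^ 2 ∈ Complex.slitPlane := by
  rw [Complex.mem_slitPlane_iff]
  by_cases h : y.im = 0
  · left
    simp only [pow_two, Complex.add_re, Complex.mul_re, h, Complex.ofReal_re, Complex.ofReal_im]
    nlinarith [mul_self_nonneg r, mul_pos hy hy]
  · right
    simp only [pow_two, Complex.add_im, Complex.mul_im, Complex.ofReal_re, Complex.ofReal_im]
    have : y.re * y.im ≠ 0 := mul_ne_zero hy.ne' h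
    intro h'; apply this; linarith

theorem shiftRoot_re_nonneg (r : ℝ) (y : ℂ) : 0 ≤ (shiftRoot r y).re := by
  rw [shiftRoot, Complex.sqrt, Complex.cpow_inv_two_re]; positivity

theorem shiftRoot_ne_zero (r : ℝ) {y : ℂ} (hy : 0 < y.re) : shiftRoot r y ≠ 0 := by
  intro h
  have h1 := shiftRoot_sq r y
  have h2 := Complex.slitPlane_ne_zero (sq_add_sq_mem_slitPlane r hy)
  rw [← h1, h] at h2; simp at h2

theorem shiftRoot_sq_re (r : ℝ) (y : ℂ) :
    (shiftRoot r y).re ^ 2 - (shiftRoot r y).im ^ 2 = y.re ^ 2 - y.im ^ 2 + r ^ 2 := by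
  have := congrArg Complex.re (shiftRoot_sq r y)
  simp only [pow_two, Complex.add_re, Complex.mul_re, Complex.ofReal_re, Complex.ofReal_im] at this
  linarith

theorem shiftRoot_sq_im (r : ℝ) (y : ℂ) :
    (shiftRoot r y).re * (shiftRoot r y).im = y.re * y.im := by
  have := congrArg Complex.im (shiftRoot_sq r y)
  simp only [pow_two, Complex.add_im, Complex.mul_im, Complex.ofReal_re, Complex.ofReal_im] at this
  linarith

theorem re_le_shiftRoot_re (r : ℝ) {y : ℂ} (hy : 0 < y.re) : y.re ≤ (shiftRoot r y).re := by
  have h1 := shiftRoot_sq_re r y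
  have h2 := shiftRoot_sq_im r y
  have h0 := shiftRoot_re_nonneg r y
  set A := (shiftRoot r y).re
  set B := (shiftRoot r y).im
  by_contra! h
  have hA : A ^ 2 < y.re ^ 2 := by nlinarith
  have h3 : y.re ^ 2 * y.im ^ 2 = A ^ 2 * B ^ 2 := by rw [← mul_pow, ← h2, mul_pow]
  have hB : B ^ 2 < y.im ^ 2 := by nlinarith [sq_nonneg r]
  nlinarith [mul_le_mul hA.le hB.le (sq_nonneg B) (sq_nonneg y.re), sq_nonneg A, sq_nonneg B,
    mul_pos hy hy, sq_nonneg y.re]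

theorem shiftRoot_re_pos (r : ℝ) {y : ℂ} (hy : 0 < y.re) : 0 < (shiftRoot r y).re :=
  hy.trans_le (re_le_shiftRoot_re r hy)

theorem shiftRoot_im_sq_le (r : ℝ) {y : ℂ} (hy : 0 < y.re) :
    (shiftRoot r y).im ^ 2 ≤ y.im ^ 2 := by
  have h2 := shiftRoot_sq_im r y
  have h0 := re_le_shiftRoot_re r hy
  set A := (shiftRoot r y).re
  set B := (shiftRoot r y).im
  by_contra! h
  have hA : y.re ^ 2 ≤ A ^ 2 := by nlinarith
  have h3 : y.re ^ 2 * y.im ^ 2 = A ^ 2 * B ^ 2 := by rw [← mul_pow, ← h2, mul_pow]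
  nlinarith [mul_pos hy hy, sq_nonneg y.im]

theorem shiftRoot_re_sq_le (r : ℝ) {y : ℂ} (hy : 0 < y.re) :
    (shiftRoot r y).re ^ 2 ≤ y.re ^ 2 + r ^ 2 := by
  linarith [shiftRoot_im_sq_le r hy, shiftRoot_sq_re r y]

theorem le_shiftRoot_re {r : ℝ} {y : ℂ} : r - |y.im| ≤ (shiftRoot r y).re := by
  have h1 := shiftRoot_sq_re r y
  have h0 := shiftRoot_re_nonneg r y
  set A := (shiftRoot r y).re
  set B := (shiftRoot r y).im
  by_contra! h
  nlinarith [sq_nonneg B, sq_nonneg y.re, sq_abs y.im, abs_nonneg y.im]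

theorem norm_shiftRoot_le (r : ℝ) (y : ℂ) : ‖shiftRoot r y‖ ≤ ‖y‖ + |r| := by
  have h : ‖shiftRoot r y‖ ^ 2 ≤ (‖y‖ + |r|) ^ 2 := by
    rw [← norm_pow, shiftRoot_sq]
    refine (norm_add_le _ _).trans ?_
    simp only [norm_pow, Complex.norm_real, Real.norm_eq_abs]
    nlinarith [norm_nonneg y, abs_nonneg r, mul_nonneg (norm_nonneg y) (abs_nonneg r)]
  exact (pow_le_pow_iff_left₀ (norm_nonneg _) (by positivity) two_ne_zero).1 h

theorem hasDerivAt_shiftRoot (r : ℝ) {y : ℂ} (hy : 0 < y.re) :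
    HasDerivAt (shiftRoot r) (y / shiftRoot r y) y := by
  have hd : DifferentiableAt ℂ (shiftRoot r) y := by
    unfold shiftRoot
    exact DifferentiableAt.comp y (Complex.differentiableAt_sqrt (sq_add_sq_mem_slitPlane r hy))
      (f := fun y : ℂ => y ^ 2 + (r : ℂ) ^ 2) (by fun_prop)
  have h1 : HasDerivAt (fun y => shiftRoot r y ^ 2) (2 * y) y := by
    simp only [shiftRoot_sq]
    simpa using (hasDerivAt_pow 2 y).add_const ((r : ℂ) ^ 2)
  have h2 := hd.hasDerivAt.fun_pow 2
  have h3 := h1.unique h2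
  have h4 := shiftRoot_ne_zero r hy
  have : deriv (shiftRoot r) y = y / shiftRoot r y := by
    rw [eq_div_iff h4]
    simp at h3
    linear_combination (-1 / 2 : ℂ) * h3
  rw [← this]; exact hd.hasDerivAt

theorem measurable_complexSqrt : Measurable Complex.sqrt := by
  have : Complex.sqrt = fun w => w ^ (2⁻¹ : ℂ) := funext fun w => by rw [Complex.sqrt]
  rw [this]; fun_prop

theorem measurable_shiftRoot : Measurable fun p : ℝ × ℂ => shiftRoot p.1 p.2 := by
  unfold shiftRoot
  exact measurable_complexSqrt.comp (by fun_prop)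

/-! ### Bounds for the Mehler kernel -/

theorem sin_eq_mk (y : ℂ) :
    Complex.sin y = ⟨Real.sin y.re * Real.cosh y.im, Real.cos y.re * Real.sinh y.im⟩ := by
  rw [Complex.sin_eq, ← Complex.ofReal_sin, ← Complex.ofReal_cos, ← Complex.ofReal_cosh,
    ← Complex.ofReal_sinh]
  apply Complex.ext <;> simp [-Complex.ofReal_sin, -Complex.ofReal_cos, -Complex.ofReal_cosh,
    -Complex.ofReal_sinh]

theorem cos_eq_mk (y : ℂ) :
    Complex.cos y = ⟨Real.cos y.re * Real.cosh y.im, -(Real.sin y.re * Real.sinh y.im)⟩ := by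
  rw [Complex.cos_eq, ← Complex.ofReal_sin, ← Complex.ofReal_cos, ← Complex.ofReal_cosh,
    ← Complex.ofReal_sinh]
  apply Complex.ext <;> simp [-Complex.ofReal_sin, -Complex.ofReal_cos, -Complex.ofReal_cosh,
    -Complex.ofReal_sinh]

theorem re_mul_cos_div_sin (y : ℂ) : (y * Complex.cos y / Complex.sin y).re =
    (y.re * (Real.sin y.re * Real.cos y.re) + y.im * (Real.sinh y.im * Real.cosh y.im)) /
      Complex.normSq (Complex.sin y) := by
  have hs := sin_eq_mk y
  have hc := cos_eq_mk y
  rw [Complex.div_re, ← add_div]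
  congr 1
  rw [hs, hc]
  simp only [Complex.mul_re, Complex.mul_im]
  have h1 := Real.sin_sq_add_cos_sq y.re
  have h2 := Real.cosh_sq y.im
  linear_combination (y.re * Real.sin y.re * Real.cos y.re) * h2 +
    (y.im * Real.sinh y.im * Real.cosh y.im) * h1

theorem normSq_sin (y : ℂ) :
    Complex.normSq (Complex.sin y) = Real.sin y.re ^ 2 + Real.sinh y.im ^ 2 := by
  have hs := sin_eq_mk y
  rw [hs, Complex.normSq_mk]
  have h1 := Real.sin_sq_add_cos_sq y.re
  have h2 := Real.cosh_sq y.im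
  linear_combination (Real.sin y.re ^ 2) * h2 + (Real.sinh y.im ^ 2) * h1

theorem norm_cos_le (y : ℂ) : ‖Complex.cos y‖ ≤ Real.cosh y.im := by
  have hc := cos_eq_mk y
  rw [← sq_le_sq₀ (norm_nonneg _) (Real.cosh_pos _).le, ← Complex.normSq_eq_norm_sq, hc,
    Complex.normSq_mk]
  have h1 := Real.sin_sq_add_cos_sq y.re
  have h2 := Real.cosh_sq y.im
  nlinarith [sq_nonneg (Real.sin y.re)]

theorem exp_abs_le_two_mul_cosh (b : ℝ) : Real.exp |b| ≤ 2 * Real.cosh b := by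
  rw [← Real.cosh_abs, Real.cosh_eq]; linarith [Real.exp_pos (-|b|)]

theorem norm_mehler_le {n k : ℕ} (hn : 1 ≤ n) {R : ℝ} (hR : 0 ≤ R) {y : ℂ}
    (hs : Complex.sin y ≠ 0) (h1 : 0 ≤ (y * Complex.cos y / Complex.sin y).re)
    (h2 : ‖y‖ * Real.cosh y.im ≤ 10 * (1 + |y.im|) * ‖Complex.sin y‖) :
    ‖mehler (n + k) k R (-y ^ 2)‖ ≤ 2 * (10 * (1 + |y.im|)) ^ (n + k) * Real.exp (-|y.im|) := by
  have hc := Real.cosh_pos y.im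
  have hsn : 0 < ‖Complex.sin y‖ := norm_pos_iff.2 hs
  rw [mehler_neg_sq _ _ _ hs, norm_mul, norm_mul, norm_pow, norm_pow, norm_div]
  have e1 : ‖Complex.exp (-(R * (y * Complex.cos y / Complex.sin y)))‖ ≤ 1 := by
    rw [Complex.norm_exp, Real.exp_le_one_iff, Complex.neg_re, Complex.re_ofReal_mul]
    nlinarith [mul_nonneg hR h1]
  have e2 : ‖y‖ / ‖Complex.sin y‖ ≤ 10 * (1 + |y.im|) / Real.cosh y.im := by
    rw [div_le_div_iff₀ hsn hc]; exact h2
  have e3 := norm_cos_le y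
  calc _ ≤ (10 * (1 + |y.im|) / Real.cosh y.im) ^ (n + k) * Real.cosh y.im ^ k * 1 := by gcongr
    _ = (10 * (1 + |y.im|)) ^ (n + k) * (1 / Real.cosh y.im) ^ n := by
      rw [div_pow, mul_one, pow_add (Real.cosh y.im), one_div, inv_pow]; field_simp
    _ ≤ (10 * (1 + |y.im|)) ^ (n + k) * (1 / Real.cosh y.im) ^ 1 := by
      have h0 : 0 ≤ 1 / Real.cosh y.im := by positivity
      have h1 : 1 / Real.cosh y.im ≤ 1 := by rw [div_le_one hc]; exact Real.one_le_cosh _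
      exact mul_le_mul_of_nonneg_left (pow_le_pow_of_le_one h0 h1 hn) (by positivity)
    _ ≤ (10 * (1 + |y.im|)) ^ (n + k) * (2 * Real.exp (-|y.im|)) := by
      gcongr
      rw [pow_one, div_le_iff₀ hc, Real.exp_neg]
      have := exp_abs_le_two_mul_cosh y.im
      have := Real.exp_pos |y.im|
      field_simp; linarith
    _ = _ := by ring

theorem norm_mehler_le_of_abs_re_le {n k : ℕ} (hn : 1 ≤ n) {R : ℝ} (hR : 0 ≤ R) {y : ℂ}
    (h : |y.re| ≤ |y.im|) (h' : 1 ≤ |y.im|) :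
    ‖mehler (n + k) k R (-y ^ 2)‖ ≤ 2 * (10 * (1 + |y.im|)) ^ (n + k) * Real.exp (-|y.im|) := by
  have hsh : |y.im| ≤ |Real.sinh y.im| := by
    rw [Real.abs_sinh]; exact Real.self_le_sinh_iff.2 (abs_nonneg _)
  have hsin : |Real.sinh y.im| ≤ ‖Complex.sin y‖ := by
    rw [← sq_le_sq₀ (abs_nonneg _) (norm_nonneg _), ← Complex.normSq_eq_norm_sq, normSq_sin, sq_abs]
    nlinarith [sq_nonneg (Real.sin y.re)]
  refine norm_mehler_le hn hR (norm_pos_iff.1 (by linarith)) ?_ ?_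
  · rw [re_mul_cos_div_sin]
    refine div_nonneg ?_ (Complex.normSq_nonneg _)
    have a1 : |y.re * (Real.sin y.re * Real.cos y.re)| ≤ |y.im| * |y.im| := by
      rw [abs_mul, abs_mul]
      have := Real.abs_cos_le_one y.re
      have := Real.abs_sin_le_one y.re
      have h3 : |Real.sin y.re| * |Real.cos y.re| ≤ 1 := by
        nlinarith [abs_nonneg (Real.sin y.re), abs_nonneg (Real.cos y.re)]
      nlinarith [abs_nonneg y.re, abs_nonneg (Real.sin y.re), abs_nonneg (Real.cos y.re),
        mul_nonneg (abs_nonneg (Real.sin y.re)) (abs_nonneg (Real.cos y.re))]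
    have a2 : |y.im| * |y.im| ≤ y.im * (Real.sinh y.im * Real.cosh y.im) := by
      have : y.im * (Real.sinh y.im * Real.cosh y.im) =
          |y.im| * |Real.sinh y.im| * Real.cosh y.im := by
        rcases le_total 0 y.im with h0 | h0
        · rw [abs_of_nonneg h0, abs_of_nonneg (Real.sinh_nonneg_iff.2 h0)]; ring
        · rw [abs_of_nonpos h0, abs_of_nonpos (Real.sinh_nonpos_iff.2 h0)]; ring
      rw [this]
      have := Real.one_le_cosh y.im
      nlinarith [mul_nonneg (abs_nonneg y.im) (abs_nonneg (Real.sinh y.im)), abs_nonneg y.im]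
    linarith [neg_abs_le (y.re * (Real.sin y.re * Real.cos y.re))]
  · have b1 : ‖y‖ ≤ 2 * |y.im| := by
      have := Complex.norm_le_abs_re_add_abs_im y; linarith
    have b2 : Real.cosh y.im ≤ 2 * |Real.sinh y.im| := by
      have hq := Real.cosh_sq y.im
      have h1 : 1 ≤ |Real.sinh y.im| := h'.trans hsh
      have : Real.cosh y.im ^ 2 ≤ (2 * |Real.sinh y.im|) ^ 2 := by
        rw [mul_pow, sq_abs, hq]; nlinarith [sq_abs (Real.sinh y.im)]
      exact (pow_le_pow_iff_left₀ (Real.cosh_pos _).le (by positivity) two_ne_zero).1 this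
    calc ‖y‖ * Real.cosh y.im ≤ (2 * |y.im|) * (2 * ‖Complex.sin y‖) := by
          gcongr
          linarith
      _ ≤ _ := by nlinarith [mul_nonneg (abs_nonneg y.im) (norm_nonneg (Complex.sin y)),
                    norm_nonneg (Complex.sin y)]

theorem norm_mehler_le_of_cos_eq_zero {n k : ℕ} (hn : 1 ≤ n) {R : ℝ} (hR : 0 ≤ R) {y : ℂ}
    (h : Real.cos y.re = 0) (h' : |y.re| ≤ 10) :
    Complex.sin y ≠ 0 ∧
    ‖mehler (n + k) k R (-y ^ 2)‖ ≤ 2 * (10 * (1 + |y.im|)) ^ (n + k) * Real.exp (-|y.im|) := by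
  have hsin : ‖Complex.sin y‖ = Real.cosh y.im := by
    rw [← sq_eq_sq₀ (norm_nonneg _) (Real.cosh_pos _).le, ← Complex.normSq_eq_norm_sq, normSq_sin,
      Real.cosh_sq, Real.sin_sq, h]; ring
  have h0 : Complex.sin y ≠ 0 := norm_pos_iff.1 (hsin ▸ Real.cosh_pos _)
  refine ⟨h0, norm_mehler_le hn hR h0 ?_ ?_⟩
  · rw [re_mul_cos_div_sin, h]
    refine div_nonneg ?_ (Complex.normSq_nonneg _)
    have : 0 ≤ y.im * Real.sinh y.im := by
      rcases le_total 0 y.im with h0 | h0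
      · exact mul_nonneg h0 (Real.sinh_nonneg_iff.2 h0)
      · exact mul_nonneg_of_nonpos_of_nonpos h0 (Real.sinh_nonpos_iff.2 h0)
    nlinarith [mul_nonneg this (Real.cosh_pos y.im).le]
  · rw [hsin]
    have := Complex.norm_le_abs_re_add_abs_im y
    gcongr
    linarith [abs_nonneg y.im]

theorem norm_mehler_real_sq_le {n k : ℕ} (hn : 1 ≤ n) {R : ℝ} (hR : 0 ≤ R) {μ : ℝ} (hμ : 0 ≤ μ) :
    ‖mehler (n + k) k R ((μ : ℂ) ^ 2)‖ ≤ 2 * (10 * (1 + μ)) ^ (n + k) * Real.exp (-μ) := by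
  rcases hμ.eq_or_lt with rfl | hμ
  · have h : coshSqrt 0 = 1 := by simpa using coshSqrt_sq 0
    have : ‖mehler (n + k) k R (((0 : ℝ) : ℂ) ^ 2)‖ ≤ 1 := by
      simp [mehler, sinhcSqrt_zero, h, Complex.norm_exp, hR]
    refine this.trans ?_
    have : (1 : ℝ) ≤ (10 * (1 + 0)) ^ (n + k) := one_le_pow₀ (by norm_num)
    simp only [neg_zero, Real.exp_zero]
    linarith
  · have him : ((μ : ℂ) * Complex.I).im = μ := by simp
    have hre : ((μ : ℂ) * Complex.I).re = 0 := by simp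
    have hsin : ‖Complex.sin (μ * Complex.I)‖ = Real.sinh μ := by
      rw [Complex.sin_mul_I, ← Complex.ofReal_sinh]
      rw [norm_mul, Complex.norm_I, mul_one, Complex.norm_real, Real.norm_eq_abs,
        abs_of_pos (Real.sinh_pos_iff.2 hμ)]
    have hpos := Real.sinh_pos_iff.2 hμ
    have := norm_mehler_le (k := k) hn hR (y := μ * Complex.I) (norm_pos_iff.1 (hsin ▸ hpos)) ?_ ?_
    · rw [him, abs_of_pos hμ, mul_pow, Complex.I_sq] at this
      convert this using 3; ring
    · rw [re_mul_cos_div_sin, him, hre]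
      refine div_nonneg ?_ (Complex.normSq_nonneg _)
      have h2 := Real.cosh_pos μ
      rw [zero_mul, zero_add]
      exact mul_nonneg hμ.le (mul_nonneg hpos.le h2.le)
    · rw [hsin, him, norm_mul, Complex.norm_I, Complex.norm_real, Real.norm_eq_abs, abs_of_pos hμ]
      have a1 : μ ≤ Real.sinh μ := Real.self_le_sinh_iff.2 hμ.le
      have a2 : Real.cosh μ = Real.sinh μ + Real.exp (-μ) := by
        rw [← Real.cosh_sub_sinh]; ring
      have a3 : Real.exp (-μ) ≤ 1 := Real.exp_le_one_iff.2 (by linarith)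
      rw [a2]
      nlinarith [Real.exp_pos (-μ)]

/-! ### Primitives on convex sets and a contour shift -/

theorem exists_primitive {U : Set ℂ} (hU : IsOpen U) (hc : Convex ℝ U) {f : ℂ → ℂ}
    (hf : ∀ z ∈ U, DifferentiableAt ℂ f z) : ∃ g : ℂ → ℂ, ∀ z ∈ U, HasDerivAt g (f z) z := by
  obtain ⟨g, hg⟩ := hc.exists_forall_hasDerivWithinAt (𝕜 := ℂ) (f := f)
    fun z hz => (hf z hz).differentiableWithinAt
  exact ⟨g, fun z hz => (hg z hz).hasDerivAt (hU.mem_nhds hz)⟩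

theorem primitive_sub_eq {U V : Set ℂ} (hU : IsOpen U) (hV : IsOpen V) (hc : Convex ℝ U)
    (hc' : Convex ℝ V) {f g h : ℂ → ℂ} (hg : ∀ z ∈ U, HasDerivAt g (f z) z)
    (hh : ∀ z ∈ V, HasDerivAt h (f z) z) {a b : ℂ} (ha : a ∈ U ∩ V) (hb : b ∈ U ∩ V) :
    g b - g a = h b - h a := by
  have := (hU.inter hV).is_const_of_deriv_eq_zero (𝕜 := ℂ) (f := fun z => g z - h z)
    (hc.inter hc').isPreconnected
    (fun z hz => ((hg z hz.1).fun_sub (hh z hz.2)).differentiableAt.differentiableWithinAt)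
    (fun z hz => by rw [((hg z hz.1).fun_sub (hh z hz.2)).deriv]; simp) ha hb
  linear_combination -this

theorem integral_arc {U : Set ℂ} {f g : ℂ → ℂ} (hf : ∀ z ∈ U, DifferentiableAt ℂ f z)
    (hg : ∀ z ∈ U, HasDerivAt g (f z) z) {c : ℂ} {σ a b : ℝ}
    (h : ∀ θ ∈ uIcc a b, circleMap c σ θ ∈ U) :
    IntervalIntegrable (fun θ => f (circleMap c σ θ) * (circleMap 0 σ θ * Complex.I)) volume a b ∧
    ∫ θ in a..b, f (circleMap c σ θ) * (circleMap 0 σ θ * Complex.I) =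
      g (circleMap c σ b) - g (circleMap c σ a) := by
  have hi : IntervalIntegrable (fun θ => f (circleMap c σ θ) * (circleMap 0 σ θ * Complex.I))
      volume a b := by
    refine ContinuousOn.intervalIntegrable fun θ hθ => ContinuousAt.continuousWithinAt ?_
    refine ContinuousAt.mul ?_ (by fun_prop)
    exact ContinuousAt.comp (f := circleMap c σ) (hf _ (h θ hθ)).continuousAt (by fun_prop)
  exact ⟨hi, intervalIntegral.integral_eq_sub_of_hasDerivAt (f := fun θ => g (circleMap c σ θ))
    (fun θ hθ => (hg _ (h θ hθ)).comp θ (hasDerivAt_circleMap c σ θ)) hi⟩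

theorem integral_vertical {U : Set ℂ} {f g : ℂ → ℂ} (hf : ∀ z ∈ U, DifferentiableAt ℂ f z)
    (hg : ∀ z ∈ U, HasDerivAt g (f z) z) {a s T : ℝ}
    (h : ∀ b ∈ uIcc s T, (a + b * Complex.I : ℂ) ∈ U) :
    ∫ b in s..T, f (a + b * Complex.I) * Complex.I =
      g (a + T * Complex.I) - g (a + s * Complex.I) := by
  refine intervalIntegral.integral_eq_sub_of_hasDerivAt
    (f := fun b : ℝ => g (a + b * Complex.I)) (fun b hb => ?_) ?_
  · have h1 : HasDerivAt (fun b : ℝ => (a + b * Complex.I : ℂ)) Complex.I b := by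
      simpa using ((hasDerivAt_id b).ofReal_comp.mul_const Complex.I).const_add (a : ℂ)
    exact (hg _ (h b hb)).comp b h1
  · refine ContinuousOn.intervalIntegrable fun b hb => ContinuousAt.continuousWithinAt ?_
    refine ContinuousAt.mul ?_ (by fun_prop)
    exact ContinuousAt.comp (f := fun b : ℝ => (a + b * Complex.I : ℂ)) (hf _ (h b hb)).continuousAt
      (by fun_prop)

theorem norm_primitive_sub_le {U : Set ℂ} {f g : ℂ → ℂ}
    (hg : ∀ z ∈ U, HasDerivAt g (f z) z) {a b : ℂ} {C : ℝ}
    (h : ∀ z ∈ segment ℝ a b, z ∈ U ∧ ‖f z‖ ≤ C) : ‖g b - g a‖ ≤ C * ‖b - a‖ :=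
  Convex.norm_image_sub_le_of_norm_hasDerivWithin_le (𝕜 := ℂ) (s := segment ℝ a b) (f' := f)
    (fun z hz => (hg z (h z hz).1).hasDerivWithinAt) (fun z hz => (h z hz).2)
    (convex_segment a b) (left_mem_segment ℝ a b) (right_mem_segment ℝ a b)

theorem mem_segment_horizontal {a b T : ℝ} {z : ℂ}
    (hz : z ∈ segment ℝ (a + T * Complex.I : ℂ) (b + T * Complex.I)) :
    z.im = T ∧ z.re ∈ uIcc a b := by
  obtain ⟨u, v, hu, hv, huv, rfl⟩ := hz
  constructor
  · simp; rw [← add_mul, huv, one_mul]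
  · rw [← segment_eq_uIcc]
    exact ⟨u, v, hu, hv, huv, by simp⟩

theorem mem_segment_vertical {a b T : ℝ} {z : ℂ}
    (hz : z ∈ segment ℝ (T + a * Complex.I : ℂ) (T + b * Complex.I)) :
    z.re = T ∧ z.im ∈ uIcc a b := by
  obtain ⟨u, v, hu, hv, huv, rfl⟩ := hz
  constructor
  · simp; rw [← add_mul, huv, one_mul]
  · rw [← segment_eq_uIcc]
    exact ⟨u, v, hu, hv, huv, by simp⟩

/-- Residue-type identity: the difference of the integrals over two vertical lines on both sides of
an isolated singularity is the integral over a small circle. -/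
theorem integral_line_sub_integral_line {f : ℂ → ℂ} {p σ l L : ℝ} (hσ : 0 < σ) (hσl : σ < l)
    (hl : l < L) (hf : ∀ z : ℂ, |z.re - p| < L → z ≠ p → DifferentiableAt ℂ f z)
    (hi₁ : Integrable fun b : ℝ => f ((p - l : ℝ) + b * Complex.I))
    (hi₂ : Integrable fun b : ℝ => f ((p + l : ℝ) + b * Complex.I))
    (hlim : ∀ ε > 0, ∃ T₀ : ℝ, ∀ z : ℂ, |z.re - p| ≤ l → T₀ ≤ |z.im| → ‖f z‖ ≤ ε) :
    Complex.I * ((∫ b : ℝ, f ((p + l : ℝ) + b * Complex.I)) -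
        ∫ b : ℝ, f ((p - l : ℝ) + b * Complex.I)) =
      ∫ θ in (-(π / 4))..(7 * π / 4),
        f (circleMap p σ θ) * (circleMap 0 σ θ * Complex.I) := by
  have hπ := Real.pi_pos
  have hre : Continuous Complex.re := Complex.continuous_re
  have him : Continuous Complex.im := Complex.continuous_im
  let UR : Set ℂ := {z | p < z.re} ∩ {z | z.re < p + L}
  let UL : Set ℂ := {z | p - L < z.re} ∩ {z | z.re < p}
  let UU : Set ℂ := {z | 0 < z.im} ∩ ({z | p - L < z.re} ∩ {z | z.re < p + L})
  let UD : Set ℂ := {z | z.im < 0} ∩ ({z | p - L < z.re} ∩ {z | z.re < p + L})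
  have oR : IsOpen UR := (isOpen_lt continuous_const hre).inter (isOpen_lt hre continuous_const)
  have oL : IsOpen UL := (isOpen_lt continuous_const hre).inter (isOpen_lt hre continuous_const)
  have oU : IsOpen UU := (isOpen_lt continuous_const him).inter
    ((isOpen_lt continuous_const hre).inter (isOpen_lt hre continuous_const))
  have oD : IsOpen UD := (isOpen_lt him continuous_const).inter
    ((isOpen_lt continuous_const hre).inter (isOpen_lt hre continuous_const))
  have cR : Convex ℝ UR := (convex_halfSpace_re_gt _).inter (convex_halfSpace_re_lt _)
  have cL : Convex ℝ UL := (convex_halfSpace_re_gt _).inter (convex_halfSpace_re_lt _)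
  have cU : Convex ℝ UU := (convex_halfSpace_im_gt _).inter
    ((convex_halfSpace_re_gt _).inter (convex_halfSpace_re_lt _))
  have cD : Convex ℝ UD := (convex_halfSpace_im_lt _).inter
    ((convex_halfSpace_re_gt _).inter (convex_halfSpace_re_lt _))
  have fR : ∀ z ∈ UR, DifferentiableAt ℂ f z := fun z hz => hf z
    (by rw [abs_lt]; constructor <;> linarith [hz.1.out, hz.2.out])
    (by rintro rfl; simpa using hz.1.out)
  have fL : ∀ z ∈ UL, DifferentiableAt ℂ f z := fun z hz => hf z
    (by rw [abs_lt]; constructor <;> linarith [hz.1.out, hz.2.out])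
    (by rintro rfl; simpa using hz.2.out)
  have fU : ∀ z ∈ UU, DifferentiableAt ℂ f z := fun z hz => hf z
    (by rw [abs_lt]; constructor <;> linarith [hz.2.1.out, hz.2.2.out])
    (by rintro rfl; simpa using hz.1.out)
  have fD : ∀ z ∈ UD, DifferentiableAt ℂ f z := fun z hz => hf z
    (by rw [abs_lt]; constructor <;> linarith [hz.2.1.out, hz.2.2.out])
    (by rintro rfl; simpa using hz.1.out)
  obtain ⟨gR, hR⟩ := exists_primitive oR cR fR
  obtain ⟨gL, hL⟩ := exists_primitive oL cL fL
  obtain ⟨gU, hU⟩ := exists_primitive oU cU fU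
  obtain ⟨gD, hD⟩ := exists_primitive oD cD fD
  have cre : ∀ θ, (circleMap (p : ℂ) σ θ).re = p + σ * Real.cos θ := by
    intro θ; simp [circleMap, Complex.exp_ofReal_mul_I_re]
  have cim : ∀ θ, (circleMap (p : ℂ) σ θ).im = σ * Real.sin θ := by
    intro θ; simp [circleMap, Complex.exp_ofReal_mul_I_im]
  have b1 : ∀ θ, σ * Real.cos θ < L := fun θ => by nlinarith [Real.cos_le_one θ]
  have b2 : ∀ θ, -L < σ * Real.cos θ := fun θ => by nlinarith [Real.neg_one_le_cos θ]
  have mR : ∀ θ ∈ Icc (-(π / 4)) (π / 4), circleMap (p : ℂ) σ θ ∈ UR := fun θ hθ => by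
    have := mul_pos hσ (Real.cos_pos_of_mem_Ioo (x := θ) ⟨by linarith [hθ.1], by linarith [hθ.2]⟩)
    exact ⟨by simp only [mem_ofPred_eq, cre]; linarith,
      by simp only [mem_ofPred_eq, cre]; linarith [b1 θ]⟩
  have mU : ∀ θ ∈ Icc (π / 4) (3 * π / 4), circleMap (p : ℂ) σ θ ∈ UU := fun θ hθ => by
    have := mul_pos hσ (Real.sin_pos_of_mem_Ioo (x := θ) ⟨by linarith [hθ.1], by linarith [hθ.2]⟩)
    exact ⟨by simp only [mem_ofPred_eq, cim]; linarith,
      by simp only [mem_ofPred_eq, cre]; linarith [b2 θ],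
      by simp only [mem_ofPred_eq, cre]; linarith [b1 θ]⟩
  have mL : ∀ θ ∈ Icc (3 * π / 4) (5 * π / 4), circleMap (p : ℂ) σ θ ∈ UL := fun θ hθ => by
    have := mul_neg_of_pos_of_neg hσ (Real.cos_neg_of_pi_div_two_lt_of_lt (x := θ)
      (by linarith [hθ.1]) (by linarith [hθ.2]))
    exact ⟨by simp only [mem_ofPred_eq, cre]; linarith [b2 θ],
      by simp only [mem_ofPred_eq, cre]; linarith⟩
  have mD : ∀ θ ∈ Icc (5 * π / 4) (7 * π / 4), circleMap (p : ℂ) σ θ ∈ UD := fun θ hθ => by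
    have := mul_pos hσ (Real.sin_pos_of_mem_Ioo (x := θ - π)
      ⟨by linarith [hθ.1], by linarith [hθ.2]⟩)
    rw [Real.sin_sub_pi] at this
    exact ⟨by simp only [mem_ofPred_eq, cim]; linarith,
      by simp only [mem_ofPred_eq, cre]; linarith [b2 θ],
      by simp only [mem_ofPred_eq, cre]; linarith [b1 θ]⟩
  obtain ⟨iR, eR⟩ := integral_arc (c := p) (σ := σ) (a := -(π / 4)) (b := π / 4) fR hR
    (by rw [uIcc_of_le (by linarith)]; exact mR)
  obtain ⟨iU, eU⟩ := integral_arc (c := p) (σ := σ) (a := π / 4) (b := 3 * π / 4) fU hU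
    (by rw [uIcc_of_le (by linarith)]; exact mU)
  obtain ⟨iL, eL⟩ := integral_arc (c := p) (σ := σ) (a := 3 * π / 4) (b := 5 * π / 4) fL hL
    (by rw [uIcc_of_le (by linarith)]; exact mL)
  obtain ⟨iD, eD⟩ := integral_arc (c := p) (σ := σ) (a := 5 * π / 4) (b := 7 * π / 4) fD hD
    (by rw [uIcc_of_le (by linarith)]; exact mD)
  have ecirc := intervalIntegral.integral_add_adjacent_intervals
    (((iR.trans iU).trans iL)) iD
  rw [← intervalIntegral.integral_add_adjacent_intervals (iR.trans iU) iL,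
    ← intervalIntegral.integral_add_adjacent_intervals iR iU, eR, eU, eL, eD] at ecirc
  have hper : circleMap (p : ℂ) σ (7 * π / 4) = circleMap p σ (-(π / 4)) := by
    rw [← periodic_circleMap (p : ℂ) σ (-(π / 4))]; congr 1; ring
  rw [hper] at ecirc
  have key : ∀ T : ℝ, 0 < T →
      (∫ b in (-T)..T, f ((p + l : ℝ) + b * Complex.I) * Complex.I) -
        (∫ b in (-T)..T, f ((p - l : ℝ) + b * Complex.I) * Complex.I) -
      (∫ θ in (-(π / 4))..(7 * π / 4), f (circleMap p σ θ) * (circleMap 0 σ θ * Complex.I)) =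
      (gU ((p + l : ℝ) + T * Complex.I) - gU ((p - l : ℝ) + T * Complex.I)) -
      (gD ((p + l : ℝ) + (-T : ℝ) * Complex.I) - gD ((p - l : ℝ) + (-T : ℝ) * Complex.I)) := by
    intro T hT
    have nR : ∀ b : ℝ, ((p + l : ℝ) + b * Complex.I : ℂ) ∈ UR := fun b => by
      constructor <;> simp <;> linarith
    have nL : ∀ b : ℝ, ((p - l : ℝ) + b * Complex.I : ℂ) ∈ UL := fun b => by
      constructor <;> simp <;> linarith
    have nU1 : ((p + l : ℝ) + T * Complex.I : ℂ) ∈ UU := by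
      refine ⟨?_, ?_, ?_⟩ <;> simp <;> linarith
    have nU2 : ((p - l : ℝ) + T * Complex.I : ℂ) ∈ UU := by
      refine ⟨?_, ?_, ?_⟩ <;> simp <;> linarith
    have nD1 : ((p + l : ℝ) + (-T : ℝ) * Complex.I : ℂ) ∈ UD := by
      refine ⟨?_, ?_, ?_⟩ <;> simp <;> linarith
    have nD2 : ((p - l : ℝ) + (-T : ℝ) * Complex.I : ℂ) ∈ UD := by
      refine ⟨?_, ?_, ?_⟩ <;> simp <;> linarith
    have q1 := mR (-(π / 4)) ⟨by linarith, by linarith⟩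
    have q1' := mD (7 * π / 4) ⟨by linarith, by linarith⟩
    rw [hper] at q1'
    have q2 := mR (π / 4) ⟨by linarith, by linarith⟩
    have q2' := mU (π / 4) ⟨by linarith, by linarith⟩
    have q3 := mU (3 * π / 4) ⟨by linarith, by linarith⟩
    have q3' := mL (3 * π / 4) ⟨by linarith, by linarith⟩
    have q4 := mL (5 * π / 4) ⟨by linarith, by linarith⟩
    have q4' := mD (5 * π / 4) ⟨by linarith, by linarith⟩
    rw [integral_vertical fR hR (fun b _ => nR b), integral_vertical fL hL (fun b _ => nL b)]
    have s1 := primitive_sub_eq oR oU cR cU hR hU ⟨q2, q2'⟩ ⟨nR T, nU1⟩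
    have s2 := primitive_sub_eq oU oL cU cL hU hL ⟨nU2, nL T⟩ ⟨q3, q3'⟩
    have s3 := primitive_sub_eq oL oD cL cD hL hD ⟨q4, q4'⟩ ⟨nL (-T), nD2⟩
    have s4 := primitive_sub_eq oD oR cD cR hD hR ⟨nD1, nR (-T)⟩ ⟨q1', q1⟩
    linear_combination s1 - s2 + s3 - s4 + ecirc
  have t1 := (intervalIntegral_tendsto_integral hi₂ tendsto_neg_atTop_atBot tendsto_id).mul_const
    Complex.I
  have t2 := (intervalIntegral_tendsto_integral hi₁ tendsto_neg_atTop_atBot tendsto_id).mul_const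
    Complex.I
  have t3 := (t1.sub t2).sub_const
    (∫ θ in (-(π / 4))..(7 * π / 4), f (circleMap p σ θ) * (circleMap 0 σ θ * Complex.I))
  have t4 : Tendsto (fun T : ℝ => (∫ b in (-T)..T, f ((p + l : ℝ) + b * Complex.I)) * Complex.I -
        (∫ b in (-T)..T, f ((p - l : ℝ) + b * Complex.I)) * Complex.I -
      (∫ θ in (-(π / 4))..(7 * π / 4), f (circleMap p σ θ) * (circleMap 0 σ θ * Complex.I)))
      atTop (𝓝 0) := by
    rw [Metric.tendsto_atTop]
    intro ε hε
    have hL0 : 0 < l := hσ.trans hσl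
    obtain ⟨T₀, hT₀⟩ := hlim (ε / (8 * l)) (by positivity)
    refine ⟨max T₀ 1, fun T hT => ?_⟩
    have hT1 : 0 < T := by linarith [le_max_right T₀ 1]
    have hT2 : T₀ ≤ T := (le_max_left _ _).trans hT
    rw [dist_zero_right, ← intervalIntegral.integral_mul_const, ← intervalIntegral.integral_mul_const,
      key T hT1]
    have hn : ∀ b : ℝ, ‖((p + l : ℝ) + b * Complex.I : ℂ) - ((p - l : ℝ) + b * Complex.I)‖ =
        2 * l := by
      intro b
      have : ((p + l : ℝ) + b * Complex.I : ℂ) - ((p - l : ℝ) + b * Complex.I) = ((2 * l : ℝ) : ℂ) := by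
        push_cast; ring
      rw [this, Complex.norm_real, Real.norm_eq_abs, abs_of_pos (by linarith)]
    have e1 : ‖gU ((p + l : ℝ) + T * Complex.I) - gU ((p - l : ℝ) + T * Complex.I)‖ ≤
        ε / (8 * l) * (2 * l) := by
      rw [← hn T]
      refine norm_primitive_sub_le hU fun z hz => ?_
      obtain ⟨z1, z2⟩ := mem_segment_horizontal hz
      rw [uIcc_of_le (by linarith)] at z2
      refine ⟨⟨?_, ?_, ?_⟩, hT₀ z ?_ ?_⟩
      · simp [z1, hT1]
      · simp only [mem_ofPred_eq]; linarith [z2.1]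
      · simp only [mem_ofPred_eq]; linarith [z2.2]
      · rw [abs_le]; constructor <;> linarith [z2.1, z2.2]
      · rw [z1, abs_of_pos hT1]; exact hT2
    have e2 : ‖gD ((p + l : ℝ) + (-T : ℝ) * Complex.I) - gD ((p - l : ℝ) + (-T : ℝ) * Complex.I)‖ ≤
        ε / (8 * l) * (2 * l) := by
      rw [← hn (-T)]
      refine norm_primitive_sub_le hD fun z hz => ?_
      obtain ⟨z1, z2⟩ := mem_segment_horizontal hz
      rw [uIcc_of_le (by linarith)] at z2
      refine ⟨⟨?_, ?_, ?_⟩, hT₀ z ?_ ?_⟩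
      · simp [z1, hT1]
      · simp only [mem_ofPred_eq]; linarith [z2.1]
      · simp only [mem_ofPred_eq]; linarith [z2.2]
      · rw [abs_le]; constructor <;> linarith [z2.1, z2.2]
      · rw [z1, abs_neg, abs_of_pos hT1]; exact hT2
    have e3 : ε / (8 * l) * (2 * l) = ε / 4 := by field_simp; norm_num
    refine (norm_sub_le _ _).trans_lt ?_
    rw [e3] at e1 e2
    linarith
  have := tendsto_nhds_unique t3 t4
  linear_combination this

/-! ### Exponential bounds -/

theorem exists_one_add_pow_le (K : ℕ) {a : ℝ} (ha : 0 < a) :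
    ∃ C : ℝ, 0 < C ∧ ∀ b : ℝ, 0 ≤ b → (1 + b) ^ K ≤ C * Real.exp (a * b) := by
  refine ⟨K.factorial * Real.exp a / a ^ K, by positivity, fun b hb => ?_⟩
  have h := Real.pow_div_factorial_le_exp (x := a * (1 + b)) (by positivity) K
  rw [div_le_iff₀ (by positivity), mul_pow, mul_add, Real.exp_add, mul_one] at h
  rw [div_mul_eq_mul_div, le_div_iff₀ (by positivity)]
  linarith

theorem integrable_exp_neg_mul_norm {E : Type*} [NormedAddCommGroup E] [NormedSpace ℝ E]
    [FiniteDimensional ℝ E] [MeasurableSpace E] [BorelSpace E] (μ : Measure E)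
    [μ.IsAddHaarMeasure] {a : ℝ} (ha : 0 < a) :
    Integrable (fun v : E => Real.exp (-(a * ‖v‖))) μ := by
  obtain ⟨C, hC, h⟩ := exists_one_add_pow_le (Module.finrank ℝ E + 1) ha
  have h1 : Integrable (fun v : E => C * (1 + ‖v‖) ^ (-((Module.finrank ℝ E + 1 : ℕ) : ℝ))) μ :=
    (integrable_one_add_norm (by push_cast; linarith)).const_mul C
  refine h1.mono' (by fun_prop) (Eventually.of_forall fun v => ?_)
  have h2 := h ‖v‖ (norm_nonneg v)
  rw [Real.norm_eq_abs, abs_of_pos (Real.exp_pos _), Real.rpow_neg (by positivity),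
    Real.rpow_natCast, Real.exp_neg, ← div_eq_mul_inv, le_div_iff₀ (by positivity)]
  have := Real.exp_pos (a * ‖v‖)
  rw [inv_mul_le_iff₀ this]; linarith

theorem integrable_exp_neg_mul_abs {a : ℝ} (ha : 0 < a) :
    Integrable (fun b : ℝ => Real.exp (-(a * |b|))) := by
  simpa using integrable_exp_neg_mul_norm (volume : Measure ℝ) ha

/-! ### The one-dimensional integrand and its shifted form -/

theorem exists_of_sinhcSqrt_eq_zero {w : ℂ} (h : sinhcSqrt w = 0) :
    ∃ j : ℤ, j ≠ 0 ∧ w = -((j : ℂ) * π) ^ 2 := by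
  have h1 : -(Complex.sqrt (-w)) ^ 2 = w := by rw [complexSqrt_pow_two]; ring
  have h2 := mul_sinhcSqrt_neg_sq (Complex.sqrt (-w))
  rw [h1, h, mul_zero] at h2
  obtain ⟨j, hj⟩ := Complex.sin_eq_zero_iff.1 h2.symm
  refine ⟨j, ?_, by rw [← hj, h1]⟩
  rintro rfl
  rw [hj] at h1
  simp at h1
  rw [← h1, sinhcSqrt_zero] at h
  exact one_ne_zero h

theorem sinhcSqrt_sq_add_sq_ne_zero {r : ℝ} {l : ℂ} (hl : l.im ^ 2 < π ^ 2 + r ^ 2) :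
    sinhcSqrt (l ^ 2 + (r : ℂ) ^ 2) ≠ 0 := by
  intro h
  obtain ⟨j, hj, h⟩ := exists_of_sinhcSqrt_eq_zero h
  have h1 := congrArg Complex.re h
  have h2 := congrArg Complex.im h
  have hc : ((j : ℂ) * π) = (((j : ℝ) * π : ℝ) : ℂ) := by push_cast; rfl
  rw [hc] at h1 h2
  simp only [pow_two, Complex.add_re, Complex.mul_re, Complex.neg_re, Complex.ofReal_re,
    Complex.ofReal_im, Complex.add_im, Complex.mul_im, Complex.neg_im] at h1 h2
  have h3 : l.re * l.im = 0 := by linarith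
  have hj2 : (1 : ℝ) ≤ (j : ℝ) ^ 2 := by
    have : 1 ≤ j ^ 2 := by have := sq_nonneg j; have : j ^ 2 ≠ 0 := pow_ne_zero 2 hj; omega
    exact_mod_cast this
  have hπ := Real.pi_pos
  rcases mul_eq_zero.1 h3 with h4 | h4
  · rw [h4] at h1; nlinarith [mul_pos hπ hπ]
  · rw [h4] at h1; nlinarith [mul_pos hπ hπ, sq_nonneg l.re, sq_nonneg r]

/-- The integrand of the heat kernel on the line in direction `t`, at distance `r` from the axis. -/
noncomputable def lineIntegrand (N k₁ k : ℕ) (R t r : ℝ) (l : ℂ) : ℂ :=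
  Complex.exp (Complex.I * t * l) * l ^ k * mehler N k₁ R (l ^ 2 + (r : ℂ) ^ 2)

/-- `lineIntegrand` after the substitution `l = i √(y² + r²)`. -/
noncomputable def shiftIntegrand (N k₁ k : ℕ) (R t r : ℝ) (y : ℂ) : ℂ :=
  mehler N k₁ R (-y ^ 2) * Complex.exp (-(t * shiftRoot r y)) * (Complex.I * shiftRoot r y) ^ k *
    (y / shiftRoot r y)

theorem differentiableAt_lineIntegrand (N k₁ k : ℕ) (R t : ℝ) {r : ℝ} {l : ℂ}
    (hl : l.im ^ 2 < π ^ 2 + r ^ 2) : DifferentiableAt ℂ (lineIntegrand N k₁ k R t r) l := by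
  have h := DifferentiableAt.comp l (f := fun l : ℂ => l ^ 2 + (r : ℂ) ^ 2)
    (differentiableAt_mehler N k₁ R (sinhcSqrt_sq_add_sq_ne_zero hl)) (by fun_prop)
  unfold lineIntegrand
  exact DifferentiableAt.mul (by fun_prop) h

theorem differentiableAt_shiftIntegrand (N k₁ k : ℕ) (R t r : ℝ) {y : ℂ} (hy : 0 < y.re)
    (hs : Complex.sin y ≠ 0) : DifferentiableAt ℂ (shiftIntegrand N k₁ k R t r) y := by
  have h := DifferentiableAt.comp y (f := fun y : ℂ => -y ^ 2)
    (differentiableAt_mehler N k₁ R (sinhcSqrt_neg_sq_ne_zero hs)) (by fun_prop)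
  have h2 := (hasDerivAt_shiftRoot r hy).differentiableAt
  have h3 := shiftRoot_ne_zero r hy
  have h4 : DifferentiableAt ℂ (fun y => Complex.exp (-(t * shiftRoot r y)) *
    (Complex.I * shiftRoot r y) ^ k * (y / shiftRoot r y)) y := by
      fun_prop (disch := assumption)
  have := h.fun_mul h4
  refine this.congr_of_eventuallyEq (Eventually.of_forall fun z => ?_)
  simp only [shiftIntegrand, Function.comp]; ring

theorem exists_norm_shiftIntegrand_le (n k₁ k : ℕ) : ∃ C : ℝ, 0 < C ∧
    ∀ (R t r : ℝ) (y : ℂ), 1 ≤ t → 0 ≤ r → 1 ≤ y.re → y.re ≤ 10 →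
      ‖mehler (n + k₁) k₁ R (-y ^ 2)‖ ≤ 2 * (10 * (1 + |y.im|)) ^ (n + k₁) * Real.exp (-|y.im|) →
      ‖shiftIntegrand (n + k₁) k₁ k R t r y‖ ≤ C * Real.exp (-(4⁻¹ * |y.im|)) *
        Real.exp (-(4⁻¹ * r)) * Real.exp (-((t - 1 / 2) * y.re)) := by
  obtain ⟨C₁, hC₁, h₁⟩ := exists_one_add_pow_le (n + k₁ + (k + 1)) (a := 4⁻¹) (by norm_num)
  obtain ⟨C₂, hC₂, h₂⟩ := exists_one_add_pow_le (k + 1) (a := 4⁻¹) (by norm_num)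
  refine ⟨2 * 10 ^ (n + k₁) * 10 ^ (k + 1) * C₁ * C₂, by positivity, fun R t r y ht hr hy hy' hm => ?_⟩
  have hY := re_le_shiftRoot_re r (y := y) (by linarith)
  have hY2 := le_shiftRoot_re (r := r) (y := y)
  have hYn := Complex.re_le_norm (shiftRoot r y)
  have hYpos : 0 < ‖shiftRoot r y‖ := by linarith
  have hyn : ‖y‖ ≤ 10 + |y.im| := by
    have := Complex.norm_le_abs_re_add_abs_im y
    rw [abs_of_pos (by linarith : 0 < y.re)] at this; linarith
  have hb := abs_nonneg y.im
  set b := |y.im|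
  have hYu : ‖shiftRoot r y‖ ≤ 10 * (1 + b) * (1 + r) := by
    have := norm_shiftRoot_le r y
    rw [abs_of_nonneg hr] at this
    nlinarith [mul_nonneg hb hr]
  have e1 : ‖y‖ / ‖shiftRoot r y‖ ≤ 10 * (1 + b) * (1 + r) := by
    rw [div_le_iff₀ hYpos]
    have : 1 ≤ ‖shiftRoot r y‖ := by linarith
    calc ‖y‖ ≤ 10 * (1 + b) * (1 + r) * 1 := by nlinarith [mul_nonneg hb hr]
      _ ≤ _ := by gcongr
  have e2 : ‖Complex.exp (-(t * shiftRoot r y))‖ ≤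
      Real.exp (-((t - 1 / 2) * y.re)) * Real.exp (-((r - b) / 2)) := by
    rw [Complex.norm_exp, Complex.neg_re, Complex.re_ofReal_mul, ← Real.exp_add]
    apply Real.exp_le_exp.2
    nlinarith
  rw [shiftIntegrand, norm_mul, norm_mul, norm_mul, norm_pow, norm_mul, Complex.norm_I, one_mul,
    norm_div]
  have h3 := h₁ b hb
  have h4 := h₂ r hr
  have e5 : Real.exp (-b) * Real.exp (-((r - b) / 2)) * Real.exp (4⁻¹ * b) * Real.exp (4⁻¹ * r) =
      Real.exp (-(4⁻¹ * b)) * Real.exp (-(4⁻¹ * r)) := by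
    simp only [← Real.exp_add]; congr 1; ring
  calc _ ≤ 2 * (10 * (1 + b)) ^ (n + k₁) * Real.exp (-b) *
        (Real.exp (-((t - 1 / 2) * y.re)) * Real.exp (-((r - b) / 2))) *
        (10 * (1 + b) * (1 + r)) ^ k * (10 * (1 + b) * (1 + r)) := by gcongr
    _ = 2 * 10 ^ (n + k₁) * 10 ^ (k + 1) * (1 + b) ^ (n + k₁ + (k + 1)) * (1 + r) ^ (k + 1) *
        (Real.exp (-b) * Real.exp (-((r - b) / 2))) * Real.exp (-((t - 1 / 2) * y.re)) := by
      simp only [mul_pow, pow_add]; ring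
    _ ≤ 2 * 10 ^ (n + k₁) * 10 ^ (k + 1) * (C₁ * Real.exp (4⁻¹ * b)) * (C₂ * Real.exp (4⁻¹ * r)) *
        (Real.exp (-b) * Real.exp (-((r - b) / 2))) * Real.exp (-((t - 1 / 2) * y.re)) := by gcongr
    _ = _ := by linear_combination (2 * 10 ^ (n + k₁) * 10 ^ (k + 1) * C₁ * C₂ *
                  Real.exp (-((t - 1 / 2) * y.re))) * e5

theorem exists_norm_lineIntegrand_le (n k₁ k : ℕ) (hn : 1 ≤ n) : ∃ C : ℝ, 0 < C ∧
    ∀ (R t r l : ℝ), 0 ≤ R → 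
      ‖lineIntegrand (n + k₁) k₁ k R t r l‖ ≤ C * Real.exp (-(2⁻¹ * √(l ^ 2 + r ^ 2))) := by
  obtain ⟨C₁, hC₁, h₁⟩ := exists_one_add_pow_le (n + k₁ + k) (a := 2⁻¹) (by norm_num)
  refine ⟨2 * 10 ^ (n + k₁) * C₁, by positivity, fun R t r l hR => ?_⟩
  set μ := √(l ^ 2 + r ^ 2) with hμ
  have hμ0 : 0 ≤ μ := Real.sqrt_nonneg _
  have hsq : ((l : ℂ) ^ 2 + (r : ℂ) ^ 2) = (μ : ℂ) ^ 2 := by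
    have : μ ^ 2 = l ^ 2 + r ^ 2 := Real.sq_sqrt (by positivity)
    exact_mod_cast this.symm
  have hm := norm_mehler_real_sq_le (k := k₁) hn hR hμ0
  have hl : |l| ≤ 1 + μ := by
    have : |l| ≤ μ := Real.abs_le_sqrt (by nlinarith [sq_nonneg r])
    linarith
  have he : ‖Complex.exp (Complex.I * t * l)‖ = 1 := by
    rw [Complex.norm_exp]; simp
  rw [lineIntegrand, hsq, norm_mul, norm_mul, he, one_mul, norm_pow, Complex.norm_real,
    Real.norm_eq_abs]
  have e5 : Real.exp (-μ) * Real.exp (2⁻¹ * μ) = Real.exp (-(2⁻¹ * μ)) := by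
    simp only [← Real.exp_add]; congr 1; ring
  calc _ ≤ (1 + μ) ^ k * (2 * (10 * (1 + μ)) ^ (n + k₁) * Real.exp (-μ)) := by gcongr
    _ = 2 * 10 ^ (n + k₁) * (1 + μ) ^ (n + k₁ + k) * Real.exp (-μ) := by
      simp only [mul_pow, pow_add]; ring
    _ ≤ 2 * 10 ^ (n + k₁) * (C₁ * Real.exp (2⁻¹ * μ)) * Real.exp (-μ) := by
      have := h₁ μ hμ0
      gcongr
    _ = _ := by linear_combination (2 * 10 ^ (n + k₁) * C₁) * e5

theorem exp_neg_sqrt_le (l r : ℝ) : Real.exp (-(2⁻¹ * √(l ^ 2 + r ^ 2))) ≤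
    Real.exp (-(4⁻¹ * |l|)) * Real.exp (-(4⁻¹ * |r|)) := by
  rw [← Real.exp_add]
  apply Real.exp_le_exp.2
  have h1 : |l| ≤ √(l ^ 2 + r ^ 2) := Real.abs_le_sqrt (by nlinarith [sq_nonneg r])
  have h2 : |r| ≤ √(l ^ 2 + r ^ 2) := Real.abs_le_sqrt (by nlinarith [sq_nonneg l])
  linarith

theorem continuous_lineIntegrand (N k₁ k : ℕ) (R t r : ℝ) :
    Continuous fun l : ℝ => lineIntegrand N k₁ k R t r l := by
  refine continuous_iff_continuousAt.2 fun l => ?_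
  have : ((l : ℂ)).im ^ 2 < π ^ 2 + r ^ 2 := by simp; positivity
  exact ContinuousAt.comp (f := fun l : ℝ => (l : ℂ))
    (differentiableAt_lineIntegrand N k₁ k R t this).continuousAt (by fun_prop)

theorem integrable_lineIntegrand {n k₁ k : ℕ} (hn : 1 ≤ n) {R : ℝ} (hR : 0 ≤ R) (t r : ℝ) :
    Integrable fun l : ℝ => lineIntegrand (n + k₁) k₁ k R t r l := by
  obtain ⟨C, hC, h⟩ := exists_norm_lineIntegrand_le n k₁ k hn
  refine Integrable.mono' ((integrable_exp_neg_mul_abs (a := 4⁻¹) (by norm_num)).const_mul C)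
    (continuous_lineIntegrand _ _ _ _ _ _).aestronglyMeasurable (Eventually.of_forall fun l => ?_)
  refine (h R t r l hR).trans ?_
  have h1 := exp_neg_sqrt_le l r
  have h2 : Real.exp (-(4⁻¹ * |r|)) ≤ 1 := Real.exp_le_one_iff.2 (by linarith [abs_nonneg r])
  have h3 := Real.exp_pos (-(4⁻¹ * |l|))
  have : Real.exp (-(2⁻¹ * √(l ^ 2 + r ^ 2))) ≤ Real.exp (-(4⁻¹ * |l|)) := by nlinarith
  gcongr

theorem sin_ne_zero_of_cos_re_eq_zero {y : ℂ} (h : Real.cos y.re = 0) : Complex.sin y ≠ 0 := by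
  intro h0
  have := normSq_sin y
  rw [h0, map_zero, Real.sin_sq, h] at this
  nlinarith [sq_nonneg (Real.sinh y.im)]

theorem continuous_shiftIntegrand_line (N k₁ k : ℕ) (R t r : ℝ) {c : ℝ} (hc : 0 < c)
    (hc' : Real.cos c = 0) :
    Continuous fun b : ℝ => shiftIntegrand N k₁ k R t r (c + b * Complex.I) := by
  refine continuous_iff_continuousAt.2 fun b => ?_
  have h1 : ((c : ℂ) + b * Complex.I).re = c := by simp
  exact ContinuousAt.comp (f := fun b : ℝ => (c + b * Complex.I : ℂ))
    (differentiableAt_shiftIntegrand N k₁ k R t r (by rw [h1]; exact hc)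
      (sin_ne_zero_of_cos_re_eq_zero (by rw [h1]; exact hc'))).continuousAt (by fun_prop)

theorem exists_norm_shiftIntegrand_line_le (n k₁ k : ℕ) (hn : 1 ≤ n) : ∃ C : ℝ, 0 < C ∧
    ∀ (R t r c b : ℝ), 0 ≤ R → 1 ≤ t → 0 ≤ r → 1 ≤ c → c ≤ 10 → Real.cos c = 0 →
      ‖shiftIntegrand (n + k₁) k₁ k R t r (c + b * Complex.I)‖ ≤ C * Real.exp (-(4⁻¹ * |b|)) *
        Real.exp (-(4⁻¹ * r)) * Real.exp (-((t - 1 / 2) * c)) := by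
  obtain ⟨C, hC, h⟩ := exists_norm_shiftIntegrand_le n k₁ k
  refine ⟨C, hC, fun R t r c b hR ht hr hc hc' hcos => ?_⟩
  have h1 : ((c : ℂ) + b * Complex.I).re = c := by simp
  have h2 : ((c : ℂ) + b * Complex.I).im = b := by simp
  have := h R t r (c + b * Complex.I) ht hr (by rwa [h1]) (by rwa [h1])
    (norm_mehler_le_of_cos_eq_zero hn hR (by rwa [h1])
      (by rw [h1, abs_of_pos (by linarith)]; exact hc')).2
  rwa [h1, h2] at this

theorem integrable_shiftIntegrand_line {n k₁ k : ℕ} (hn : 1 ≤ n) {R t r c : ℝ} (hR : 0 ≤ R)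
    (ht : 1 ≤ t) (hr : 0 ≤ r) (hc : 1 ≤ c) (hc' : c ≤ 10) (hcos : Real.cos c = 0) :
    Integrable fun b : ℝ => shiftIntegrand (n + k₁) k₁ k R t r (c + b * Complex.I) := by
  obtain ⟨C, hC, h⟩ := exists_norm_shiftIntegrand_line_le n k₁ k hn
  refine Integrable.mono' (((integrable_exp_neg_mul_abs (a := 4⁻¹) (by norm_num)).const_mul
    (C * Real.exp (-(4⁻¹ * r)) * Real.exp (-((t - 1 / 2) * c)))))
    (continuous_shiftIntegrand_line _ _ _ _ _ _ (by linarith) hcos).aestronglyMeasurable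
    (Eventually.of_forall fun b => ?_)
  refine (h R t r c b hR ht hr hc hc' hcos).trans (le_of_eq (by ring))

/-! ### Shifting the contour -/

theorem exists_lineIntegrand_small (n k₁ k : ℕ) (hn : 1 ≤ n) {R t r A : ℝ} (hR : 0 ≤ R)
    (ht : 0 ≤ t) {ε : ℝ} (hε : 0 < ε) : ∃ B₀ : ℝ, ∀ l : ℂ, B₀ ≤ |l.re| → 0 ≤ l.im → l.im ≤ A →
      ‖lineIntegrand (n + k₁) k₁ k R t r l‖ ≤ ε := by
  obtain ⟨C₁, hC₁, h₁⟩ := exists_one_add_pow_le (n + k₁ + k) (a := 2⁻¹) (by norm_num)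
  have hlim : Tendsto (fun b : ℝ => 2 * 10 ^ (n + k₁) * 4 ^ k * C₁ * Real.exp (-(2⁻¹ * b)))
      atTop (𝓝 (2 * 10 ^ (n + k₁) * 4 ^ k * C₁ * 0)) := by
    refine Tendsto.const_mul _ (Real.tendsto_exp_atBot.comp ?_)
    exact tendsto_neg_atTop_atBot.comp (tendsto_id.const_mul_atTop (by norm_num))
  rw [mul_zero] at hlim
  obtain ⟨b₀, hb₀⟩ := eventually_atTop.1 (hlim.eventually (eventually_le_nhds hε))
  refine ⟨max (2 * |b₀|) (2 * |A| + 2 ), fun l hl h0 hA => ?_⟩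
  have hB1 := (le_max_left _ _).trans hl
  have hB2 := (le_max_right _ _).trans hl
  have hAa := le_abs_self A
  have hAn := abs_nonneg A
  set y := Complex.sqrt (-(l ^ 2 + (r : ℂ) ^ 2)) with hy
  have hysq : -y ^ 2 = l ^ 2 + (r : ℂ) ^ 2 := by rw [hy, complexSqrt_pow_two]; ring
  have hre := congrArg Complex.re hysq
  simp only [pow_two, Complex.add_re, Complex.mul_re, Complex.neg_re, Complex.ofReal_re,
    Complex.ofReal_im, mul_zero, sub_zero] at hre
  have hB : |l.re| ^ 2 = l.re * l.re := by rw [sq_abs, pow_two]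
  have hyi : |y.im| ^ 2 = y.im * y.im := by rw [sq_abs, pow_two]
  have hyr : |y.re| ^ 2 = y.re * y.re := by rw [sq_abs, pow_two]
  have him2 : l.im * l.im ≤ |A| * |A| := by nlinarith
  have c1 : |l.re| / 2 ≤ |y.im| := by
    refine abs_le_of_sq_le_sq' ?_ (abs_nonneg _) |>.2
    nlinarith [sq_nonneg |y.re|, mul_self_nonneg r]
  have c2 : |y.re| ≤ |y.im| := by
    refine abs_le_of_sq_le_sq' ?_ (abs_nonneg _) |>.2
    nlinarith [mul_self_nonneg r]
  have c3 : 1 ≤ |y.im| := by linarith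
  have hm := norm_mehler_le_of_abs_re_le (k := k₁) hn hR c2 c3
  have hb := abs_nonneg y.im
  have hl' : ‖l‖ ≤ 4 * (1 + |y.im|) := by
    have := Complex.norm_le_abs_re_add_abs_im l
    rw [abs_of_nonneg h0] at this
    linarith
  rw [hysq] at hm
  have he : ‖Complex.exp (Complex.I * t * l)‖ ≤ 1 := by
    rw [Complex.norm_exp]; simp; positivity
  have hb0 : b₀ ≤ |y.im| := by linarith [le_abs_self b₀]
  have hfin := hb₀ _ hb0
  set b := |y.im|
  have e5 : Real.exp (-b) * Real.exp (2⁻¹ * b) = Real.exp (-(2⁻¹ * b)) := by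
    simp only [← Real.exp_add]; congr 1; ring
  refine le_trans ?_ hfin
  rw [lineIntegrand, norm_mul, norm_mul, norm_pow]
  calc _ ≤ 1 * (4 * (1 + b)) ^ k * (2 * (10 * (1 + b)) ^ (n + k₁) * Real.exp (-b)) := by gcongr
    _ = 2 * 10 ^ (n + k₁) * 4 ^ k * (1 + b) ^ (n + k₁ + k) * Real.exp (-b) := by
      simp only [mul_pow, pow_add]; ring
    _ ≤ 2 * 10 ^ (n + k₁) * 4 ^ k * (C₁ * Real.exp (2⁻¹ * b)) * Real.exp (-b) := by
      have := h₁ b hb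
      gcongr
    _ = _ := by linear_combination (2 * 10 ^ (n + k₁) * 4 ^ k * C₁) * e5

theorem lineIntegrand_I_mul_shiftRoot (N k₁ k : ℕ) (R t r : ℝ) (y : ℂ) :
    lineIntegrand N k₁ k R t r (Complex.I * shiftRoot r y) * (y / shiftRoot r y) =
      shiftIntegrand N k₁ k R t r y := by
  have h1 : (Complex.I * shiftRoot r y) ^ 2 + (r : ℂ) ^ 2 = -y ^ 2 := by
    rw [mul_pow, Complex.I_sq, shiftRoot_sq]; ring
  have h2 : Complex.I * t * (Complex.I * shiftRoot r y) = -(t * shiftRoot r y) := by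
    linear_combination (t * shiftRoot r y) * Complex.I_sq
  rw [lineIntegrand, shiftIntegrand, h1, h2]; ring

theorem abs_shiftRoot_im_ge {r : ℝ} (hr : 0 ≤ r) {y : ℂ} (hy : 0 < y.re) :
    |y.im| - r ≤ |(shiftRoot r y).im| := by
  have h1 := shiftRoot_sq_re r y
  have h2 := re_le_shiftRoot_re r hy
  by_contra! h
  have h3 := abs_nonneg (shiftRoot r y).im
  nlinarith [sq_abs y.im, sq_abs (shiftRoot r y).im]

theorem integral_lineIntegrand_eq {n k₁ k : ℕ} (hn : 1 ≤ n) {R t r : ℝ} (hR : 0 ≤ R)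
    (ht : 1 ≤ t) (hr : 0 ≤ r) :
    ∫ l : ℝ, lineIntegrand (n + k₁) k₁ k R t r l =
      ∫ b : ℝ, shiftIntegrand (n + k₁) k₁ k R t r ((π / 2 : ℝ) + b * Complex.I) := by
  have hπ := Real.pi_pos
  have hπ3 := Real.pi_gt_three
  have hπ4 := Real.pi_lt_four
  set f := lineIntegrand (n + k₁) k₁ k R t r with hf
  set Q := shiftIntegrand (n + k₁) k₁ k R t r with hQ
  set c := √(π ^ 2 + r ^ 2) with hc
  have hc2 : c ^ 2 = π ^ 2 + r ^ 2 := Real.sq_sqrt (by positivity)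
  have hc0 : 0 < c := Real.sqrt_pos.2 (by positivity)
  have him : Continuous Complex.im := Complex.continuous_im
  let U : Set ℂ := {z | -c < z.im} ∩ {z | z.im < c}
  have oU : IsOpen U := (isOpen_lt continuous_const him).inter (isOpen_lt him continuous_const)
  have cU : Convex ℝ U := (convex_halfSpace_im_gt _).inter (convex_halfSpace_im_lt _)
  have fU : ∀ z ∈ U, DifferentiableAt ℂ f z := fun z hz => by
    refine differentiableAt_lineIntegrand _ _ _ _ _ ?_
    rw [← hc2]; exact sq_lt_sq' hz.1 hz.2
  obtain ⟨g, hg⟩ := exists_primitive oU cU fU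
  let y : ℝ → ℂ := fun b => ((π / 2 : ℝ) : ℂ) + b * Complex.I
  let Y : ℝ → ℂ := fun b => shiftRoot r (y b)
  have yre : ∀ b, (y b).re = π / 2 := fun b => by simp [y]
  have yim : ∀ b, (y b).im = b := fun b => by simp [y]
  have ypos : ∀ b, 0 < (y b).re := fun b => by rw [yre]; positivity
  have Yre0 : ∀ b, 0 < (Y b).re := fun b => shiftRoot_re_pos r (ypos b)
  have Yre1 : ∀ b, (Y b).re < c := fun b => by
    have h := shiftRoot_re_sq_le r (ypos b)
    rw [yre] at h
    refine lt_of_pow_lt_pow_left₀ 2 hc0.le ?_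
    rw [hc2]; show (shiftRoot r (y b)).re ^ 2 < _; nlinarith
  have mU : ∀ b, Complex.I * Y b ∈ U := fun b => by
    constructor <;> simp <;> linarith [Yre0 b, Yre1 b]
  have hder : ∀ b, HasDerivAt (fun b : ℝ => g (Complex.I * Y b)) (-Q (y b)) b := by
    intro b
    have h1 : HasDerivAt y Complex.I b := by
      simpa [y] using ((hasDerivAt_id b).ofReal_comp.mul_const Complex.I).const_add
        ((π / 2 : ℝ) : ℂ)
    have h2 : HasDerivAt (fun b : ℝ => Complex.I * Y b)
        (Complex.I * (y b / Y b * Complex.I)) b :=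
      ((hasDerivAt_shiftRoot r (ypos b)).comp b h1).const_mul Complex.I
    have h3 := (hg _ (mU b)).comp b h2
    have h4 : -Q (y b) = f (Complex.I * Y b) * (Complex.I * (y b / Y b * Complex.I)) := by
      rw [hQ, ← lineIntegrand_I_mul_shiftRoot]
      linear_combination (-f (Complex.I * Y b) * (y b / Y b)) * Complex.I_mul_I
    rw [h4]; exact h3
  have iQ : Integrable fun b : ℝ => Q (y b) :=
    integrable_shiftIntegrand_line hn hR ht hr (by linarith) (by linarith) Real.cos_pi_div_two
  have key1 : ∀ T : ℝ, ∫ b in (-T)..T, Q (y b) = g (Complex.I * Y (-T)) - g (Complex.I * Y T) := by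
    intro T
    have h := intervalIntegral.integral_eq_sub_of_hasDerivAt (fun b _ => hder b)
      (iQ.neg.intervalIntegrable (a := -T) (b := T))
    simp only [intervalIntegral.integral_neg] at h
    linear_combination -h
  have key2 : ∀ a b : ℝ, ∫ l in a..b, f l = g b - g a := by
    intro a b
    refine intervalIntegral.integral_eq_sub_of_hasDerivAt (f := fun x : ℝ => g x) (fun x _ => ?_)
      ((continuous_lineIntegrand _ _ _ _ _ _).intervalIntegrable _ _)
    exact (hg x (by constructor <;> simp [hc0])).comp_ofReal
  have ht0 : 0 ≤ t := by linarith
  have Yim_pos : ∀ T, 0 < T → T - r ≤ (Y T).im ∧ T - r ≤ -(Y (-T)).im := by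
    intro T hT
    have s1 := shiftRoot_sq_im r (y T)
    have s2 := shiftRoot_sq_im r (y (-T))
    rw [yre, yim] at s1 s2
    have g1 := abs_shiftRoot_im_ge hr (ypos T)
    have g2 := abs_shiftRoot_im_ge hr (ypos (-T))
    rw [yim] at g1 g2
    rw [abs_neg] at g2
    rw [abs_of_pos hT] at g1 g2
    have p1 : 0 < (Y T).im := by
      have := Yre0 T
      refine pos_of_mul_pos_right (a := (Y T).re) ?_ this.le
      rw [s1]; positivity
    have p2 : (Y (-T)).im < 0 := by
      have := Yre0 (-T)
      by_contra! h
      have : 0 ≤ (Y (-T)).re * (Y (-T)).im := mul_nonneg this.le h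
      rw [s2] at this
      nlinarith [mul_pos hπ hT]
    rw [abs_of_pos p1] at g1
    rw [abs_of_neg p2] at g2
    exact ⟨g1, g2⟩
  have t1 : Tendsto (fun T => -(Y T).im) atTop atBot := by
    refine tendsto_neg_atTop_atBot.comp (tendsto_atTop_mono' _ ?_
      (tendsto_atTop_add_const_right atTop (-r) tendsto_id))
    filter_upwards [eventually_gt_atTop 0] with T hT
    exact (Yim_pos T hT).1
  have t2 : Tendsto (fun T => -(Y (-T)).im) atTop atTop := by
    refine (tendsto_atTop_mono' _ ?_ (tendsto_atTop_add_const_right atTop (-r) tendsto_id))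
    filter_upwards [eventually_gt_atTop 0] with T hT
    exact (Yim_pos T hT).2
  have l1 := intervalIntegral_tendsto_integral (integrable_lineIntegrand (k₁ := k₁) (k := k) hn hR t r) t1 t2
  have l2 := intervalIntegral_tendsto_integral iQ tendsto_neg_atTop_atBot tendsto_id
  have l3 : Tendsto (fun T : ℝ => (∫ l in (-(Y T).im)..(-(Y (-T)).im), f l) -
      ∫ b in (-T)..T, Q (y b)) atTop (𝓝 0) := by
    rw [Metric.tendsto_atTop]
    intro ε hε
    obtain ⟨B₀, hB₀⟩ := exists_lineIntegrand_small n k₁ k hn (r := r) (A := c) hR ht0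
      (ε := ε / (4 * c)) (by positivity)
    refine ⟨|B₀| + r + 1, fun T hT => ?_⟩
    have hT0 : 0 < T := by linarith [abs_nonneg B₀]
    obtain ⟨y1, y2⟩ := Yim_pos T hT0
    have hB0 := le_abs_self B₀
    have hseg : ∀ s : ℝ, B₀ ≤ |(Y s).im| →
        ‖g (Complex.I * Y s) - g ((-(Y s).im : ℝ) : ℂ)‖ ≤ ε / (4 * c) * c := by
      intro s hs
      have e1 : Complex.I * Y s = ((-(Y s).im : ℝ) : ℂ) + (Y s).re * Complex.I := by
        apply Complex.ext <;> simp
      have e2 : ((-(Y s).im : ℝ) : ℂ) = ((-(Y s).im : ℝ) : ℂ) + (0 : ℝ) * Complex.I := by simp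
      have := norm_primitive_sub_le (C := ε / (4 * c)) hg
        (a := ((-(Y s).im : ℝ) : ℂ) + (0 : ℝ) * Complex.I)
        (b := ((-(Y s).im : ℝ) : ℂ) + (Y s).re * Complex.I) fun z hz => ?_
      · rw [← e1, ← e2] at this
        refine this.trans ?_
        gcongr
        rw [e1]
        simp only [add_sub_cancel_left, norm_mul, Complex.norm_I, mul_one, Complex.norm_real,
          Real.norm_eq_abs]
        rw [abs_of_pos (Yre0 s)]; exact (Yre1 s).le
      · obtain ⟨z1, z2⟩ := mem_segment_vertical hz
        rw [uIcc_of_le (Yre0 s).le] at z2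
        have := Yre1 s
        refine ⟨⟨?_, ?_⟩, hB₀ z ?_ z2.1 (by linarith [z2.2])⟩
        · simp only [mem_ofPred_eq]; linarith [z2.1]
        · simp only [mem_ofPred_eq]; linarith [z2.2]
        · rw [z1, abs_neg]; exact hs
    have h1 := hseg T (by linarith [le_abs_self (Y T).im])
    have h2 := hseg (-T) (by linarith [neg_le_abs (Y (-T)).im])
    have e3 : ε / (4 * c) * c = ε / 4 := by field_simp
    rw [e3] at h1 h2
    rw [dist_zero_right, key1, key2]
    have e4 : g ((-(Y (-T)).im : ℝ) : ℂ) - g ((-(Y T).im : ℝ) : ℂ) -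
        (g (Complex.I * Y (-T)) - g (Complex.I * Y T)) =
        (g (Complex.I * Y T) - g ((-(Y T).im : ℝ) : ℂ)) -
        (g (Complex.I * Y (-T)) - g ((-(Y (-T)).im : ℝ) : ℂ)) := by ring
    rw [e4]
    refine (norm_sub_le _ _).trans_lt ?_
    linarith
  have := tendsto_nhds_unique (l1.sub l2) l3
  exact sub_eq_zero.1 this

theorem sin_ne_zero_of_abs_re_sub_pi_lt {z : ℂ} (h : |z.re - π| < π) (h' : z ≠ π) :
    Complex.sin z ≠ 0 := by
  intro h0
  obtain ⟨j, hj⟩ := Complex.sin_eq_zero_iff.1 h0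
  have hre : z.re = j * π := by rw [hj]; simp
  rw [hre, abs_lt] at h
  have hπ := Real.pi_pos
  have a1 : (0 : ℝ) < j := by nlinarith [h.1]
  have a2 : (j : ℝ) < 2 := by nlinarith [h.2]
  have b1 : 0 < j := by exact_mod_cast a1
  have b2 : j < 2 := by exact_mod_cast a2
  have : j = 1 := by omega
  subst this
  apply h'; rw [hj]; simp

theorem integral_shiftIntegrand_eq {n k₁ k : ℕ} (hn : 1 ≤ n) {R t r σ : ℝ} (hR : 0 ≤ R)
    (ht : 1 ≤ t) (hr : 0 ≤ r) (hσ : 0 < σ) (hσ' : σ < π / 2) :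
    ∫ b : ℝ, shiftIntegrand (n + k₁) k₁ k R t r ((π / 2 : ℝ) + b * Complex.I) =
      (∫ b : ℝ, shiftIntegrand (n + k₁) k₁ k R t r ((3 * π / 2 : ℝ) + b * Complex.I)) +
      ∫ θ in (-π)..π, shiftIntegrand (n + k₁) k₁ k R t r (π - circleMap 0 σ θ) *
        circleMap 0 σ θ := by
  have hπ := Real.pi_pos
  have hπ3 := Real.pi_gt_three
  have hπ4 := Real.pi_lt_d2
  have e1 : π - π / 2 = π / 2 := by ring
  have e2 : π + π / 2 = 3 * π / 2 := by ring
  have hc3 : Real.cos (3 * π / 2) = 0 := by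
    rw [← e2, Real.cos_add, Real.cos_pi_div_two, Real.sin_pi]; ring
  have h := integral_line_sub_integral_line (f := shiftIntegrand (n + k₁) k₁ k R t r)
    (p := π) (σ := σ) (l := π / 2) (L := π) hσ hσ' (by linarith) ?_ ?_ ?_ ?_
  · rw [e1, e2] at h
    have hp : Function.Periodic (fun θ => shiftIntegrand (n + k₁) k₁ k R t r
        (circleMap π σ θ) * (circleMap 0 σ θ * Complex.I)) (2 * π) := fun θ => by
      simp only [periodic_circleMap _ _ θ]
    have h3 := hp.intervalIntegral_add_eq (-(π / 4)) 0
    have e5 : -(π / 4) + 2 * π = 7 * π / 4 := by ring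
    rw [e5, zero_add] at h3
    rw [h3] at h
    have h4 := intervalIntegral.integral_comp_add_right (a := -π) (b := π) (fun θ =>
      shiftIntegrand (n + k₁) k₁ k R t r (circleMap π σ θ) * (circleMap 0 σ θ * Complex.I)) π
    have e6 : π + π = 2 * π := by ring
    rw [neg_add_cancel, e6] at h4
    rw [← h4] at h
    have h5 : ∀ θ, circleMap π σ (θ + π) = π - circleMap 0 σ θ := fun θ => by
      simp [circleMap, add_mul, Complex.exp_add, Complex.exp_pi_mul_I]; ring
    have h6 : ∀ θ, circleMap 0 σ (θ + π) * Complex.I = -Complex.I * circleMap 0 σ θ := fun θ => by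
      simp [circleMap, add_mul, Complex.exp_add, Complex.exp_pi_mul_I]; ring
    simp only [h5, h6] at h
    have h7 : ∀ θ, shiftIntegrand (n + k₁) k₁ k R t r (π - circleMap 0 σ θ) *
        (-Complex.I * circleMap 0 σ θ) = -Complex.I *
        (shiftIntegrand (n + k₁) k₁ k R t r (π - circleMap 0 σ θ) * circleMap 0 σ θ) :=
      fun θ => by ring
    simp only [h7, intervalIntegral.integral_const_mul] at h
    have h8 := mul_left_cancel₀ (a := Complex.I) (b := (∫ b : ℝ, shiftIntegrand (n + k₁) k₁ k R t r
      ((3 * π / 2 : ℝ) + b * Complex.I)) - ∫ b : ℝ, shiftIntegrand (n + k₁) k₁ k R t r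
      ((π / 2 : ℝ) + b * Complex.I)) (c := -∫ θ in (-π)..π,
        shiftIntegrand (n + k₁) k₁ k R t r (π - circleMap 0 σ θ) * circleMap 0 σ θ)
        Complex.I_ne_zero (by rw [h]; ring)
    linear_combination -h8
  · intro z hz hz'
    refine differentiableAt_shiftIntegrand _ _ _ _ _ _ ?_ (sin_ne_zero_of_abs_re_sub_pi_lt hz hz')
    linarith [(abs_lt.1 hz).1]
  · rw [e1]; exact integrable_shiftIntegrand_line hn hR ht hr (by linarith) (by linarith)
      Real.cos_pi_div_two
  · rw [e2]; exact integrable_shiftIntegrand_line hn hR ht hr (by linarith) (by linarith) hc3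
  · intro ε hε
    obtain ⟨C, hC, hb⟩ := exists_norm_shiftIntegrand_le n k₁ k
    have hlim : Tendsto (fun b : ℝ => C * Real.exp (-(4⁻¹ * b))) atTop (𝓝 (C * 0)) := by
      refine Tendsto.const_mul _ (Real.tendsto_exp_atBot.comp ?_)
      exact tendsto_neg_atTop_atBot.comp (tendsto_id.const_mul_atTop (by norm_num))
    rw [mul_zero] at hlim
    obtain ⟨b₀, hb₀⟩ := eventually_atTop.1 (hlim.eventually (eventually_le_nhds hε))
    refine ⟨max b₀ 10, fun z hz hz' => ?_⟩
    obtain ⟨a1, a2⟩ := abs_le.1 hz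
    have a3 := (le_max_right _ _).trans hz'
    refine le_trans (hb R t r z ht hr (by linarith) (by linarith)
      (norm_mehler_le_of_abs_re_le hn hR ?_ (by linarith))) ((?_ : _ ≤ C *
      Real.exp (-(4⁻¹ * |z.im|))).trans (hb₀ |z.im| ((le_max_left _ _).trans hz')))
    · rw [abs_of_pos (by linarith)]; linarith
    · have b1 : Real.exp (-(4⁻¹ * r)) ≤ 1 := Real.exp_le_one_iff.2 (by linarith)
      have b2 : Real.exp (-((t - 1 / 2) * z.re)) ≤ 1 := Real.exp_le_one_iff.2 (by nlinarith)
      have b3 : 0 ≤ C * Real.exp (-(4⁻¹ * |z.im|)) := by positivity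
      calc _ ≤ C * Real.exp (-(4⁻¹ * |z.im|)) * 1 * 1 := by gcongr
        _ = _ := by ring

theorem exists_measurePreserving_prod_euclideanSpace (m : ℕ) :
    ∃ Φ : ℝ × EuclideanSpace ℝ (Fin m) ≃ᵐ EuclideanSpace ℝ (Fin (m + 1)),
      MeasurePreserving Φ ∧ ∀ p, Φ p 0 = p.1 ∧ ‖Φ p‖ ^ 2 = p.1 ^ 2 + ‖p.2‖ ^ 2 := by
  let e1 : ℝ × EuclideanSpace ℝ (Fin m) ≃ᵐ ℝ × (Fin m → ℝ) :=
    (MeasurableEquiv.refl ℝ).prodCongr (MeasurableEquiv.toLp 2 (Fin m → ℝ)).symm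
  let e2 : ℝ × (Fin m → ℝ) ≃ᵐ (Fin (m + 1) → ℝ) :=
    (MeasurableEquiv.piFinSuccAbove (fun _ => ℝ) 0).symm
  let e3 : (Fin (m + 1) → ℝ) ≃ᵐ EuclideanSpace ℝ (Fin (m + 1)) :=
    MeasurableEquiv.toLp 2 (Fin (m + 1) → ℝ)
  have h1 : MeasurePreserving e1 :=
    (MeasurePreserving.id volume).prod (PiLp.volume_preserving_ofLp (Fin m))
  have h2 : MeasurePreserving e2 :=
    (volume_preserving_piFinSuccAbove (fun _ => ℝ) 0).symm
  have h3 : MeasurePreserving e3 := PiLp.volume_preserving_toLp (Fin (m + 1))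
  have h0 : ∀ p, (e3 (e2 (e1 p))) 0 = p.1 := fun p => rfl
  have hs : ∀ p (i : Fin m), (e3 (e2 (e1 p))) i.succ = p.2 i := fun p i => rfl
  refine ⟨(e1.trans e2).trans e3, (h3.comp h2).comp h1, fun p => ⟨h0 p, ?_⟩⟩
  change ‖e3 (e2 (e1 p))‖ ^ 2 = _
  rw [EuclideanSpace.norm_sq_eq, EuclideanSpace.norm_sq_eq, Fin.sum_univ_succ, h0]
  simp [hs]

theorem pT_eq_integral_prod (n m k₁ k₂ : ℕ) (x : EuclideanSpace ℝ (Fin (2 * n)))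
    (t : EuclideanSpace ℝ (Fin (m + 1))) :
    pT n (m + 1) k₁ k₂ m.succ_pos x t =
      ((-1 : ℂ) ^ k₁ * Complex.I ^ k₂ / ((4 * (π : ℂ)) ^ n * (2 * (π : ℂ)) ^ (m + 1))) *
      ∫ p : ℝ × EuclideanSpace ℝ (Fin m),
        lineIntegrand (n + k₁) k₁ k₂ (‖x‖ ^ 2 / 4) ‖t‖ ‖p.2‖ p.1 := by
  obtain ⟨Φ, hΦ, h⟩ := exists_measurePreserving_prod_euclideanSpace m
  rw [pT, ← hΦ.integral_comp']
  congr 1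
  refine integral_congr_ae ?_
  have hae : ∀ᵐ p : ℝ × EuclideanSpace ℝ (Fin m), Φ p ≠ 0 := by
    refine hΦ.quasiMeasurePreserving.ae (p := fun y => y ≠ 0) ?_
    exact Measure.ae_ne volume 0
  filter_upwards [hae] with p hp
  obtain ⟨h0, h1⟩ := h p
  have hpos : 0 < ‖Φ p‖ := norm_pos_iff.2 hp
  have hsinh : Complex.sinh (‖Φ p‖ : ℂ) ≠ 0 := by
    rw [← Complex.ofReal_sinh]
    exact_mod_cast (Real.sinh_pos_iff.2 hpos).ne'
  have h2 : ((p.1 : ℂ) ^ 2 + ((‖p.2‖ : ℝ) : ℂ) ^ 2) = (‖Φ p‖ : ℂ) ^ 2 := by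
    exact_mod_cast h1.symm
  have h0' : (Φ p) ⟨0, m.succ_pos⟩ = p.1 := h0
  rw [if_neg hp, h0', lineIntegrand, h2, mehler_sq _ _ _ hsinh, sub_eq_add_neg, Complex.exp_add,
    div_pow]
  push_cast
  have h3 : (‖x‖ : ℂ) ^ 2 / 4 * ‖Φ p‖ * Complex.cosh ‖Φ p‖ / Complex.sinh ‖Φ p‖ =
    ‖x‖ ^ 2 / 4 * (‖Φ p‖ * Complex.cosh ‖Φ p‖ / Complex.sinh ‖Φ p‖) := by ring
  rw [h3]
  ring

theorem measurable_lineIntegrand (N k₁ k : ℕ) (R t : ℝ) :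
    Measurable fun p : ℝ × ℝ => lineIntegrand N k₁ k R t p.2 p.1 := by
  have := measurable_mehler N k₁ R
  unfold lineIntegrand
  fun_prop

theorem integrable_lineIntegrand_prod {n k₁ k : ℕ} (hn : 1 ≤ n) {R : ℝ} (hR : 0 ≤ R) (t : ℝ)
    (m : ℕ) :
    Integrable fun p : ℝ × EuclideanSpace ℝ (Fin m) =>
      lineIntegrand (n + k₁) k₁ k R t ‖p.2‖ p.1 := by
  obtain ⟨C, hC, h⟩ := exists_norm_lineIntegrand_le n k₁ k hn
  have h1 := (integrable_exp_neg_mul_abs (a := 4⁻¹) (by norm_num)).mul_prod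
    (integrable_exp_neg_mul_norm (volume : Measure (EuclideanSpace ℝ (Fin m)))
      (a := 4⁻¹) (by norm_num))
  refine (h1.const_mul C).mono' ?_ (Eventually.of_forall fun p => ?_)
  · exact ((measurable_lineIntegrand (n + k₁) k₁ k R t).comp
      (measurable_fst.prodMk measurable_snd.norm)).aestronglyMeasurable
  · refine (h R t _ _ hR).trans ?_
    have := exp_neg_sqrt_le p.1 ‖p.2‖
    rw [abs_norm] at this
    gcongr

/-- The part of `shiftIntegrand` that depends on the tail variable `r`. -/
noncomputable def shiftKernel (k : ℕ) (t r : ℝ) (y : ℂ) : ℂ :=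
  Complex.exp (-(t * (shiftRoot r y - y))) * (shiftRoot r y ^ k / shiftRoot r y)

theorem shiftIntegrand_eq_mul_shiftKernel (N k₁ k : ℕ) (R t r : ℝ) (y : ℂ) :
    shiftIntegrand N k₁ k R t r y =
      Complex.I ^ k * (mehler N k₁ R (-y ^ 2) * Complex.exp (-(t * y)) * y) *
        shiftKernel k t r y := by
  have h : Complex.exp (-(t * shiftRoot r y)) =
      Complex.exp (-(t * y)) * Complex.exp (-(t * (shiftRoot r y - y))) := by
    rw [← Complex.exp_add]; congr 1; ring
  rw [shiftIntegrand, shiftKernel, h, mul_pow]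
  ring

theorem measurable_shiftKernel (k : ℕ) (t : ℝ) :
    Measurable fun p : ℝ × ℂ => shiftKernel k t p.1 p.2 := by
  have := measurable_shiftRoot
  unfold shiftKernel
  fun_prop

theorem shiftRoot_sub_eq (r : ℝ) {y : ℂ} (hy : 0 < y.re) :
    shiftRoot r y - y = (r : ℂ) ^ 2 / (shiftRoot r y + y) := by
  have h : shiftRoot r y + y ≠ 0 := by
    intro h
    have := congrArg Complex.re h
    have h1 := re_le_shiftRoot_re r hy
    simp at this
    linarith
  rw [eq_div_iff h]
  linear_combination shiftRoot_sq r y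

theorem re_bounds_of_norm_sub_pi_le_one {y : ℂ} (hy : ‖y - π‖ ≤ 1) :
    2 ≤ y.re ∧ |y.im| ≤ 1 ∧ ‖y‖ ≤ 9 / 2 := by
  have h1 := (Complex.abs_re_le_norm _).trans hy
  have h2 := (Complex.abs_im_le_norm _).trans hy
  simp at h1 h2
  have hπ3 := Real.pi_gt_three
  have hπ4 := Real.pi_lt_d2
  refine ⟨by linarith [(abs_le.1 h1).1], h2, ?_⟩
  have h3 := norm_le_norm_sub_add y (π : ℂ)
  simp [abs_of_pos Real.pi_pos] at h3
  linarith

theorem le_re_mul_shiftRoot_sub {t r : ℝ} {y : ℂ} (ht : 1 ≤ t) (hr : 0 ≤ r)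
    (hy : ‖y - π‖ ≤ 1) :
    (√t * r - 1) / 40 ≤ (t * (shiftRoot r y - y)).re := by
  obtain ⟨h1, h2, h3⟩ := re_bounds_of_norm_sub_pi_le_one hy
  have hy0 : 0 < y.re := by linarith
  set Y := shiftRoot r y with hY
  have hYre : y.re ≤ Y.re := re_le_shiftRoot_re r hy0
  have hYr : r - |y.im| ≤ Y.re := le_shiftRoot_re ..
  have hYn : ‖Y‖ ≤ ‖y‖ + |r| := norm_shiftRoot_le r y
  rw [abs_of_nonneg hr] at hYn
  have hs : ‖Y + y‖ ≤ 9 + r := (norm_add_le _ _).trans (by linarith)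
  have hre : (5 + r) / 2 ≤ (Y + y).re := by
    rw [Complex.add_re]
    linarith
  have hpos : 0 < ‖Y + y‖ := by
    refine norm_pos_iff.2 fun h => ?_
    rw [h] at hre
    simp at hre
    linarith
  have hst : 1 ≤ √t := Real.one_le_sqrt.2 ht
  have ht2 : √t ^ 2 = t := Real.sq_sqrt (by linarith)
  have e1 : (t * (Y - y)).re = t * (r ^ 2 * ((Y + y).re / ‖Y + y‖ ^ 2)) := by
    rw [Complex.re_ofReal_mul, shiftRoot_sub_eq r hy0, ← Complex.normSq_eq_norm_sq]
    congr 1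
    rw [div_eq_mul_inv, ← Complex.ofReal_pow, Complex.re_ofReal_mul, Complex.inv_re]
  have e2 : 1 / (40 * (1 + r)) ≤ (Y + y).re / ‖Y + y‖ ^ 2 := by
    rw [div_le_div_iff₀ (by positivity) (by positivity)]
    have : ‖Y + y‖ ^ 2 ≤ (9 + r) ^ 2 := by gcongr
    nlinarith
  rw [e1]
  have e3 : t * (r ^ 2 * (1 / (40 * (1 + r)))) ≤ t * (r ^ 2 * ((Y + y).re / ‖Y + y‖ ^ 2)) := by
    gcongr
  refine le_trans ?_ e3
  rw [← ht2]
  have e4 : √t ^ 2 * (r ^ 2 * (1 / (40 * (1 + r)))) = (√t * r) ^ 2 / (1 + r) / 40 := by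
    field_simp
  rw [ht2] at *
  rw [← ht2, e4]
  gcongr
  rw [le_div_iff₀ (by positivity)]
  have : r ≤ √t * r := by nlinarith
  nlinarith [mul_nonneg (by linarith : (0 : ℝ) ≤ √t) hr, Real.sq_sqrt (by linarith : 0 ≤ t)]

theorem exists_norm_shiftKernel_le (k : ℕ) : ∃ C : ℝ, 0 < C ∧ ∀ (t r : ℝ) (y : ℂ), 1 ≤ t → 0 ≤ r →
    ‖y - π‖ ≤ 1 → ‖shiftKernel k t r y‖ ≤ C * Real.exp (-(80⁻¹ * (√t * r))) := by
  obtain ⟨C, hC, h⟩ := exists_one_add_pow_le k (a := 80⁻¹) (by norm_num)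
  refine ⟨Real.exp (1 / 40) * (5 ^ k * C), by positivity, fun t r y ht hr hy => ?_⟩
  have h0 := le_re_mul_shiftRoot_sub ht hr hy
  obtain ⟨h1, h2, h3⟩ := re_bounds_of_norm_sub_pi_le_one hy
  have hy0 : 0 < y.re := by linarith
  have hYre : y.re ≤ (shiftRoot r y).re := re_le_shiftRoot_re r hy0
  have hYn : ‖shiftRoot r y‖ ≤ ‖y‖ + |r| := norm_shiftRoot_le r y
  rw [abs_of_nonneg hr] at hYn
  have hY1 : 1 ≤ ‖shiftRoot r y‖ := by
    have := Complex.re_le_norm (shiftRoot r y)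
    linarith
  have hst : 1 ≤ √t := Real.one_le_sqrt.2 ht
  rw [shiftKernel, norm_mul, Complex.norm_exp, Complex.neg_re, norm_div, norm_pow]
  have e1 : ‖shiftRoot r y‖ ^ k / ‖shiftRoot r y‖ ≤ 5 ^ k * (C * Real.exp (80⁻¹ * (√t * r))) := by
    calc _ ≤ ‖shiftRoot r y‖ ^ k := div_le_self (by positivity) hY1
      _ ≤ (5 * (1 + r)) ^ k := by gcongr; linarith
      _ = 5 ^ k * (1 + r) ^ k := mul_pow ..
      _ ≤ _ := by
        gcongr
        refine (h r hr).trans ?_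
        gcongr
        nlinarith
  have e2 : Real.exp (-(t * (shiftRoot r y - y)).re) ≤
      Real.exp (1 / 40) * Real.exp (-(80⁻¹ * (√t * r))) * Real.exp (-(80⁻¹ * (√t * r))) := by
    rw [← Real.exp_add, ← Real.exp_add]
    gcongr
    linarith
  calc _ ≤ (Real.exp (1 / 40) * Real.exp (-(80⁻¹ * (√t * r))) * Real.exp (-(80⁻¹ * (√t * r)))) *
        (5 ^ k * (C * Real.exp (80⁻¹ * (√t * r)))) := by gcongr
    _ = _ := by
      have : Real.exp (-(80⁻¹ * (√t * r))) * Real.exp (80⁻¹ * (√t * r)) = 1 := by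
        rw [← Real.exp_add]; simp
      linear_combination (Real.exp (1 / 40) * Real.exp (-(80⁻¹ * (√t * r))) * 5 ^ k * C) * this

/-- The rescaled transverse integral of `shiftKernel`. -/
noncomputable def transverse (m k : ℕ) (t : ℝ) (y : ℂ) : ℂ :=
  ∫ w : EuclideanSpace ℝ (Fin m), shiftKernel k t (‖w‖ / √t) y

theorem integral_shiftKernel_norm (m k : ℕ) {t : ℝ} (ht : 0 < t) (y : ℂ) :
    ∫ v : EuclideanSpace ℝ (Fin m), shiftKernel k t ‖v‖ y =
      ((√t ^ m)⁻¹ : ℝ) * transverse m k t y := by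
  have h := Measure.integral_comp_smul (volume : Measure (EuclideanSpace ℝ (Fin m)))
    (fun w => shiftKernel k t (‖w‖ / √t) y) √t
  have hst : 0 < √t := Real.sqrt_pos.2 ht
  have e : ∀ v : EuclideanSpace ℝ (Fin m), ‖√t • v‖ / √t = ‖v‖ := fun v => by
    rw [norm_smul, Real.norm_of_nonneg hst.le]; field_simp
  simp only [e] at h
  rw [h, transverse, finrank_euclideanSpace_fin, abs_of_pos (by positivity), Complex.real_smul]

theorem tendsto_transverse (m k : ℕ) :
    Tendsto (fun p : ℝ × ℂ => transverse m k p.1 p.2) (atTop ×ˢ 𝓝 (π : ℂ))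
      (𝓝 (((2 * π ^ 2) ^ ((m : ℝ) / 2) : ℝ) * ((π : ℂ) ^ k / π))) := by
  have hπ := Real.pi_pos
  obtain ⟨C, hC, h⟩ := exists_norm_shiftKernel_le k
  have hlim : ∫ w : EuclideanSpace ℝ (Fin m),
      ((Real.exp (-((2 * π)⁻¹) * ‖w‖ ^ 2) : ℝ) : ℂ) * ((π : ℂ) ^ k / π) =
      ((2 * π ^ 2) ^ ((m : ℝ) / 2) : ℝ) * ((π : ℂ) ^ k / π) := by
    rw [integral_mul_const, integral_complex_ofReal, GaussianFourier.integral_rexp_neg_mul_sq_norm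
      (by positivity)]
    congr 3
    · field_simp
    · simp
  rw [← hlim]
  have hev : ∀ᶠ p : ℝ × ℂ in atTop ×ˢ 𝓝 (π : ℂ), 1 ≤ p.1 ∧ ‖p.2 - π‖ ≤ 1 := by
    refine (eventually_ge_atTop (1 : ℝ)).prod_mk (pb := fun y : ℂ => ‖y - π‖ ≤ 1) ?_
    filter_upwards [Metric.closedBall_mem_nhds (π : ℂ) one_pos] with y hy
    rwa [← dist_eq_norm]
  unfold transverse
  refine tendsto_integral_filter_of_dominated_convergence
    (fun w => C * Real.exp (-(80⁻¹ * ‖w‖))) ?_ ?_ ?_ ?_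
  · refine Eventually.of_forall fun p => ?_
    exact ((measurable_shiftKernel k p.1).comp
      ((measurable_norm.div_const _).prodMk measurable_const)).aestronglyMeasurable
  · filter_upwards [hev] with p hp
    refine Eventually.of_forall fun w => ?_
    have hst : 0 < √p.1 := Real.sqrt_pos.2 (by linarith [hp.1])
    refine (h p.1 (‖w‖ / √p.1) p.2 hp.1 (by positivity) hp.2).trans_eq ?_
    rw [mul_div_cancel₀ _ hst.ne']
  · exact (integrable_exp_neg_mul_norm _ (by norm_num)).const_mul C
  · refine Eventually.of_forall fun w => ?_
    have hr : Tendsto (fun p : ℝ × ℂ => ‖w‖ / √p.1) (atTop ×ˢ 𝓝 (π : ℂ)) (𝓝 0) :=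
      (tendsto_const_nhds.div_atTop Real.tendsto_sqrt_atTop).comp tendsto_fst
    have hy : Tendsto (fun p : ℝ × ℂ => p.2) (atTop ×ˢ 𝓝 (π : ℂ)) (𝓝 (π : ℂ)) := tendsto_snd
    have hroot0 : shiftRoot 0 (π : ℂ) = π := by
      have h1 := shiftRoot_sq 0 (π : ℂ)
      have h2 := re_le_shiftRoot_re 0 (y := (π : ℂ)) (by simpa using hπ)
      have h3 : (shiftRoot 0 (π : ℂ) - π) * (shiftRoot 0 (π : ℂ) + π) = 0 := by
        linear_combination h1 + (Complex.ofReal_zero ▸ by simp : ((0 : ℝ) : ℂ) ^ 2 = 0)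
      rcases mul_eq_zero.1 h3 with h4 | h4
      · exact sub_eq_zero.1 h4
      · have := congrArg Complex.re h4
        simp at this h2
        linarith
    have hroot : Tendsto (fun p : ℝ × ℂ => shiftRoot (‖w‖ / √p.1) p.2) (atTop ×ˢ 𝓝 (π : ℂ))
        (𝓝 (π : ℂ)) := by
      nth_rewrite 2 [← hroot0]
      unfold shiftRoot
      refine Tendsto.comp (g := Complex.sqrt)
        (Complex.differentiableAt_sqrt
          (sq_add_sq_mem_slitPlane 0 (y := (π : ℂ)) (by simpa using hπ))).continuousAt.tendsto ?_
      exact (hy.pow 2).add (((Complex.continuous_ofReal.tendsto 0).comp hr).pow 2)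
    have hπ0 : (π : ℂ) ≠ 0 := by exact_mod_cast hπ.ne'
    have hE : Tendsto (fun p : ℝ × ℂ => -((‖w‖ : ℂ) ^ 2 / (shiftRoot (‖w‖ / √p.1) p.2 + p.2)))
        (atTop ×ˢ 𝓝 (π : ℂ)) (𝓝 (-((‖w‖ : ℂ) ^ 2 / (π + π)))) :=
      ((tendsto_const_nhds).div (hroot.add hy) (by rw [← two_mul]; simp)).neg
    have hF := (hE.cexp).mul ((hroot.pow k).div hroot hπ0)
    have : ((Real.exp (-((2 * π)⁻¹) * ‖w‖ ^ 2) : ℝ) : ℂ) =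
        Complex.exp (-((‖w‖ : ℂ) ^ 2 / (π + π))) := by
      push_cast
      congr 1
      field_simp
      ring
    rw [this]
    refine hF.congr' ?_
    filter_upwards [hev] with p hp
    have hst : 0 < √p.1 := Real.sqrt_pos.2 (by linarith [hp.1])
    have h5 := re_bounds_of_norm_sub_pi_le_one hp.2
    rw [shiftKernel, shiftRoot_sub_eq _ (by linarith [h5.1])]
    congr 3
    rw [← mul_div_assoc]
    congr 1
    have : (p.1 : ℝ) = √p.1 ^ 2 := (Real.sq_sqrt (by linarith [hp.1])).symm
    have h6 : p.1 * (‖w‖ / √p.1) ^ 2 = ‖w‖ ^ 2 := by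
      rw [div_pow, ← this, mul_div_cancel₀ _ (by linarith [hp.1])]
    have h7 := congrArg Complex.ofReal h6
    push_cast at h7 ⊢
    exact h7.symm

theorem measurable_transverse (m k : ℕ) (t : ℝ) : Measurable (transverse m k t) := by
  have h1 : Measurable fun p : ℂ × EuclideanSpace ℝ (Fin m) => (‖p.2‖ / √t, p.1) :=
    (measurable_snd.norm.div_const _).prodMk measurable_fst
  have h2 := (measurable_shiftKernel k t).comp h1
  exact (StronglyMeasurable.integral_prod_right' h2.stronglyMeasurable).measurable

/-- The integrand of the residue contribution around `y = π`, up to the factor `I ^ k`. -/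
noncomputable def circleFactor (N k₁ : ℕ) (R t σ θ : ℝ) : ℂ :=
  mehler N k₁ R (-(π - circleMap 0 σ θ) ^ 2) * Complex.exp (-(t * (π - circleMap 0 σ θ))) *
    (π - circleMap 0 σ θ) * circleMap 0 σ θ

theorem sin_pi_sub_circleMap_ne_zero {σ : ℝ} (hσ : 0 < σ) (hσ' : σ ≤ 1) (θ : ℝ) :
    Complex.sin (π - circleMap 0 σ θ) ≠ 0 := by
  have hn : ‖circleMap 0 σ θ‖ = σ := by simp [abs_of_pos hσ]
  apply sin_ne_zero_of_abs_re_sub_pi_lt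
  · have := Complex.abs_re_le_norm (circleMap 0 σ θ)
    rw [hn] at this
    simp only [Complex.sub_re, Complex.ofReal_re, sub_sub_cancel_left, abs_neg]
    linarith [Real.pi_gt_three]
  · intro h
    rw [sub_eq_self] at h
    rw [h, norm_zero] at hn
    exact hσ.ne hn

theorem continuous_circleFactor (N k₁ : ℕ) (R t : ℝ) {σ : ℝ} (hσ : 0 < σ) (hσ' : σ ≤ 1) :
    Continuous (circleFactor N k₁ R t σ) := by
  have h1 : Continuous fun θ : ℝ => mehler N k₁ R (-(π - circleMap 0 σ θ) ^ 2) := by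
    refine continuous_iff_continuousAt.2 fun θ => ?_
    refine ContinuousAt.comp (g := mehler N k₁ R)
      (f := fun θ : ℝ => -((π : ℂ) - circleMap 0 σ θ) ^ 2) ?_ (by fun_prop)
    exact (differentiableAt_mehler N k₁ R
      (sinhcSqrt_neg_sq_ne_zero (sin_pi_sub_circleMap_ne_zero hσ hσ' θ))).continuousAt
  unfold circleFactor
  fun_prop

theorem integrable_circleFactor_mul_shiftKernel (N k₁ k m : ℕ) (R : ℝ) {t σ : ℝ} (ht : 1 ≤ t)
    (hσ : 0 < σ) (hσ' : σ ≤ 1) :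
    Integrable (fun p : EuclideanSpace ℝ (Fin m) × ℝ => circleFactor N k₁ R t σ p.2 *
        shiftKernel k t ‖p.1‖ (π - circleMap 0 σ p.2))
      (volume.prod (volume.restrict (Set.uIoc (-π) π))) := by
  obtain ⟨C, hC, h⟩ := exists_norm_shiftKernel_le k
  have hst : 0 < √t := Real.sqrt_pos.2 (by linarith)
  have hc := continuous_circleFactor N k₁ R t hσ hσ'
  have hi : Integrable (fun θ => ‖circleFactor N k₁ R t σ θ‖)
      (volume.restrict (Set.uIoc (-π) π)) :=
    (hc.norm.intervalIntegrable _ _).def'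
  have hb := (integrable_exp_neg_mul_norm (volume : Measure (EuclideanSpace ℝ (Fin m)))
    (a := 80⁻¹ * √t) (by positivity)).mul_prod hi
  refine (hb.const_mul C).mono' ?_ (Eventually.of_forall fun p => ?_)
  · have h3 : Measurable fun p : EuclideanSpace ℝ (Fin m) × ℝ =>
        (‖p.1‖, (π : ℂ) - circleMap 0 σ p.2) :=
      measurable_fst.norm.prodMk (measurable_const.sub
        ((continuous_circleMap 0 σ).measurable.comp measurable_snd))
    have h4 := (measurable_shiftKernel k t).comp h3
    have h5 : Measurable fun p : EuclideanSpace ℝ (Fin m) × ℝ => circleFactor N k₁ R t σ p.2 :=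
      hc.measurable.comp measurable_snd
    have h6 := h5.mul h4
    exact h6.aestronglyMeasurable
  · have hy : ‖((π : ℂ) - circleMap 0 σ p.2) - π‖ ≤ 1 := by simpa [abs_of_pos hσ] using hσ'
    have := h t ‖p.1‖ _ ht (norm_nonneg _) hy
    rw [norm_mul]
    rw [← mul_assoc] at this
    calc _ ≤ ‖circleFactor N k₁ R t σ p.2‖ *
        (C * Real.exp (-(80⁻¹ * √t * ‖p.1‖))) := by gcongr
      _ = _ := by ring

theorem exists_integral_lineIntegrand_prod (n k₁ k m : ℕ) (hn : 1 ≤ n) : ∃ C : ℝ, 0 < C ∧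
    ∀ R t σ : ℝ, 0 ≤ R → 1 ≤ t → 0 < σ → σ ≤ 1 →
      ‖(∫ p : ℝ × EuclideanSpace ℝ (Fin m), lineIntegrand (n + k₁) k₁ k R t ‖p.2‖ p.1) -
        Complex.I ^ k * (((√t ^ m)⁻¹ : ℝ) * ∫ θ in (-π)..π, circleFactor (n + k₁) k₁ R t σ θ *
          transverse m k t (π - circleMap 0 σ θ))‖ ≤
        C * Real.exp (-((t - 1 / 2) * (3 * π / 2))) := by
  have hπ := Real.pi_pos
  have hπ3 := Real.pi_gt_three
  have hπ4 := Real.pi_lt_d2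
  obtain ⟨C₁, hC₁, h₁⟩ := exists_norm_shiftIntegrand_line_le n k₁ k hn
  set B := ∫ b : ℝ, Real.exp (-(4⁻¹ * |b|)) with hB
  set V := ∫ v : EuclideanSpace ℝ (Fin m), Real.exp (-(4⁻¹ * ‖v‖)) with hV
  have hB0 : 0 ≤ B := integral_nonneg fun _ => (Real.exp_pos _).le
  have hV0 : 0 ≤ V := integral_nonneg fun _ => (Real.exp_pos _).le
  have hVi := integrable_exp_neg_mul_norm (volume : Measure (EuclideanSpace ℝ (Fin m)))
    (a := 4⁻¹) (by norm_num)
  refine ⟨C₁ * (B * V) + 1, by positivity, fun R t σ hR ht hσ hσ' => ?_⟩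
  have ht0 : 0 < t := by linarith
  have hst : 0 < √t := Real.sqrt_pos.2 ht0
  set J1 : EuclideanSpace ℝ (Fin m) → ℂ := fun v =>
    ∫ b : ℝ, shiftIntegrand (n + k₁) k₁ k R t ‖v‖ ((3 * π / 2 : ℝ) + b * Complex.I) with hJ1
  have hprod := integrable_lineIntegrand_prod (n := n) (k₁ := k₁) (k := k) hn hR t m
  set F : EuclideanSpace ℝ (Fin m) → ℝ → ℂ := fun v θ =>
    circleFactor (n + k₁) k₁ R t σ θ * shiftKernel k t ‖v‖ (π - circleMap 0 σ θ) with hF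
  have hFint : Integrable (Function.uncurry F)
      (volume.prod (volume.restrict (Set.uIoc (-π) π))) :=
    integrable_circleFactor_mul_shiftKernel (n + k₁) k₁ k m R ht hσ hσ'
  have hJ : ∀ v : EuclideanSpace ℝ (Fin m),
      ∫ l : ℝ, lineIntegrand (n + k₁) k₁ k R t ‖v‖ l =
        J1 v + Complex.I ^ k * ∫ θ in (-π)..π, F v θ := fun v => by
    rw [integral_lineIntegrand_eq hn hR ht (norm_nonneg v),
      integral_shiftIntegrand_eq hn hR ht (norm_nonneg v) hσ (by linarith),
      ← intervalIntegral.integral_const_mul]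
    congr 1
    refine intervalIntegral.integral_congr fun θ _ => ?_
    simp only [hF, circleFactor, shiftIntegrand_eq_mul_shiftKernel]
    ring
  have hle : -π ≤ π := by linarith
  have hI : Integrable fun v : EuclideanSpace ℝ (Fin m) => ∫ θ in (-π)..π, F v θ := by
    have := hFint.integral_prod_left
    simpa only [intervalIntegral.integral_of_le hle, Set.uIoc_of_le hle,
      Function.uncurry] using this
  have hS : ∫ v, ∫ θ in (-π)..π, F v θ = ((√t ^ m)⁻¹ : ℝ) *
      ∫ θ in (-π)..π, circleFactor (n + k₁) k₁ R t σ θ *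
          transverse m k t (π - circleMap 0 σ θ) := by
    simp only [intervalIntegral.integral_of_le hle]
    rw [Set.uIoc_of_le hle] at hFint
    rw [integral_integral_swap hFint, ← integral_const_mul]
    congr 1
    ext θ
    simp only [hF]
    rw [integral_const_mul, integral_shiftKernel_norm m k ht0]
    ring
  have hL : Integrable fun v : EuclideanSpace ℝ (Fin m) =>
      ∫ l : ℝ, lineIntegrand (n + k₁) k₁ k R t ‖v‖ l := hprod.integral_prod_right
  rw [Measure.volume_eq_prod, integral_prod_symm _ hprod, ← hS, ← integral_const_mul,
    ← integral_sub hL (hI.const_mul _)]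
  simp only [hJ, add_sub_cancel_right]
  have hJb : ∀ v, ‖J1 v‖ ≤ C₁ * B * Real.exp (-((t - 1 / 2) * (3 * π / 2))) *
      Real.exp (-(4⁻¹ * ‖v‖)) := fun v => by
    have hcos : Real.cos (3 * π / 2) = 0 := by
      rw [show 3 * π / 2 = π / 2 + π by ring, Real.cos_add_pi]; simp
    refine (norm_integral_le_of_norm_le ((integrable_exp_neg_mul_abs (a := 4⁻¹)
      (by norm_num)).const_mul (C₁ * Real.exp (-(4⁻¹ * ‖v‖)) *
        Real.exp (-((t - 1 / 2) * (3 * π / 2))))) (Eventually.of_forall fun b => ?_)).trans_eq ?_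
    · refine (h₁ R t ‖v‖ (3 * π / 2) b hR ht (norm_nonneg _) (by linarith) (by linarith)
        hcos).trans_eq (by ring)
    · rw [integral_const_mul]; ring
  refine (norm_integral_le_of_norm_le (hVi.const_mul _) (Eventually.of_forall hJb)).trans ?_
  rw [integral_const_mul]
  have := Real.exp_pos (-((t - 1 / 2) * (3 * π / 2)))
  rw [← hV]
  nlinarith

theorem integral_exp_mul_I_mul_inv_pow (j n : ℕ) :
    ∫ θ in (-π)..π, Complex.exp (θ * Complex.I) ^ j * (Complex.exp (θ * Complex.I))⁻¹ ^ n =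
      if j = n then 2 * (π : ℂ) else 0 := by
  have h : ∀ θ : ℝ, Complex.exp (θ * Complex.I) ^ j * (Complex.exp (θ * Complex.I))⁻¹ ^ n =
      Complex.exp ((((j : ℂ) - n) * Complex.I) * θ) := fun θ => by
    rw [← Complex.exp_neg, ← Complex.exp_nat_mul, ← Complex.exp_nat_mul, ← Complex.exp_add]
    congr 1; ring
  simp only [h]
  split_ifs with hjn
  · simp [hjn]; ring
  · have h0 : ((j : ℂ) - n) ≠ 0 := sub_ne_zero.2 (by exact_mod_cast hjn)
    rw [integral_exp_mul_complex (mul_ne_zero h0 Complex.I_ne_zero)]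
    have h1 : Complex.exp ((j - n) * Complex.I * π) = Complex.exp ((j - n) * Complex.I * (-π : ℝ)) := by
      rw [Complex.exp_eq_exp_iff_exists_int]
      refine ⟨(j : ℤ) - n, ?_⟩
      push_cast; ring
    rw [h1]; simp

theorem integral_exp_circle_mul_inv_pow (a : ℂ) (n : ℕ) :
    ∫ θ in (-π)..π, Complex.exp (a * Complex.exp (θ * Complex.I)) *
        (Complex.exp (θ * Complex.I))⁻¹ ^ n = 2 * π * (a ^ n / n.factorial) := by
  have hs : HasSum (fun j : ℕ => ∫ θ in (-π)..π, a ^ j / j.factorial *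
      (Complex.exp (θ * Complex.I) ^ j * (Complex.exp (θ * Complex.I))⁻¹ ^ n))
      (∫ θ in (-π)..π, Complex.exp (a * Complex.exp (θ * Complex.I)) *
        (Complex.exp (θ * Complex.I))⁻¹ ^ n) := by
    refine intervalIntegral.hasSum_integral_of_dominated_convergence
      (fun j _ => ‖a‖ ^ j / j.factorial) ?_ ?_ ?_ ?_ ?_
    · intro j
      refine Continuous.aestronglyMeasurable ?_
      simp only [← Complex.exp_neg]
      fun_prop
    · intro j
      refine Eventually.of_forall fun θ _ => ?_
      simp [Complex.norm_exp_ofReal_mul_I]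
    · exact Eventually.of_forall fun θ _ => Real.summable_pow_div_factorial ‖a‖
    · exact intervalIntegrable_const
    · refine Eventually.of_forall fun θ _ => ?_
      have := NormedSpace.expSeries_div_hasSum_exp (a * Complex.exp (θ * Complex.I))
      rw [← Complex.exp_eq_exp_ℂ] at this
      refine (this.mul_right ((Complex.exp (θ * Complex.I))⁻¹ ^ n)).congr_fun ?_
      intro j
      rw [mul_pow]; ring
  have h1 := hs.tsum_eq
  rw [← h1, tsum_eq_single n]
  · rw [intervalIntegral.integral_const_mul, integral_exp_mul_I_mul_inv_pow, if_pos rfl]; ring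
  · intro j hj
    rw [intervalIntegral.integral_const_mul, integral_exp_mul_I_mul_inv_pow, if_neg hj, mul_zero]

theorem hasSum_integral_exp_add_inv (a b : ℂ) (ν : ℕ) :
    HasSum (fun k : ℕ => 2 * π * (a ^ (k + ν) * b ^ k / (k.factorial * (k + ν).factorial)))
      (∫ θ in (-π)..π, Complex.exp (a * Complex.exp (θ * Complex.I) +
        b * (Complex.exp (θ * Complex.I))⁻¹) * (Complex.exp (θ * Complex.I))⁻¹ ^ ν) := by
  have hs : HasSum (fun k : ℕ => ∫ θ in (-π)..π, b ^ k / k.factorial *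
      (Complex.exp (a * Complex.exp (θ * Complex.I)) *
        (Complex.exp (θ * Complex.I))⁻¹ ^ (k + ν)))
      (∫ θ in (-π)..π, Complex.exp (a * Complex.exp (θ * Complex.I) +
        b * (Complex.exp (θ * Complex.I))⁻¹) * (Complex.exp (θ * Complex.I))⁻¹ ^ ν) := by
    refine intervalIntegral.hasSum_integral_of_dominated_convergence
      (fun j _ => Real.exp ‖a‖ * (‖b‖ ^ j / j.factorial)) ?_ ?_ ?_ ?_ ?_
    · intro j
      refine Continuous.aestronglyMeasurable ?_
      simp only [← Complex.exp_neg]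
      fun_prop
    · intro j
      refine Eventually.of_forall fun θ _ => ?_
      have h1 : ‖Complex.exp (a * Complex.exp (θ * Complex.I))‖ ≤ Real.exp ‖a‖ := by
        refine (Complex.norm_exp_le_exp_norm _).trans ?_
        simp [Complex.norm_exp_ofReal_mul_I]
      simp only [norm_mul, norm_div, norm_pow, norm_inv, Complex.norm_exp_ofReal_mul_I,
        Complex.norm_natCast, inv_one, one_pow, mul_one]
      rw [mul_comm]
      gcongr
    · exact Eventually.of_forall fun θ _ => (Real.summable_pow_div_factorial ‖b‖).mul_left _
    · exact intervalIntegrable_const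
    · refine Eventually.of_forall fun θ _ => ?_
      have := NormedSpace.expSeries_div_hasSum_exp (b * (Complex.exp (θ * Complex.I))⁻¹)
      rw [← Complex.exp_eq_exp_ℂ] at this
      rw [Complex.exp_add]
      have h2 := this.mul_right (Complex.exp (a * Complex.exp (θ * Complex.I)) *
        (Complex.exp (θ * Complex.I))⁻¹ ^ ν)
      rw [mul_assoc, mul_left_comm]
      refine h2.congr_fun fun j => ?_
      rw [mul_pow, pow_add]; ring
  convert hs using 1
  ext k
  rw [intervalIntegral.integral_const_mul, integral_exp_circle_mul_inv_pow]
  have := Nat.cast_ne_zero (R := ℂ).2 (Nat.factorial_ne_zero k)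
  have := Nat.cast_ne_zero (R := ℂ).2 (Nat.factorial_ne_zero (k + ν))
  field_simp

theorem summable_besselItilde (ν : ℕ) (ζ : ℝ) : Summable fun k : ℕ => ζ ^ (2 * k) /
    ((2 : ℝ) ^ (2 * k + ν) * (Nat.factorial k) * (Nat.factorial (k + ν))) := by
  refine Summable.of_nonneg_of_le (fun k => by rw [pow_mul]; positivity) (fun k => ?_)
    (Real.summable_pow_div_factorial (ζ ^ 2))
  rw [pow_mul]
  refine div_le_div_of_nonneg_left (by positivity) (by positivity) ?_
  have h1 : (1 : ℝ) ≤ 2 ^ (2 * k + ν) := one_le_pow₀ (by norm_num)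
  have h2 : (1 : ℝ) ≤ (k + ν).factorial := by exact_mod_cast Nat.factorial_pos _
  have h3 : (0 : ℝ) < k.factorial := by positivity
  calc (k.factorial : ℝ) = 1 * k.factorial * 1 := by ring
    _ ≤ _ := by gcongr

theorem le_besselItilde (ν : ℕ) (ζ : ℝ) : 1 / (2 ^ ν * (ν.factorial : ℝ)) ≤ besselItilde ν ζ := by
  have := (summable_besselItilde ν ζ).le_tsum 0 (fun k _ => by rw [pow_mul]; positivity)
  simpa [besselItilde] using this

theorem besselItilde_pos (ν : ℕ) (ζ : ℝ) : 0 < besselItilde ν ζ :=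
  lt_of_lt_of_le (by positivity) (le_besselItilde ν ζ)

theorem integral_exp_add_inv_mul_inv_pow (ν : ℕ) {a b ζ : ℝ} (h : 4 * (a * b) = ζ ^ 2) :
    ∫ θ in (-π)..π, Complex.exp (a * Complex.exp (θ * Complex.I) +
        b * (Complex.exp (θ * Complex.I))⁻¹) * (Complex.exp (θ * Complex.I))⁻¹ ^ ν =
      ((2 * π * (2 * a) ^ ν * besselItilde ν ζ : ℝ) : ℂ) := by
  refine (hasSum_integral_exp_add_inv a b ν).unique ?_
  have h1 := Complex.hasSum_ofReal.2
    ((summable_besselItilde ν ζ).hasSum.mul_left (2 * π * (2 * a) ^ ν))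
  unfold besselItilde
  convert h1 using 1
  ext k
  have h2 : (ζ : ℂ) ^ 2 = 4 * (a * b) := by exact_mod_cast h.symm
  push_cast
  rw [pow_mul, h2, pow_add 2, pow_mul 2, pow_add (a : ℂ), mul_pow, mul_pow, mul_pow]
  have := Nat.cast_ne_zero (R := ℂ).2 (Nat.factorial_ne_zero k)
  have := Nat.cast_ne_zero (R := ℂ).2 (Nat.factorial_ne_zero (k + ν))
  norm_num
  field_simp

theorem integral_exp_neg_mul_sq_le {a : ℝ} (ha : 0 < a) :
    ∫ θ in (-π)..π, Real.exp (-a * θ ^ 2) ≤ √(π / a) := by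
  rw [intervalIntegral.integral_of_le (by linarith [Real.pi_pos]), ← integral_gaussian a]
  exact setIntegral_le_integral (integrable_exp_neg_mul_sq ha)
    (Eventually.of_forall fun _ => (Real.exp_pos _).le)

theorem integral_exp_neg_mul_one_sub_cos_le {a : ℝ} (ha : 0 < a) :
    ∫ θ in (-π)..π, Real.exp (-(a * (1 - Real.cos θ))) ≤ 4 / √a := by
  have hπ := Real.pi_pos
  have hπ4 := Real.pi_lt_d2
  have h1 : ∫ θ in (-π)..π, Real.exp (-(a * (1 - Real.cos θ))) ≤
      ∫ θ in (-π)..π, Real.exp (-(2 * a / π ^ 2) * θ ^ 2) := by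
    refine intervalIntegral.integral_mono_on (by linarith)
      (Continuous.intervalIntegrable (by fun_prop) _ _)
      (Continuous.intervalIntegrable (by fun_prop) _ _) fun θ hθ => ?_
    have := Real.cos_le_one_sub_mul_cos_sq (x := θ) (abs_le.2 hθ)
    gcongr
    have h2 : a * (2 / π ^ 2 * θ ^ 2) ≤ a * (1 - Real.cos θ) := by gcongr; linarith
    have h3 : a * (2 / π ^ 2 * θ ^ 2) = 2 * a / π ^ 2 * θ ^ 2 := by ring
    linarith
  refine h1.trans ((integral_exp_neg_mul_sq_le (by positivity)).trans ?_)
  rw [le_div_iff₀ (by positivity), ← Real.sqrt_mul (by positivity)]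
  refine Real.sqrt_le_iff.2 ⟨by norm_num, ?_⟩
  have : π / (2 * a / π ^ 2) * a = π ^ 3 / 2 := by field_simp
  rw [this]
  have : π ^ 3 ≤ 3.15 ^ 3 := by gcongr
  norm_num at this ⊢
  linarith

theorem le_integral_exp_mul_cos (ν : ℕ) {κ : ℝ} (hκ : 60 * (ν : ℝ) ^ 2 + 1 ≤ κ) :
    1 / (2 * √κ) ≤ ∫ θ in (-π)..π, Real.exp (-(κ * (1 - Real.cos θ))) * Real.cos (ν * θ) := by
  have hπ := Real.pi_pos
  have hπ3 := Real.pi_gt_three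
  have hπ4 := Real.pi_lt_d2
  have hκ1 : 1 ≤ κ := by nlinarith [sq_nonneg (ν : ℝ)]
  have hκ0 : 0 < κ := by linarith
  have hs : 1 ≤ √κ := Real.one_le_sqrt.2 hκ1
  have hsq : √κ ^ 2 = κ := Real.sq_sqrt hκ0.le
  set b := (ν : ℝ) ^ 2 / 2 * (π ^ 2 / κ) with hb
  have h1 : ∫ θ in (-π)..π, (Real.exp (-(κ * θ ^ 2 / 2)) - b * Real.exp (-(κ / π ^ 2) * θ ^ 2)) ≤
      ∫ θ in (-π)..π, Real.exp (-(κ * (1 - Real.cos θ))) * Real.cos (ν * θ) := by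
    refine intervalIntegral.integral_mono_on (by linarith)
      (Continuous.intervalIntegrable (by fun_prop) _ _)
      (Continuous.intervalIntegrable (by fun_prop) _ _) fun θ hθ => ?_
    have hc := Real.cos_le_one_sub_mul_cos_sq (x := θ) (abs_le.2 hθ)
    have hc2 := Real.one_sub_sq_div_two_le_cos (x := θ)
    have hc3 := Real.one_sub_sq_div_two_le_cos (x := ν * θ)
    set E := Real.exp (-(κ * (1 - Real.cos θ))) with hE
    have hE0 : 0 < E := Real.exp_pos _
    set w := κ / π ^ 2 * θ ^ 2 with hw
    have hw0 : 0 ≤ w := by positivity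
    have e1 : Real.exp (-(κ * θ ^ 2 / 2)) ≤ E := by
      rw [hE]; gcongr; nlinarith
    have e2 : E ≤ Real.exp (-w) * Real.exp (-w) := by
      rw [hE, ← Real.exp_add]; gcongr
      have : κ * (2 / π ^ 2 * θ ^ 2) ≤ κ * (1 - Real.cos θ) := by gcongr; linarith
      have h3 : κ * (2 / π ^ 2 * θ ^ 2) = 2 * w := by rw [hw]; ring
      linarith
    have e3 : w * Real.exp (-w) ≤ 1 := by
      have := Real.add_one_le_exp w
      rw [Real.exp_neg, ← div_eq_mul_inv, div_le_one (Real.exp_pos _)]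
      linarith
    have e4 : θ ^ 2 * E ≤ π ^ 2 / κ * Real.exp (-w) := by
      have : θ ^ 2 = π ^ 2 / κ * w := by rw [hw]; field_simp
      rw [this, mul_assoc]
      gcongr
      calc w * E ≤ w * (Real.exp (-w) * Real.exp (-w)) := by gcongr
        _ = (w * Real.exp (-w)) * Real.exp (-w) := by ring
        _ ≤ 1 * Real.exp (-w) := by gcongr
        _ = _ := one_mul _
    have e5 : (ν : ℝ) ^ 2 / 2 * (θ ^ 2 * E) ≤ (ν : ℝ) ^ 2 / 2 * (π ^ 2 / κ * Real.exp (-w)) := by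
      gcongr
    have e6 : E * (1 - (ν * θ) ^ 2 / 2) ≤ E * Real.cos (ν * θ) := by gcongr
    have e7 : Real.exp (-(κ / π ^ 2) * θ ^ 2) = Real.exp (-w) := by rw [hw]; congr 1; ring
    rw [e7, hb]
    nlinarith
  refine le_trans ?_ h1
  rw [intervalIntegral.integral_sub (Continuous.intervalIntegrable (by fun_prop) _ _)
    (Continuous.intervalIntegrable (by fun_prop) _ _), intervalIntegral.integral_const_mul]
  have h2 := integral_exp_neg_mul_sq_le (a := κ / π ^ 2) (by positivity)
  have h3 : √(π / (κ / π ^ 2)) ≤ 6 / √κ := by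
    rw [le_div_iff₀ (by positivity), ← Real.sqrt_mul (by positivity)]
    refine Real.sqrt_le_iff.2 ⟨by norm_num, ?_⟩
    have : π / (κ / π ^ 2) * κ = π ^ 3 := by field_simp
    rw [this]
    have : π ^ 3 ≤ 3.15 ^ 3 := by gcongr
    norm_num at this ⊢
    linarith
  have h4 : 1 / √κ ≤ ∫ θ in (-π)..π, Real.exp (-(κ * θ ^ 2 / 2)) := by
    have hi : 1 / √κ ≤ 1 := by rw [div_le_one (by positivity)]; exact hs
    have hp : 0 < 1 / √κ := by positivity
    have e1 : ∫ θ in (-(1 / √κ))..(1 / √κ), (1 / 2 : ℝ) ≤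
        ∫ θ in (-(1 / √κ))..(1 / √κ), Real.exp (-(κ * θ ^ 2 / 2)) := by
      refine intervalIntegral.integral_mono_on (by linarith)
        (Continuous.intervalIntegrable (by fun_prop) _ _)
        (Continuous.intervalIntegrable (by fun_prop) _ _) fun θ hθ => ?_
      have : θ ^ 2 ≤ 1 / κ := by
        have := sq_le_sq' hθ.1 hθ.2
        rwa [div_pow, hsq, one_pow] at this
      have : κ * θ ^ 2 ≤ 1 := by
        calc κ * θ ^ 2 ≤ κ * (1 / κ) := by gcongr
          _ = 1 := by field_simp
      have := Real.add_one_le_exp (-(κ * θ ^ 2 / 2))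
      linarith
    have e2 : ∫ θ in (-(1 / √κ))..(1 / √κ), Real.exp (-(κ * θ ^ 2 / 2)) ≤
        ∫ θ in (-π)..π, Real.exp (-(κ * θ ^ 2 / 2)) :=
      intervalIntegral.integral_mono_interval (by linarith) (by linarith) (by linarith)
        (Eventually.of_forall fun _ => (Real.exp_pos _).le)
        (Continuous.intervalIntegrable (by fun_prop) _ _)
    rw [intervalIntegral.integral_const, smul_eq_mul] at e1
    linarith
  have h5 : b * ∫ θ in (-π)..π, Real.exp (-(κ / π ^ 2) * θ ^ 2) ≤ b * (6 / √κ) := by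
    have : 0 ≤ b := by positivity
    gcongr
    exact h2.trans h3
  have h6 : b * (6 / √κ) ≤ 1 / (2 * √κ) := by
    have : b ≤ 1 / 12 := by
      rw [hb, ← mul_div_assoc, div_le_iff₀ hκ0]
      have : π ^ 2 ≤ 10 := by nlinarith
      have : (ν : ℝ) ^ 2 / 2 * π ^ 2 ≤ (ν : ℝ) ^ 2 / 2 * 10 := by gcongr
      linarith
    calc b * (6 / √κ) ≤ 1 / 12 * (6 / √κ) := by gcongr
      _ = _ := by field_simp; norm_num
  have h7 : 1 / √κ = 1 / (2 * √κ) + 1 / (2 * √κ) := by field_simp; norm_num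
  linarith

theorem exp_mul_I_add_inv (θ : ℝ) :
    Complex.exp (θ * Complex.I) + (Complex.exp (θ * Complex.I))⁻¹ = 2 * (Real.cos θ : ℝ) := by
  rw [← Complex.exp_neg, Complex.ofReal_cos, Complex.cos]
  ring_nf

theorem integral_exp_neg_mul_one_sub_cos_mul_inv_pow (ν : ℕ) (κ : ℝ) :
    ∫ θ in (-π)..π, ((Real.exp (-(κ * (1 - Real.cos θ))) : ℝ) : ℂ) *
        (Complex.exp (θ * Complex.I))⁻¹ ^ ν =
      ((2 * π * κ ^ ν * Real.exp (-κ) * besselItilde ν κ : ℝ) : ℂ) := by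
  have h := integral_exp_add_inv_mul_inv_pow ν (a := κ / 2) (b := κ / 2) (ζ := κ) (by ring)
  have h1 : ∀ θ : ℝ, ((Real.exp (-(κ * (1 - Real.cos θ))) : ℝ) : ℂ) *
      (Complex.exp (θ * Complex.I))⁻¹ ^ ν = (Real.exp (-κ) : ℝ) *
      (Complex.exp ((κ / 2 : ℝ) * Complex.exp (θ * Complex.I) +
        (κ / 2 : ℝ) * (Complex.exp (θ * Complex.I))⁻¹) * (Complex.exp (θ * Complex.I))⁻¹ ^ ν) := by
    intro θ
    rw [← mul_add, exp_mul_I_add_inv, ← mul_assoc, Complex.ofReal_exp, Complex.ofReal_exp,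
      ← Complex.exp_add]
    congr 2
    push_cast; ring
  simp only [h1]
  rw [intervalIntegral.integral_const_mul, h]
  push_cast
  ring_nf

theorem le_mul_besselItilde (ν : ℕ) {κ : ℝ} (hκ : 60 * (ν : ℝ) ^ 2 + 1 ≤ κ) :
    1 / (2 * √κ) ≤ 2 * π * κ ^ ν * Real.exp (-κ) * besselItilde ν κ := by
  refine (le_integral_exp_mul_cos ν hκ).trans_eq ?_
  have h := congrArg Complex.re (integral_exp_neg_mul_one_sub_cos_mul_inv_pow ν κ)
  rw [Complex.ofReal_re, ← Complex.reCLM_apply,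
    ← ContinuousLinearMap.intervalIntegral_comp_comm] at h
  · rw [← h]
    congr 1
    ext θ
    rw [Complex.reCLM_apply, Complex.re_ofReal_mul, ← Complex.exp_neg, ← Complex.exp_nat_mul]
    have : (ν : ℂ) * -(θ * Complex.I) = ((-(ν * θ) : ℝ) : ℂ) * Complex.I := by push_cast; ring
    rw [this, Complex.exp_ofReal_mul_I_re, Real.cos_neg]
  · refine Continuous.intervalIntegrable ?_ _ _
    simp only [← Complex.exp_neg]
    fun_prop

theorem norm_exp_neg_add_sub_le {w η : ℝ} {d : ℂ} (hw : 0 ≤ w) (hη : 0 ≤ η) (hη' : η ≤ 1 / 2)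
    (hd : ‖d‖ ≤ η * w) :
    ‖Complex.exp (-w + d) - Complex.exp (-w)‖ ≤ 4 * η * Real.exp (-(w / 4)) := by
  have h1 : ‖Complex.exp d - 1‖ ≤ ‖d‖ * Real.exp ‖d‖ := by
    simpa using Complex.norm_exp_sub_sum_le_norm_mul_exp d 1
  have h2 : ‖d‖ ≤ w / 2 := hd.trans (by nlinarith)
  have h3 : Complex.exp (-w + d) - Complex.exp (-w) =
      ((Real.exp (-w) : ℝ) : ℂ) * (Complex.exp d - 1) := by
    rw [Complex.exp_add]; push_cast; ring
  rw [h3, norm_mul, Complex.norm_real, Real.norm_of_nonneg (Real.exp_pos _).le]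
  have h4 : w * Real.exp (-(w / 4)) ≤ 4 := by
    have := Real.add_one_le_exp (w / 4)
    rw [Real.exp_neg, ← div_eq_mul_inv, div_le_iff₀ (Real.exp_pos _)]
    linarith
  calc Real.exp (-w) * ‖Complex.exp d - 1‖ ≤ Real.exp (-w) * (η * w * Real.exp (w / 2)) := by
        gcongr
        refine h1.trans ?_
        gcongr
    _ = η * (w * Real.exp (-(w / 4))) * Real.exp (-(w / 4)) := by
        have : Real.exp (-w) * Real.exp (w / 2) = Real.exp (-(w / 4)) * Real.exp (-(w / 4)) := by
          rw [← Real.exp_add, ← Real.exp_add]; congr 1; ring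
        linear_combination η * w * this
    _ ≤ η * 4 * Real.exp (-(w / 4)) := by gcongr
    _ = _ := by ring

theorem norm_exp_mul_I_sub_one_sq (θ : ℝ) :
    ‖Complex.exp (θ * Complex.I) - 1‖ ^ 2 = 2 * (1 - Real.cos θ) := by
  have h : Complex.exp (θ * Complex.I) - 1 =
      ((Real.cos θ - 1 : ℝ) : ℂ) + (Real.sin θ : ℝ) * Complex.I := by
    rw [Complex.exp_mul_I]; push_cast; ring
  rw [← Complex.normSq_eq_norm_sq, h, Complex.normSq_add_mul_I]
  nlinarith [Real.sin_sq_add_cos_sq θ]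

/-- The phase of the circle integral at the saddle radius is a small perturbation of
`κ (cos θ - 1)`. -/
theorem norm_saddle_phase_le {h : ℂ → ℂ} {h₀ h₁ : ℝ → ℝ} {M : ℝ} (hM : 0 ≤ M)
    (hh₁ : ∀ s, 0 < s → s ≤ 1 → |h₁ s| ≤ M)
    (hh : ∀ s : ℝ, 0 < s → s ≤ 1 → ∀ c : ℂ, ‖c‖ ≤ 1 →
      ‖h c - h₀ s - h₁ s * (c - s)‖ ≤ M * ‖c - s‖ ^ 2)
    {R t s κ : ℝ} (hR : 0 < R) (ht : 0 < t) (hs : 0 < s) (hs1 : s ≤ 1) (hMs : M * s ^ 2 ≤ 1 / 4)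
    (hcrit : π * R / s ^ 2 = t - R * h₁ s) (hκ : κ = 2 * √(π * t * R)) :
    |2 * t * s / κ - 1| ≤ M * s ^ 2 ∧ ∀ θ : ℝ,
      ‖(t * (s * Complex.exp (θ * Complex.I)) + π * R / (s * Complex.exp (θ * Complex.I))
          - R * h (s * Complex.exp (θ * Complex.I))) - (t * s + π * R / s - R * h₀ s : ℝ) +
        (κ * (1 - Real.cos θ) : ℝ)‖ ≤ 3 * M * s ^ 2 * (κ * (1 - Real.cos θ)) := by
  have hπ := Real.pi_pos
  have hπ3 := Real.pi_gt_three
  set b := π * R / s with hb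
  set ξ := s ^ 2 * h₁ s / π with hξ
  have hb0 : 0 < b := by positivity
  have hRb : R = b * s / π := by rw [hb]; field_simp
  have hab : t * s = b * (1 + ξ) := by
    have : t = π * R / s ^ 2 + R * h₁ s := by linarith
    rw [this, hξ, hb]; field_simp
  have hξM : |ξ| ≤ M * s ^ 2 := by
    rw [hξ, abs_div, abs_mul, abs_of_pos hπ, abs_of_nonneg (sq_nonneg s), div_le_iff₀ hπ]
    have := hh₁ s hs hs1
    nlinarith [sq_nonneg s, mul_le_mul_of_nonneg_left this (sq_nonneg s),
      mul_nonneg hM (sq_nonneg s)]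
  have hξ1 := abs_le.1 hξM
  set x := √(1 + ξ) with hx
  have hx2 : x ^ 2 = 1 + ξ := Real.sq_sqrt (by linarith)
  have hx0 : 0 ≤ x := Real.sqrt_nonneg _
  have hxhalf : 1 / 2 ≤ x := by nlinarith
  have hx1 : |x - 1| ≤ |ξ| := by
    have : (x - 1) * (x + 1) = ξ := by linear_combination hx2
    rw [← this, abs_mul]
    have : 1 ≤ |x + 1| := by rw [abs_of_nonneg (by linarith)]; linarith
    nlinarith [abs_nonneg (x - 1)]
  have hκx : κ = 2 * b * x := by
    have : π * t * R = (b * x) ^ 2 := by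
      rw [mul_pow, hx2]
      have : π * t * R = b * (t * s) := by rw [hb]; field_simp
      rw [this, hab]; ring
    rw [hκ, this, Real.sqrt_sq (by positivity)]; ring
  have hκ0 : 0 < κ := by rw [hκx]; positivity
  refine ⟨?_, fun θ => ?_⟩
  · have : 2 * t * s / κ = x := by
      rw [div_eq_iff hκ0.ne', hκx]
      linear_combination 2 * hab - 2 * b * hx2
    rw [this]
    exact hx1.trans hξM
  · set e := Complex.exp (θ * Complex.I) with he
    have he0 : e ≠ 0 := Complex.exp_ne_zero _
    have hen : ‖e‖ = 1 := Complex.norm_exp_ofReal_mul_I θ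
    have hw0 : 0 ≤ 1 - Real.cos θ := by linarith [Real.cos_le_one θ]
    have hsum : e + e⁻¹ = 2 * (Real.cos θ : ℝ) := exp_mul_I_add_inv θ
    have hs0 : (s : ℂ) ≠ 0 := by exact_mod_cast hs.ne'
    have hdiff : ‖(s : ℂ) * e - s‖ ^ 2 = s ^ 2 * (2 * (1 - Real.cos θ)) := by
      rw [← norm_exp_mul_I_sub_one_sq, ← he, show (s : ℂ) * e - s = s * (e - 1) by ring, norm_mul,
        mul_pow, Complex.norm_real, Real.norm_eq_abs, sq_abs]
    have herr := hh s hs hs1 (s * e) (by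
      rw [norm_mul, hen, mul_one, Complex.norm_real, Real.norm_of_nonneg hs.le]; exact hs1)
    rw [hdiff] at herr
    have hab' : (t : ℂ) * s = b * (1 + ξ) := by exact_mod_cast hab
    have hRξ : (R : ℂ) * h₁ s * s = b * ξ := by
      have : R * h₁ s * s = b * ξ := by rw [hRb, hξ]; field_simp
      exact_mod_cast this
    have hbC : (π : ℂ) * R / (s * e) = b * e⁻¹ := by
      rw [hb]; push_cast; field_simp
    have key : ((t : ℂ) * (s * e) + π * R / (s * e) - R * h (s * e)) -
        (t * s + b - R * h₀ s : ℝ) + (κ * (1 - Real.cos θ) : ℝ) =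
        ((κ - 2 * b) * (1 - Real.cos θ) : ℝ) -
          R * (h (s * e) - h₀ s - h₁ s * (s * e - s)) := by
      rw [hbC]
      push_cast at hsum ⊢
      linear_combination (e - 1) * hab' + (b : ℂ) * hsum - (e - 1) * hRξ
    rw [key]
    refine (norm_sub_le _ _).trans ?_
    rw [norm_mul, Complex.norm_real, Complex.norm_real, Real.norm_of_nonneg hR.le,
      Real.norm_eq_abs, abs_mul, abs_of_nonneg hw0]
    have e1 : |κ - 2 * b| ≤ 2 * (M * s ^ 2) * κ := by
      have : κ - 2 * b = 2 * b * (x - 1) := by rw [hκx]; ring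
      rw [this, abs_mul, abs_of_pos (by positivity)]
      calc 2 * b * |x - 1| ≤ 2 * b * (M * s ^ 2) := by gcongr; exact hx1.trans hξM
        _ ≤ 2 * κ * (M * s ^ 2) := by
          gcongr
          rw [hκx]; nlinarith
        _ = _ := by ring
    have e2 : R * 2 ≤ κ := by
      rw [hκx, hRb]
      have : b * s / π * 2 ≤ b * 1 / 2 * 2 := by gcongr; linarith
      nlinarith
    calc |κ - 2 * b| * (1 - Real.cos θ) + R * ‖h (s * e) - h₀ s - h₁ s * (s * e - s)‖
        ≤ (2 * (M * s ^ 2) * κ) * (1 - Real.cos θ) + R * (M * (s ^ 2 * (2 * (1 - Real.cos θ)))) := by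
          gcongr
      _ = (2 * (M * s ^ 2) * κ) * (1 - Real.cos θ) + (R * 2) * (M * s ^ 2 * (1 - Real.cos θ)) := by
          ring
      _ ≤ (2 * (M * s ^ 2) * κ) * (1 - Real.cos θ) + κ * (M * s ^ 2 * (1 - Real.cos θ)) := by
          gcongr
      _ = _ := by ring

/-- Integrand of the residue integral in the coordinate `c = π - y`. -/
noncomputable def phaseIntegrand (ν : ℕ) (h A : ℂ → ℂ) (R t : ℝ) (c : ℂ) : ℂ :=
  c⁻¹ ^ ν * Complex.exp (t * c + π * R / c - R * h c) * A c

/-- The expected leading term of the residue integral, up to a constant. -/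
noncomputable def besselTerm (ν : ℕ) (R t s h₀ κ : ℝ) : ℝ :=
  2 * π * (2 * t) ^ ν * Real.exp (t * s + π * R / s - R * h₀ - κ) * besselItilde ν κ

theorem norm_integral_sub_le_of_pointwise {f g : ℝ → ℂ} {b : ℝ → ℝ} (hf : Measurable f)
    (hg : Continuous g) (hb : Continuous b) (h : ∀ θ, ‖f θ - g θ‖ ≤ b θ) :
    ‖(∫ θ in (-π)..π, f θ) - ∫ θ in (-π)..π, g θ‖ ≤ ∫ θ in (-π)..π, b θ := by
  have hle : -π ≤ π := by linarith [Real.pi_pos]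
  have hgi : IntervalIntegrable g volume (-π) π := hg.intervalIntegrable _ _
  have hbi : IntervalIntegrable b volume (-π) π := hb.intervalIntegrable _ _
  have hd : IntervalIntegrable (fun θ => f θ - g θ) volume (-π) π :=
    hbi.mono_fun' (hf.sub hg.measurable).aestronglyMeasurable (Eventually.of_forall h)
  have hfi : IntervalIntegrable f volume (-π) π := by
    simpa using hd.add hgi
  rw [← intervalIntegral.integral_sub hfi hgi]
  exact intervalIntegral.norm_integral_le_of_norm_le hle (Eventually.of_forall fun θ _ => h θ) hbi

theorem exists_pow_sub_one_le (ν : ℕ) {ε : ℝ} (hε : 0 < ε) : ∃ δ : ℝ, 0 < δ ∧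
    ∀ x : ℝ, |x - 1| ≤ δ → |x ^ ν - 1| ≤ ε := by
  have h : Tendsto (fun x : ℝ => x ^ ν) (𝓝 1) (𝓝 1) := by
    simpa using (continuous_pow ν).tendsto (1 : ℝ)
  obtain ⟨δ, hδ, h⟩ := Metric.tendsto_nhds_nhds.1 h ε hε
  refine ⟨δ / 2, by positivity, fun x hx => ?_⟩
  have := h (x := x) (by rw [Real.dist_eq]; linarith)
  rw [Real.dist_eq] at this
  exact this.le

theorem exists_amplitude_close {A : ℝ → ℂ → ℂ} {A₀ : ℂ}
    (hA : Tendsto (fun p : ℝ × ℂ => A p.1 p.2) (atTop ×ˢ 𝓝 0) (𝓝 A₀)) {ε : ℝ} (hε : 0 < ε) :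
    ∃ T r : ℝ, 1 ≤ T ∧ 0 < r ∧ r ≤ 1 ∧ ∀ t c, T ≤ t → ‖c‖ ≤ r → ‖A t c - A₀‖ ≤ ε := by
  have h := (Metric.tendsto_nhds.1 hA) ε hε
  obtain ⟨p, hp, q, hq, hpq⟩ := Filter.eventually_prod_iff.1 h
  obtain ⟨T, hT⟩ := Filter.eventually_atTop.1 hp
  obtain ⟨r, hr, hr'⟩ := Metric.eventually_nhds_iff.1 hq
  refine ⟨max T 1, min (r / 2) 1, le_max_right _ _, by positivity, min_le_right _ _,
    fun t c ht hc => ?_⟩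
  have h1 := hpq (hT t ((le_max_left _ _).trans ht))
    (hr' (y := c) (by rw [dist_zero_right]; linarith [hc.trans (min_le_left _ _)]))
  rw [dist_eq_norm] at h1
  exact h1.le

theorem exists_phaseIntegral_large (ν : ℕ) {A : ℝ → ℂ → ℂ} {A₀ : ℂ}
    (hA : Tendsto (fun p : ℝ × ℂ => A p.1 p.2) (atTop ×ˢ 𝓝 0) (𝓝 A₀))
    (hAm : ∀ t, Measurable (A t)) {h : ℂ → ℂ} (hhm : Measurable h) {h₀ h₁ : ℝ → ℝ} {M : ℝ}
    (hM : 0 ≤ M) (hh₁ : ∀ s, 0 < s → s ≤ 1 → |h₁ s| ≤ M)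
    (hh : ∀ s : ℝ, 0 < s → s ≤ 1 → ∀ c : ℂ, ‖c‖ ≤ 1 →
      ‖h c - h₀ s - h₁ s * (c - s)‖ ≤ M * ‖c - s‖ ^ 2) {ε : ℝ} (hε : 0 < ε) :
    ∃ s₀ T : ℝ, 0 < s₀ ∧ s₀ ≤ 1 ∧ 1 ≤ T ∧ ∀ R t s κ : ℝ, 0 < R → T ≤ t → 0 < s → s ≤ s₀ →
      π * R / s ^ 2 = t - R * h₁ s → κ = 2 * √(π * t * R) → 60 * (ν : ℝ) ^ 2 + 1 ≤ κ →
      ‖(∫ θ in (-π)..π, phaseIntegrand ν h (A t) R t (s * Complex.exp (θ * Complex.I))) -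
        A₀ * besselTerm ν R t s (h₀ s) κ‖ ≤ ε * besselTerm ν R t s (h₀ s) κ := by
  have hπ := Real.pi_pos
  set N₀ := ‖A₀‖ with hN₀
  have hN₀0 : 0 ≤ N₀ := norm_nonneg _
  set ε₁ := ε / 32 with hε₁
  have hε₁0 : 0 < ε₁ := by positivity
  obtain ⟨T, r, hT, hr0, hr1, hAc⟩ := exists_amplitude_close hA
    (ε := min 1 (ε₁ / 4)) (by positivity)
  obtain ⟨δ, hδ, hpow⟩ := exists_pow_sub_one_le ν
    (ε := min (1 / 2) (ε₁ / (4 * (N₀ + 1)))) (by positivity)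
  set τ := min (1 / 8) (min δ (ε₁ / (48 * (N₀ + 1)))) with hτ
  have hτ0 : 0 < τ := by positivity
  refine ⟨min r (τ / (M + 1)), T, by positivity, (min_le_left _ _).trans hr1, hT,
    fun R t s κ hR ht hs hss hcrit hκ hκν => ?_⟩
  have hsr : s ≤ r := hss.trans (min_le_left _ _)
  have hs1 : s ≤ 1 := hsr.trans hr1
  have ht0 : 0 < t := by linarith
  have hMs : M * s ^ 2 ≤ τ := by
    have h1 : s * (M + 1) ≤ τ := by
      rw [← le_div_iff₀ (by positivity)]; exact hss.trans (min_le_right _ _)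
    nlinarith [mul_nonneg hM hs.le]
  have hτ1 : τ ≤ 1 / 8 := min_le_left _ _
  have hτ2 : τ ≤ δ := (min_le_right _ _).trans (min_le_left _ _)
  have hτ3 : τ ≤ ε₁ / (48 * (N₀ + 1)) := (min_le_right _ _).trans (min_le_right _ _)
  obtain ⟨hx, hphase⟩ := norm_saddle_phase_le hM hh₁ hh hR ht0 hs hs1 (by linarith) hcrit hκ
  set q := (2 * t * s / κ) ^ ν with hq
  have hq1 : |q - 1| ≤ min (1 / 2) (ε₁ / (4 * (N₀ + 1))) := hpow _ (by linarith)
  have hqhalf : 1 / 2 ≤ q := by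
    have := abs_le.1 (hq1.trans (min_le_left _ _)); linarith [this.1]
  have hκ0 : 0 < κ := by nlinarith [sq_nonneg (ν : ℝ)]
  set L := t * s + π * R / s - R * h₀ s with hL
  set K := 2 * π * κ ^ ν * Real.exp (-κ) * besselItilde ν κ with hK
  have hKlow : 1 / (2 * √κ) ≤ K := le_mul_besselItilde ν hκν
  have hG : besselTerm ν R t s (h₀ s) κ = ((s⁻¹) ^ ν * Real.exp L) * (q * K) := by
    rw [besselTerm, hK, hq, div_pow, ← hL, sub_eq_add_neg, Real.exp_add, inv_pow, mul_pow, mul_pow,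
      mul_pow]
    field_simp
  have hG' : (A₀ * besselTerm ν R t s (h₀ s) κ : ℂ) = (((s⁻¹) ^ ν * Real.exp L : ℝ) : ℂ) *
      ∫ θ in (-π)..π, (q * A₀) * (((Real.exp (-(κ * (1 - Real.cos θ))) : ℝ) : ℂ) *
        (Complex.exp (θ * Complex.I))⁻¹ ^ ν) := by
    rw [intervalIntegral.integral_const_mul, integral_exp_neg_mul_one_sub_cos_mul_inv_pow, hG, hK]
    push_cast; ring
  set f : ℝ → ℂ := fun θ => (Complex.exp (θ * Complex.I))⁻¹ ^ ν *
    Complex.exp ((t * (s * Complex.exp (θ * Complex.I)) +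
      π * R / (s * Complex.exp (θ * Complex.I)) -
      R * h (s * Complex.exp (θ * Complex.I))) - (L : ℝ)) *
    A t (s * Complex.exp (θ * Complex.I)) with hf
  have hcm : Measurable fun θ : ℝ => (s : ℂ) * Complex.exp (θ * Complex.I) := by fun_prop
  have hfm : Measurable f := by
    have h1 := hhm.comp hcm
    have h2 := (hAm t).comp hcm
    simp only [Function.comp_def] at h1 h2
    rw [hf]
    fun_prop
  have hF : ∫ θ in (-π)..π, phaseIntegrand ν h (A t) R t (s * Complex.exp (θ * Complex.I)) =
      (((s⁻¹) ^ ν * Real.exp L : ℝ) : ℂ) * ∫ θ in (-π)..π, f θ := by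
    rw [← intervalIntegral.integral_const_mul]
    refine intervalIntegral.integral_congr fun θ _ => ?_
    simp only [phaseIntegrand, hf]
    set X := (t * (s * Complex.exp (θ * Complex.I)) +
      π * R / (s * Complex.exp (θ * Complex.I)) - R * h (s * Complex.exp (θ * Complex.I)) : ℂ)
    have hX : Complex.exp X = Complex.exp (L : ℝ) * Complex.exp (X - (L : ℝ)) := by
      rw [← Complex.exp_add]; congr 1; ring
    rw [hX, mul_inv, mul_pow]
    push_cast
    ring
  rw [hF, hG', ← mul_sub, norm_mul, hG, Complex.norm_real,
    Real.norm_of_nonneg (by positivity), mul_left_comm]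
  refine mul_le_mul_of_nonneg_left ?_ (by positivity)
  have hpt : ∀ θ : ℝ, ‖f θ - (q * A₀) * (((Real.exp (-(κ * (1 - Real.cos θ))) : ℝ) : ℂ) *
        (Complex.exp (θ * Complex.I))⁻¹ ^ ν)‖ ≤
      ε₁ * Real.exp (-(κ / 4 * (1 - Real.cos θ))) := fun θ => by
    have hw0 : 0 ≤ κ * (1 - Real.cos θ) := by
      have := Real.cos_le_one θ
      apply mul_nonneg hκ0.le; linarith
    set w := κ * (1 - Real.cos θ) with hw
    have hp := hphase θ
    rw [← hw] at hp
    set e := Complex.exp (θ * Complex.I) with he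
    have hen : ‖e⁻¹ ^ ν‖ = 1 := by
      rw [norm_pow, norm_inv, he, Complex.norm_exp_ofReal_mul_I]; simp
    set X := (t * (s * e) + π * R / (s * e) - R * h (s * e)) - (L : ℝ) with hX
    set d := X + (w : ℝ) with hd
    have h1 := norm_exp_neg_add_sub_le (d := d) (η := 3 * M * s ^ 2) hw0 (by positivity)
      (by linarith) hp
    have h2 : Complex.exp X = Complex.exp (-w + d) := by rw [hd]; congr 1; ring
    have h3 := hAc t (s * e) ht (by
      rw [norm_mul, he, Complex.norm_exp_ofReal_mul_I, Complex.norm_real,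
        Real.norm_of_nonneg hs.le, mul_one]; exact hsr)
    have h4 : ‖A t (s * e)‖ ≤ N₀ + 1 := by
      have := norm_le_norm_add_norm_sub' (A t (s * e)) A₀
      have := h3.trans (min_le_left _ _)
      linarith
    have h5 : ‖A t (s * e) - q * A₀‖ ≤ ε₁ / 4 + ε₁ / 4 := by
      have e1 : A t (s * e) - q * A₀ = (A t (s * e) - A₀) - ((q - 1 : ℝ) : ℂ) * A₀ := by
        push_cast; ring
      rw [e1]
      refine (norm_sub_le _ _).trans (add_le_add (h3.trans (min_le_right _ _)) ?_)
      rw [norm_mul, Complex.norm_real, Real.norm_eq_abs]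
      calc |q - 1| * N₀ ≤ (ε₁ / (4 * (N₀ + 1))) * (N₀ + 1) := by
            gcongr
            · exact hq1.trans (min_le_right _ _)
            · linarith
        _ = _ := by field_simp
    have hEw : Real.exp (-(κ / 4 * (1 - Real.cos θ))) = Real.exp (-(w / 4)) := by
      rw [hw]; congr 1; ring
    have h6 : ‖Complex.exp (-w)‖ ≤ Real.exp (-(w / 4)) := by
      rw [Complex.norm_exp]
      simp only [Complex.neg_re, Complex.ofReal_re]
      gcongr; linarith
    have h7 : f θ - (q * A₀) * (((Real.exp (-w) : ℝ) : ℂ) * e⁻¹ ^ ν) =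
        e⁻¹ ^ ν * ((Complex.exp (-w + d) - Complex.exp (-w)) * A t (s * e) +
          Complex.exp (-w) * (A t (s * e) - q * A₀)) := by
      simp only [hf]
      rw [← he, ← hX, h2]
      push_cast
      ring
    rw [h7, hEw, norm_mul, hen, one_mul]
    refine (norm_add_le _ _).trans ?_
    rw [norm_mul, norm_mul]
    have h8 : 4 * (3 * M * s ^ 2) * (N₀ + 1) ≤ ε₁ / 4 := by
      calc 4 * (3 * M * s ^ 2) * (N₀ + 1) = 12 * (M * s ^ 2) * (N₀ + 1) := by ring
        _ ≤ 12 * (ε₁ / (48 * (N₀ + 1))) * (N₀ + 1) := by gcongr; linarith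
        _ = _ := by field_simp; norm_num
    calc _ ≤ (4 * (3 * M * s ^ 2) * Real.exp (-(w / 4))) * (N₀ + 1) +
          Real.exp (-(w / 4)) * (ε₁ / 4 + ε₁ / 4) := by gcongr
      _ = (4 * (3 * M * s ^ 2) * (N₀ + 1) + (ε₁ / 4 + ε₁ / 4)) * Real.exp (-(w / 4)) := by ring
      _ ≤ ε₁ * Real.exp (-(w / 4)) := by gcongr; linarith
  refine (norm_integral_sub_le_of_pointwise hfm ?_ (by fun_prop) hpt).trans ?_
  · simp only [← Complex.exp_neg]
    fun_prop
  · rw [intervalIntegral.integral_const_mul]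
    have h1 := integral_exp_neg_mul_one_sub_cos_le (a := κ / 4) (by positivity)
    have h2 : 4 / √(κ / 4) = 16 * (1 / (2 * √κ)) := by
      rw [Real.sqrt_div hκ0.le, show √(4 : ℝ) = 2 by
        rw [show (4 : ℝ) = 2 ^ 2 by norm_num]; exact Real.sqrt_sq (by norm_num)]
      field_simp
      norm_num
    rw [h2] at h1
    have hK0 : 0 ≤ K := le_trans (by positivity) hKlow
    calc ε₁ * _ ≤ ε₁ * (16 * K) := by gcongr; linarith
      _ = ε * (1 / 2 * K) := by rw [hε₁]; ring
      _ ≤ ε * (q * K) := by gcongr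

theorem add_sub_two_mul_sqrt_mem {a b : ℝ} (ha : 0 ≤ a) (hb : 0 ≤ b) :
    0 ≤ a + b - 2 * √(a * b) ∧ a + b - 2 * √(a * b) ≤ |a - b| := by
  have h1 := Real.sq_sqrt ha
  have h2 := Real.sq_sqrt hb
  have h3 := Real.sqrt_nonneg a
  have h4 := Real.sqrt_nonneg b
  rw [Real.sqrt_mul ha]
  refine ⟨by nlinarith [sq_nonneg (√a - √b)], ?_⟩
  rcases le_total (√a) (√b) with h | h
  · have := neg_abs_le (a - b); nlinarith
  · have := le_abs_self (a - b); nlinarith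

theorem exponent_sub_mem {R t s κ h₁ M : ℝ} (hR : 0 < R) (ht : 0 < t) (hs : 0 < s) (hs1 : s ≤ 1)
    (hh₁ : |h₁| ≤ M) (hcrit : π * R / s ^ 2 = t - R * h₁) (hκ : κ = 2 * √(π * t * R)) :
    0 ≤ t * s + π * R / s - κ ∧ t * s + π * R / s - κ ≤ R * M := by
  have hb : π * R / s = t * s - s * (R * h₁) := by
    have : π * R / s = π * R / s ^ 2 * s := by field_simp
    rw [this, hcrit]; ring
  have hab : t * s * (π * R / s) = π * t * R := by field_simp
  obtain ⟨h1, h2⟩ := add_sub_two_mul_sqrt_mem (a := t * s) (b := π * R / s) (by positivity)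
    (by positivity)
  rw [hab, ← hκ] at h1 h2
  refine ⟨h1, h2.trans ?_⟩
  rw [hb, show t * s - (t * s - s * (R * h₁)) = s * (R * h₁) by ring, abs_mul, abs_mul,
    abs_of_pos hs, abs_of_pos hR]
  have : R * |h₁| ≤ R * M := by gcongr
  have h0 : 0 ≤ R * |h₁| := by positivity
  nlinarith

set_option maxHeartbeats 1000000 in
theorem exists_phaseIntegral_small (ν : ℕ) {A : ℝ → ℂ → ℂ} {A₀ : ℂ}
    (hA : Tendsto (fun p : ℝ × ℂ => A p.1 p.2) (atTop ×ˢ 𝓝 0) (𝓝 A₀))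
    (hAm : ∀ t, Measurable (A t)) {h : ℂ → ℂ} (hhm : Measurable h) {h₀ h₁ : ℝ → ℝ} {M : ℝ}
    (hM : 0 ≤ M) (hh₁ : ∀ s, 0 < s → s ≤ 1 → |h₁ s| ≤ M) (hh₀ : ∀ s, 0 < s → s ≤ 1 → |h₀ s| ≤ M)
    (hh : ∀ c : ℂ, ‖c‖ ≤ 1 → ‖h c‖ ≤ M) (K : ℝ) {ε : ℝ} (hε : 0 < ε) :
    ∃ T : ℝ, 1 ≤ T ∧ ∀ R t s κ : ℝ, 0 < R → T ≤ t → 0 < s → s ≤ 1 →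
      π * R / s ^ 2 = t - R * h₁ s → κ = 2 * √(π * t * R) → κ ≤ K →
      ‖(∫ θ in (-π)..π,
          phaseIntegrand ν h (A t) R t ((t⁻¹ : ℝ) * Complex.exp (θ * Complex.I))) -
        A₀ * besselTerm ν R t s (h₀ s) κ‖ ≤ ε * besselTerm ν R t s (h₀ s) κ := by
  have hπ := Real.pi_pos
  have hπ3 := Real.pi_gt_three
  set N₀ := ‖A₀‖ with hN₀
  have hN₀0 : 0 ≤ N₀ := norm_nonneg _
  set E := Real.exp (1 + K ^ 2 / 4) with hE
  have hE0 : 0 < E := Real.exp_pos _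
  have hf0 : (0 : ℝ) < ν.factorial := by exact_mod_cast ν.factorial_pos
  set η := ε / (4 * E * ν.factorial) with hη
  have hη0 : 0 < η := by positivity
  obtain ⟨T₁, r, hT₁, hr0, hr1, hAc⟩ := exists_amplitude_close hA
    (ε := min 1 (η / 2)) (by positivity)
  set τ := min (1 / 4) (min (η / (4 * (N₀ + 1))) (ε / (16 * (N₀ + 1)))) with hτ
  have hτ0 : 0 < τ := by positivity
  refine ⟨max T₁ (max r⁻¹ (K ^ 2 * M / τ)), hT₁.trans (le_max_left _ _),
    fun R t s κ hR ht hs hs1 hcrit hκ hκK => ?_⟩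
  have htT : T₁ ≤ t := (le_max_left _ _).trans ht
  have ht0 : 0 < t := by linarith
  have htr : t⁻¹ ≤ r := by
    rw [inv_le_comm₀ ht0 hr0]; exact ((le_max_left _ _).trans (le_max_right _ _)).trans ht
  have hκ0 : 0 ≤ κ := by rw [hκ]; positivity
  have hκsq : κ ^ 2 = 4 * (π * t * R) := by
    rw [hκ, mul_pow, Real.sq_sqrt (by positivity)]; norm_num
  have hκK2 : κ ^ 2 ≤ K ^ 2 := by gcongr
  have hRM : R * M ≤ τ := by
    have h1 : K ^ 2 * M / τ ≤ t := ((le_max_right _ _).trans (le_max_right _ _)).trans ht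
    rw [div_le_iff₀ hτ0] at h1
    have h2 : t * R ≤ K ^ 2 := by
      have : 0 < t * R := by positivity
      nlinarith
    have h3 : t * R * M ≤ t * τ := by nlinarith
    nlinarith
  have hτ1 : τ ≤ 1 / 4 := min_le_left _ _
  have hτ2 : τ ≤ η / (4 * (N₀ + 1)) := (min_le_right _ _).trans (min_le_left _ _)
  have hτ3 : τ ≤ ε / (16 * (N₀ + 1)) := (min_le_right _ _).trans (min_le_right _ _)
  have hRM0 : 0 ≤ R * M := by positivity
  set D := t * s + π * R / s - R * h₀ s - κ with hD
  have hDb : |D| ≤ 2 * (R * M) := by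
    obtain ⟨h1, h2⟩ := exponent_sub_mem hR ht0 hs hs1 (hh₁ s hs hs1) hcrit hκ
    have h3 := abs_le.1 (hh₀ s hs hs1)
    rw [abs_le, hD]
    constructor <;> nlinarith
  set J := 2 * π * 2 ^ ν * besselItilde ν κ with hJ
  have hJlow : 2 * π / ν.factorial ≤ J := by
    have := le_besselItilde ν κ
    calc 2 * π / ν.factorial = 2 * π * 2 ^ ν * (1 / (2 ^ ν * ν.factorial)) := by field_simp
      _ ≤ J := by rw [hJ]; gcongr
  have hJ0 : 0 < J := lt_of_lt_of_le (by positivity) hJlow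
  have hG : besselTerm ν R t s (h₀ s) κ = t ^ ν * (J * Real.exp D) := by
    rw [besselTerm, ← hD, hJ, mul_pow]; ring
  set f : ℝ → ℂ := fun θ => (Complex.exp (θ * Complex.I))⁻¹ ^ ν *
    Complex.exp (Complex.exp (θ * Complex.I) +
      (κ ^ 2 / 4 : ℝ) * (Complex.exp (θ * Complex.I))⁻¹) *
    (Complex.exp (-(R * h ((t⁻¹ : ℝ) * Complex.exp (θ * Complex.I)))) *
      A t ((t⁻¹ : ℝ) * Complex.exp (θ * Complex.I))) with hf
  have hcm : Measurable fun θ : ℝ => ((t⁻¹ : ℝ) : ℂ) * Complex.exp (θ * Complex.I) := by fun_prop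
  have hfm : Measurable f := by
    have h1 := hhm.comp hcm
    have h2 := (hAm t).comp hcm
    simp only [Function.comp_def] at h1 h2
    rw [hf]
    fun_prop
  have htc : (t : ℂ) ≠ 0 := by exact_mod_cast ht0.ne'
  have hF : ∫ θ in (-π)..π,
      phaseIntegrand ν h (A t) R t ((t⁻¹ : ℝ) * Complex.exp (θ * Complex.I)) =
      ((t ^ ν : ℝ) : ℂ) * ∫ θ in (-π)..π, f θ := by
    rw [← intervalIntegral.integral_const_mul]
    refine intervalIntegral.integral_congr fun θ _ => ?_
    simp only [phaseIntegrand, hf]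
    set e := Complex.exp (θ * Complex.I) with he
    have he0 : e ≠ 0 := Complex.exp_ne_zero _
    have hX : (t : ℂ) * ((t⁻¹ : ℝ) * e) + π * R / ((t⁻¹ : ℝ) * e) - R * h ((t⁻¹ : ℝ) * e) =
        (e + (κ ^ 2 / 4 : ℝ) * e⁻¹) + (-(R * h ((t⁻¹ : ℝ) * e))) := by
      rw [hκsq]
      push_cast
      field_simp
      ring
    rw [hX, Complex.exp_add, mul_inv, mul_pow]
    push_cast
    rw [inv_inv]
    ring
  have hG' : (A₀ * (J * t ^ ν : ℝ) : ℂ) = ((t ^ ν : ℝ) : ℂ) *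
      ∫ θ in (-π)..π, A₀ * (Complex.exp ((1 : ℝ) * Complex.exp (θ * Complex.I) +
        (κ ^ 2 / 4 : ℝ) * (Complex.exp (θ * Complex.I))⁻¹) *
        (Complex.exp (θ * Complex.I))⁻¹ ^ ν) := by
    rw [intervalIntegral.integral_const_mul,
      integral_exp_add_inv_mul_inv_pow ν (a := 1) (b := κ ^ 2 / 4) (ζ := κ) (by ring), hJ]
    push_cast; ring
  have hpt : ∀ θ : ℝ, ‖f θ - A₀ * (Complex.exp ((1 : ℝ) * Complex.exp (θ * Complex.I) +
        (κ ^ 2 / 4 : ℝ) * (Complex.exp (θ * Complex.I))⁻¹) *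
        (Complex.exp (θ * Complex.I))⁻¹ ^ ν)‖ ≤ E * η := fun θ => by
    set e := Complex.exp (θ * Complex.I) with he
    have hen0 : ‖e‖ = 1 := by rw [he, Complex.norm_exp_ofReal_mul_I]
    have hen : ‖e⁻¹ ^ ν‖ = 1 := by
      rw [norm_pow, norm_inv, hen0]; simp
    set c := ((t⁻¹ : ℝ) : ℂ) * e with hc
    have hcn : ‖c‖ ≤ r := by
      rw [hc, norm_mul, hen0, Complex.norm_real, Real.norm_of_nonneg (by positivity), mul_one]
      exact htr
    have h1 : ‖-(R * h c)‖ ≤ R * M := by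
      rw [norm_neg, norm_mul, Complex.norm_real, Real.norm_of_nonneg hR.le]
      gcongr
      exact hh c (hcn.trans hr1)
    have h2 : ‖Complex.exp (-(R * h c)) - 1‖ ≤ 2 * (R * M) :=
      (Complex.norm_exp_sub_one_le (by linarith)).trans (by linarith)
    have h3 := hAc t c htT hcn
    have h4 : ‖A t c‖ ≤ N₀ + 1 := by
      have := norm_le_norm_add_norm_sub' (A t c) A₀
      have := h3.trans (min_le_left _ _)
      linarith
    have h5 : ‖Complex.exp (-(R * h c)) * A t c - A₀‖ ≤ η := by
      have e1 : Complex.exp (-(R * h c)) * A t c - A₀ =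
          (Complex.exp (-(R * h c)) - 1) * A t c + (A t c - A₀) := by ring
      rw [e1]
      refine (norm_add_le _ _).trans ?_
      rw [norm_mul]
      calc _ ≤ 2 * (R * M) * (N₀ + 1) + η / 2 := by
            gcongr
            exact h3.trans (min_le_right _ _)
        _ ≤ 2 * (η / (4 * (N₀ + 1))) * (N₀ + 1) + η / 2 := by
            gcongr
            exact hRM.trans hτ2
        _ = η := by field_simp; norm_num
    have h6 : ‖Complex.exp (e + (κ ^ 2 / 4 : ℝ) * e⁻¹)‖ ≤ E := by
      rw [Complex.norm_exp, hE]
      gcongr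
      refine (Complex.re_le_norm _).trans ((norm_add_le _ _).trans ?_)
      rw [norm_mul, norm_inv, hen0, Complex.norm_real, Real.norm_of_nonneg (by positivity)]
      linarith
    have h7 : f θ - A₀ * (Complex.exp ((1 : ℝ) * e + (κ ^ 2 / 4 : ℝ) * e⁻¹) * e⁻¹ ^ ν) =
        e⁻¹ ^ ν * Complex.exp (e + (κ ^ 2 / 4 : ℝ) * e⁻¹) *
          (Complex.exp (-(R * h c)) * A t c - A₀) := by
      simp only [hf]
      rw [← he, ← hc, Complex.ofReal_one, one_mul]
      ring
    rw [h7, norm_mul, norm_mul, hen, one_mul]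
    gcongr
  have hmain : ‖(∫ θ in (-π)..π,
        phaseIntegrand ν h (A t) R t ((t⁻¹ : ℝ) * Complex.exp (θ * Complex.I))) -
      (A₀ * (J * t ^ ν : ℝ) : ℂ)‖ ≤ t ^ ν * (ε / 4 * J) := by
    rw [hF, hG', ← mul_sub, norm_mul, Complex.norm_real, Real.norm_of_nonneg (by positivity)]
    refine mul_le_mul_of_nonneg_left ?_ (by positivity)
    refine (norm_integral_sub_le_of_pointwise hfm ?_ (by fun_prop) hpt).trans ?_
    · have hec : Continuous fun θ : ℝ => Complex.exp (θ * Complex.I) := by fun_prop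
      have hei : Continuous fun θ : ℝ => (Complex.exp (θ * Complex.I))⁻¹ :=
        hec.inv₀ fun θ => Complex.exp_ne_zero _
      exact continuous_const.mul ((((continuous_const.mul hec).add
        (continuous_const.mul hei)).cexp).mul (hei.pow ν))
    · rw [intervalIntegral.integral_const, smul_eq_mul]
      calc (π - -π) * (E * η) = ε / 4 * (2 * π / ν.factorial) := by rw [hη]; field_simp; ring
        _ ≤ _ := by gcongr
  have hD1 : |D| ≤ 1 / 2 := by linarith
  have hexpD : ‖(Real.exp D : ℂ) - 1‖ ≤ 2 * |D| := by
    have := Complex.norm_exp_sub_one_le (x := (D : ℂ)) (by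
      rw [Complex.norm_real, Real.norm_eq_abs]; linarith)
    rw [Complex.norm_real, Real.norm_eq_abs] at this
    push_cast
    exact this
  have hexpD' : 1 / 2 ≤ Real.exp D := by
    have := Real.add_one_le_exp D
    have := (abs_le.1 hD1).1
    linarith
  have hsec : ‖(A₀ * (J * t ^ ν : ℝ) : ℂ) - A₀ * besselTerm ν R t s (h₀ s) κ‖ ≤
      t ^ ν * (ε / 4 * J) := by
    have e1 : (A₀ * (J * t ^ ν : ℝ) : ℂ) - A₀ * besselTerm ν R t s (h₀ s) κ =
        -(A₀ * (t ^ ν * J : ℝ) * ((Real.exp D : ℂ) - 1)) := by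
      rw [hG]; push_cast; ring
    rw [e1, norm_neg, norm_mul, norm_mul, Complex.norm_real, Real.norm_of_nonneg (by positivity)]
    calc ‖A₀‖ * (t ^ ν * J) * ‖(Real.exp D : ℂ) - 1‖
        ≤ (N₀ + 1) * (t ^ ν * J) * (2 * (2 * (ε / (16 * (N₀ + 1))))) := by
          gcongr
          · linarith
          · exact hexpD.trans (by linarith)
      _ = _ := by field_simp; norm_num
  calc _ ≤ t ^ ν * (ε / 4 * J) + t ^ ν * (ε / 4 * J) :=
        (norm_sub_le_norm_sub_add_norm_sub _ _ _).trans (add_le_add hmain hsec)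
    _ = ε * (t ^ ν * (J * (1 / 2))) := by ring
    _ ≤ _ := by rw [hG]; gcongr

theorem exists_phaseIntegral (ν : ℕ) {A : ℝ → ℂ → ℂ} {A₀ : ℂ}
    (hA : Tendsto (fun p : ℝ × ℂ => A p.1 p.2) (atTop ×ˢ 𝓝 0) (𝓝 A₀))
    (hAm : ∀ t, Measurable (A t)) {h : ℂ → ℂ} (hhm : Measurable h) {h₀ h₁ : ℝ → ℝ} {M : ℝ}
    (hM : 0 ≤ M) (hh₁ : ∀ s, 0 < s → s ≤ 1 → |h₁ s| ≤ M) (hh₀ : ∀ s, 0 < s → s ≤ 1 → |h₀ s| ≤ M)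
    (hh : ∀ c : ℂ, ‖c‖ ≤ 1 → ‖h c‖ ≤ M)
    (hT : ∀ s : ℝ, 0 < s → s ≤ 1 → ∀ c : ℂ, ‖c‖ ≤ 1 →
      ‖h c - h₀ s - h₁ s * (c - s)‖ ≤ M * ‖c - s‖ ^ 2) {ε : ℝ} (hε : 0 < ε) :
    ∃ s₀ T : ℝ, 0 < s₀ ∧ s₀ ≤ 1 ∧ 1 ≤ T ∧ ∀ R t s κ : ℝ, 0 < R → T ≤ t → 0 < s → s ≤ s₀ →
      π * R / s ^ 2 = t - R * h₁ s → κ = 2 * √(π * t * R) → ∃ σ : ℝ, 0 < σ ∧ σ ≤ 1 ∧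
      ‖(∫ θ in (-π)..π, phaseIntegrand ν h (A t) R t (σ * Complex.exp (θ * Complex.I))) -
        A₀ * besselTerm ν R t s (h₀ s) κ‖ ≤ ε * besselTerm ν R t s (h₀ s) κ := by
  obtain ⟨s₀, T₁, hs₀, hs₁, hT₁, H₁⟩ := exists_phaseIntegral_large ν hA hAm hhm hM hh₁ hT hε
  obtain ⟨T₂, hT₂, H₂⟩ := exists_phaseIntegral_small ν hA hAm hhm hM hh₁ hh₀ hh
    (60 * (ν : ℝ) ^ 2 + 1) hε
  refine ⟨s₀, max T₁ T₂, hs₀, hs₁, hT₁.trans (le_max_left _ _),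
    fun R t s κ hR ht hs hss hc hκ => ?_⟩
  have ht1 : T₁ ≤ t := (le_max_left _ _).trans ht
  have ht2 : T₂ ≤ t := (le_max_right _ _).trans ht
  rcases le_total κ (60 * (ν : ℝ) ^ 2 + 1) with hk | hk
  · exact ⟨t⁻¹, inv_pos.2 (by linarith), inv_le_one_of_one_le₀ (by linarith),
      H₂ R t s κ hR ht2 hs (hss.trans hs₁) hc hκ hk⟩
  · exact ⟨s, hs, hss.trans hs₁, H₁ R t s κ hR ht1 hs hss hc hκ hk⟩

theorem exists_quadratic_bound {h : ℂ → ℂ} {r : ℝ} (hr : 1 < r)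
    (hd : DifferentiableOn ℂ h (Metric.ball 0 r)) :
    ∃ M : ℝ, 0 ≤ M ∧ (∀ c, ‖c‖ ≤ 1 → ‖h c‖ ≤ M) ∧ (∀ c, ‖c‖ ≤ 1 → ‖deriv h c‖ ≤ M) ∧
      ∀ a c, ‖a‖ ≤ 1 → ‖c‖ ≤ 1 → ‖h c - h a - deriv h a * (c - a)‖ ≤ M * ‖c - a‖ ^ 2 := by
  have hsub : Metric.closedBall (0 : ℂ) 1 ⊆ Metric.ball 0 r := Metric.closedBall_subset_ball hr
  have hK := isCompact_closedBall (0 : ℂ) 1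
  have hd1 := hd.deriv Metric.isOpen_ball
  have hd2 := hd1.deriv Metric.isOpen_ball
  obtain ⟨M₀, h₀⟩ := hK.exists_bound_of_continuousOn (hd.continuousOn.mono hsub)
  obtain ⟨M₁, h₁⟩ := hK.exists_bound_of_continuousOn (hd1.continuousOn.mono hsub)
  obtain ⟨M₂, h₂⟩ := hK.exists_bound_of_continuousOn (hd2.continuousOn.mono hsub)
  simp only [mem_closedBall_zero_iff] at h₀ h₁ h₂
  set M := max M₀ (max M₁ M₂)
  have hM0 : 0 ≤ M := ((norm_nonneg _).trans (h₀ 0 (by simp))).trans (le_max_left _ _)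
  have hat : ∀ {f : ℂ → ℂ}, DifferentiableOn ℂ f (Metric.ball 0 r) → ∀ z, ‖z‖ ≤ 1 →
      HasDerivAt f (deriv f z) z := fun hf z hz =>
    (hf.differentiableAt (Metric.isOpen_ball.mem_nhds
      (hsub (mem_closedBall_zero_iff.2 hz)))).hasDerivAt
  refine ⟨M, hM0, fun c hc => (h₀ c hc).trans (le_max_left _ _),
    fun c hc => (h₁ c hc).trans ((le_max_left _ _).trans (le_max_right _ _)),
    fun a c ha hc => ?_⟩
  have hlip : ∀ z, ‖z‖ ≤ 1 → ‖deriv h z - deriv h a‖ ≤ M * ‖z - a‖ := fun z hz =>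
    (convex_closedBall (0 : ℂ) 1).norm_image_sub_le_of_norm_hasDerivWithin_le
      (fun w hw => (hat hd1 w (mem_closedBall_zero_iff.1 hw)).hasDerivWithinAt)
      (fun w hw => (h₂ w (mem_closedBall_zero_iff.1 hw)).trans
        ((le_max_right _ _).trans (le_max_right _ _)))
      (mem_closedBall_zero_iff.2 ha) (mem_closedBall_zero_iff.2 hz)
  have hcv : Convex ℝ (Metric.closedBall (0 : ℂ) 1 ∩ Metric.closedBall a ‖c - a‖) :=
    (convex_closedBall _ _).inter (convex_closedBall _ _)
  have key := hcv.norm_image_sub_le_of_norm_hasDerivWithin_le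
    (f := fun z => h z - deriv h a * z) (f' := fun z => deriv h z - deriv h a)
    (C := M * ‖c - a‖) (x := a) (y := c)
    (fun w hw => by
      have h1 := (hat hd w (mem_closedBall_zero_iff.1 hw.1)).fun_sub
        ((hasDerivAt_id w).const_mul (deriv h a))
      simpa using h1.hasDerivWithinAt)
    (fun w hw => (hlip w (mem_closedBall_zero_iff.1 hw.1)).trans (by
      have := hw.2
      rw [Metric.mem_closedBall, dist_eq_norm] at this
      gcongr))
    ⟨mem_closedBall_zero_iff.2 ha, by simp⟩
    ⟨mem_closedBall_zero_iff.2 hc, by rw [Metric.mem_closedBall, dist_eq_norm]⟩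
  calc _ = ‖h c - deriv h a * c - (h a - deriv h a * a)‖ := by congr 1; ring
    _ ≤ M * ‖c - a‖ * ‖c - a‖ := key
    _ = _ := by ring

/-- The entire function `sin c / c`. -/
noncomputable def sincC (c : ℂ) : ℂ := sinhcSqrt (-c ^ 2)

theorem mul_sincC (c : ℂ) : c * sincC c = Complex.sin c := mul_sinhcSqrt_neg_sq c

theorem differentiable_sincC : Differentiable ℂ sincC :=
  differentiable_sinhcSqrt.comp (by fun_prop)

theorem sincC_zero : sincC 0 = 1 := by simp [sincC, sinhcSqrt_zero]

/-- The holomorphic part of `-y cot y = π / c - cotRemainder c` at `c = π - y`. -/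
noncomputable def cotRemainder (c : ℂ) : ℂ :=
  (π * dslope (fun z => sincC z - Complex.cos z) 0 c + Complex.cos c) / sincC c

theorem differentiable_dslope_sincC_sub_cos :
    Differentiable ℂ (dslope (fun z => sincC z - Complex.cos z) 0) := by
  rw [← differentiableOn_univ, Complex.differentiableOn_dslope univ_mem, differentiableOn_univ]
  exact differentiable_sincC.sub Complex.differentiable_cos

theorem measurable_cotRemainder : Measurable cotRemainder := by
  have h1 := differentiable_dslope_sincC_sub_cos.continuous.measurable
  have h2 := differentiable_sincC.continuous.measurable
  unfold cotRemainder
  exact ((h1.const_mul _).add Complex.continuous_cos.measurable).div h2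

theorem sin_ne_zero_of_norm_lt_pi {c : ℂ} (h0 : c ≠ 0) (hc : ‖c‖ < π) : Complex.sin c ≠ 0 := by
  have h1 := sin_ne_zero_of_abs_re_sub_pi_lt (z := π - c) (by
    simp only [Complex.sub_re, Complex.ofReal_re, sub_sub_cancel_left, abs_neg]
    exact (Complex.abs_re_le_norm c).trans_lt hc) (by
    intro h; apply h0; linear_combination -h)
  rwa [Complex.sin_pi_sub] at h1

theorem sincC_ne_zero {c : ℂ} (hc : ‖c‖ < π) : sincC c ≠ 0 := by
  rcases eq_or_ne c 0 with rfl | h0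
  · rw [sincC_zero]; exact one_ne_zero
  · intro h
    apply sin_ne_zero_of_norm_lt_pi h0 hc
    rw [← mul_sincC, h, mul_zero]

theorem differentiableOn_cotRemainder : DifferentiableOn ℂ cotRemainder (Metric.ball 0 π) := by
  refine DifferentiableOn.div ?_ differentiable_sincC.differentiableOn fun c hc =>
    sincC_ne_zero (mem_ball_zero_iff.1 hc)
  exact ((differentiable_dslope_sincC_sub_cos.const_mul _).add
    Complex.differentiable_cos).differentiableOn

theorem cotRemainder_eq {c : ℂ} (h0 : c ≠ 0) (hs : Complex.sin c ≠ 0) :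
    cotRemainder c = π / c - (π - c) * Complex.cos c / Complex.sin c := by
  have hT : sincC c ≠ 0 := fun h => hs (by rw [← mul_sincC, h, mul_zero])
  rw [cotRemainder, dslope_of_ne _ h0, slope_def_field, ← mul_sincC]
  simp only [sincC_zero, Complex.cos_zero, sub_self, sub_zero]
  field_simp
  ring

theorem cotRemainder_ofReal {s : ℝ} (h0 : 0 < s) (h1 : s ≤ 1) :
    cotRemainder s = (π / s - (π - s) * Real.cos s / Real.sin s : ℝ) := by
  have hc0 : (s : ℂ) ≠ 0 := by exact_mod_cast h0.ne'
  rw [cotRemainder_eq hc0 (sin_ne_zero_of_norm_lt_pi hc0 (by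
    rw [Complex.norm_real, Real.norm_of_nonneg h0.le]; linarith [Real.pi_gt_three]))]
  push_cast
  ring

theorem deriv_cotRemainder_ofReal {s : ℝ} (h0 : 0 < s) (h1 : s ≤ 1) :
    deriv cotRemainder s = (((π - s) / Real.sin s ^ 2 + Real.cos s / Real.sin s - π / s ^ 2 : ℝ)
      : ℂ) := by
  have hc0 : (s : ℂ) ≠ 0 := by exact_mod_cast h0.ne'
  have hsn : ‖(s : ℂ)‖ < π := by
    rw [Complex.norm_real, Real.norm_of_nonneg h0.le]; linarith [Real.pi_gt_three]
  have hs := sin_ne_zero_of_norm_lt_pi hc0 hsn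
  have hev : cotRemainder =ᶠ[𝓝 (s : ℂ)]
      fun c => π / c - (π - c) * Complex.cos c / Complex.sin c := by
    filter_upwards [isOpen_ne.mem_nhds hc0,
      (isOpen_ne.preimage Complex.continuous_sin).mem_nhds hs] with c hc hc'
    exact cotRemainder_eq hc hc'
  rw [hev.deriv_eq]
  have hid := hasDerivAt_id (s : ℂ)
  have hd := ((hasDerivAt_const (s : ℂ) (π : ℂ)).fun_div hid hc0).fun_sub
    ((((hasDerivAt_const (s : ℂ) (π : ℂ)).fun_sub hid).fun_mul (Complex.hasDerivAt_cos s)).fun_div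
      (Complex.hasDerivAt_sin s) hs)
  refine hd.deriv.trans ?_
  have hsq := Complex.sin_sq_add_cos_sq (s : ℂ)
  push_cast
  simp only [id]
  field_simp
  linear_combination ((s : ℂ) ^ 2 * (π - s)) * hsq

/-- Amplitude of the residue integral in the coordinate `c = π - y`. -/
noncomputable def residueAmplitude (N k₁ m k : ℕ) (t : ℝ) (c : ℂ) : ℂ :=
  ((π - c) / sincC c) ^ N * (-Complex.cos c) ^ k₁ * (π - c) * transverse m k t (π - c)

theorem measurable_residueAmplitude (N k₁ m k : ℕ) (t : ℝ) :
    Measurable (residueAmplitude N k₁ m k t) := by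
  have h1 := differentiable_sincC.continuous.measurable
  have h2 : Measurable fun c : ℂ => (π : ℂ) - c := by fun_prop
  have h3 := (measurable_transverse m k t).comp h2
  have h4 := Complex.continuous_cos.measurable
  simp only [Function.comp_def] at h3
  unfold residueAmplitude
  exact ((((h2.div h1).pow_const N).mul (h4.neg.pow_const k₁)).mul h2).mul h3

/-- The limit of `residueAmplitude` at `(t, c) = (∞, 0)`. -/
noncomputable def residueLimit (N k₁ m k : ℕ) : ℂ :=
  (π : ℂ) ^ N * (-1) ^ k₁ * π * ((((2 * π ^ 2) ^ ((m : ℝ) / 2) : ℝ) : ℂ) * ((π : ℂ) ^ k / π))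

theorem tendsto_residueAmplitude (N k₁ m k : ℕ) :
    Tendsto (fun p : ℝ × ℂ => residueAmplitude N k₁ m k p.1 p.2) (atTop ×ˢ 𝓝 0)
      (𝓝 (residueLimit N k₁ m k)) := by
  have hsub : Tendsto (fun c : ℂ => (π : ℂ) - c) (𝓝 0) (𝓝 π) := by
    have : Continuous fun c : ℂ => (π : ℂ) - c := by fun_prop
    simpa using this.tendsto 0
  have h1 := (tendsto_transverse m k).comp
    ((tendsto_fst (f := (atTop : Filter ℝ)) (g := 𝓝 (0 : ℂ))).prodMk (hsub.comp tendsto_snd))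
  have h2 : Tendsto (fun c : ℂ => ((π - c) / sincC c) ^ N * (-Complex.cos c) ^ k₁ * (π - c))
      (𝓝 0) (𝓝 ((π : ℂ) ^ N * (-1) ^ k₁ * π)) := by
    have hT : Tendsto sincC (𝓝 0) (𝓝 1) := by
      have := differentiable_sincC.continuous.tendsto 0
      rwa [sincC_zero] at this
    have hc : Tendsto (fun c : ℂ => -Complex.cos c) (𝓝 0) (𝓝 (-1)) := by
      have := Complex.continuous_cos.tendsto 0
      rw [Complex.cos_zero] at this
      exact this.neg
    simpa using (((hsub.div hT one_ne_zero).pow N).mul (hc.pow k₁)).mul hsub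
  exact (h2.comp tendsto_snd).mul h1

theorem circleFactor_mul_transverse {N : ℕ} (hN : 1 ≤ N) (k₁ m k : ℕ) (R t : ℝ) {σ : ℝ}
    (hσ : 0 < σ) (hσ' : σ ≤ 1) (θ : ℝ) :
    circleFactor N k₁ R t σ θ * transverse m k t (π - circleMap 0 σ θ) =
      (Real.exp (-(π * t)) : ℝ) * phaseIntegrand (N - 1) cotRemainder
        (residueAmplitude N k₁ m k t) R t (σ * Complex.exp (θ * Complex.I)) := by
  have hsin := sin_pi_sub_circleMap_ne_zero hσ hσ' θ
  rw [circleFactor, mehler_neg_sq _ _ _ hsin, circleMap_zero, phaseIntegrand, residueAmplitude]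
  rw [circleMap_zero] at hsin
  set c := (σ : ℂ) * Complex.exp (θ * Complex.I) with hc
  have hc0 : c ≠ 0 := mul_ne_zero (by exact_mod_cast hσ.ne') (Complex.exp_ne_zero _)
  rw [Complex.sin_pi_sub] at hsin
  rw [cotRemainder_eq hc0 hsin, Complex.sin_pi_sub, Complex.cos_pi_sub]
  have hexp : Complex.exp (-(R * ((π - c) * -Complex.cos c / Complex.sin c))) *
      Complex.exp (-(t * (π - c))) = Complex.exp ((-(π * t) : ℝ) : ℂ) *
      Complex.exp (t * c + π * R / c - R * (π / c - (π - c) * Complex.cos c / Complex.sin c)) := by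
    rw [← Complex.exp_add, ← Complex.exp_add]
    congr 1
    push_cast
    ring
  have hpow : ((π - c) / Complex.sin c) ^ N * c = c⁻¹ ^ (N - 1) * ((π - c) / sincC c) ^ N := by
    obtain ⟨ν, rfl⟩ : ∃ ν, N = ν + 1 := ⟨N - 1, by omega⟩
    rw [← mul_sincC, Nat.add_sub_cancel, div_pow, div_pow, mul_pow, inv_pow]
    have hT : sincC c ≠ 0 := fun h => hsin (by rw [← mul_sincC, h, mul_zero])
    field_simp
    ring
  push_cast at hexp ⊢
  calc _ = (((π - c) / Complex.sin c) ^ N * c) *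
        (Complex.exp (-(R * ((π - c) * -Complex.cos c / Complex.sin c))) *
          Complex.exp (-(t * (π - c)))) * (-Complex.cos c) ^ k₁ * (π - c) *
          transverse m k t (π - c) := by ring
    _ = _ := by rw [hpow, hexp]; ring

theorem theta_eq {y : ℝ} (h0 : 0 < y) (hy : y < π) :
    theta y = y / Real.sin y ^ 2 - Real.cos y / Real.sin y := by
  have hs := Real.sin_pos_of_pos_of_lt_pi h0 hy
  rw [theta, if_neg h0.ne', Real.sin_two_mul]
  field_simp

theorem theta_le_self {y : ℝ} (h0 : 0 < y) (hy : y < π / 2) : theta y ≤ y := by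
  have hs := Real.sin_pos_of_pos_of_lt_pi h0 (by linarith [Real.pi_pos])
  have hc := Real.cos_pos_of_mem_Ioo ⟨by linarith, hy⟩
  have ht := Real.lt_tan h0 hy
  rw [Real.tan_eq_sin_div_cos, lt_div_iff₀ hc] at ht
  rw [theta_eq h0 (by linarith [Real.pi_pos]), show y / Real.sin y ^ 2 - Real.cos y / Real.sin y =
    (y - Real.sin y * Real.cos y) / Real.sin y ^ 2 by field_simp, div_le_iff₀ (by positivity)]
  nlinarith [Real.sin_sq_add_cos_sq y]

theorem theta_le_div_sq {y s : ℝ} (h0 : 0 < y) (hs : 0 < s) (hs1 : s ≤ 1) (hy : s ≤ π - y) :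
    theta y ≤ 16 / s ^ 2 := by
  have hπ3 := Real.pi_gt_three
  have hπ4 := Real.pi_lt_d2
  rcases lt_or_ge y (π / 2) with h | h
  · refine (theta_le_self h0 h).trans ?_
    rw [le_div_iff₀ (by positivity)]
    have : s ^ 2 ≤ 1 := by nlinarith
    nlinarith
  · have h1 := Real.mul_le_sin (x := π - y) (by linarith) (by linarith)
    rw [Real.sin_pi_sub] at h1
    have h2 : 0.63 * s ≤ 2 / π * s := by
      rw [div_mul_eq_mul_div, le_div_iff₀ (by linarith)]; nlinarith
    have h3 : 2 / π * s ≤ 2 / π * (π - y) := by gcongr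
    have h4 : 0.63 * s ≤ Real.sin y := by linarith
    have h5 : 0 < Real.sin y := by linarith
    rw [theta, if_neg h0.ne', div_le_div_iff₀ (by positivity) (by positivity)]
    have h6 := Real.neg_one_le_sin (2 * y)
    have h7 : (0.63 * s) ^ 2 ≤ Real.sin y ^ 2 := by gcongr
    nlinarith [sq_nonneg s]

theorem pi_sub_le_of_theta_eq {R t y s : ℝ} (hR : 0 < R) (ht : 0 < t) (hy : y ∈ Set.Ico 0 π)
    (hθ : theta y = t / R) (hs : 0 < s) (hs1 : s ≤ 1) (hδ : √(R / (π * t)) ≤ s / 8) :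
    0 < y ∧ π - y ≤ s := by
  have hy0 : 0 < y := by
    rcases hy.1.eq_or_lt with h | h
    · rw [← h, theta, if_pos rfl] at hθ
      have : 0 < t / R := by positivity
      linarith
    · exact h
  refine ⟨hy0, ?_⟩
  by_contra! hlt
  have h1 := theta_le_div_sq hy0 hs hs1 hlt.le
  have hπ4 := Real.pi_lt_d2
  have hπ := Real.pi_pos
  rw [hθ, div_le_div_iff₀ hR (by positivity)] at h1
  have h2 : R / (π * t) ≤ (s / 8) ^ 2 := (Real.sqrt_le_left (by positivity)).1 hδ
  rw [div_le_iff₀ (by positivity)] at h2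
  have : 0 < s ^ 2 * t := by positivity
  nlinarith

/-- The critical equation at `s = π - y`, in terms of `cotRemainder`. -/
theorem critical_of_theta_eq {R t y : ℝ} (hR : 0 < R) (h0 : 0 < y) (hy : y < π)
    (hθ : theta y = t / R) :
    π * R / (π - y) ^ 2 = t - R * ((π - (π - y)) / Real.sin (π - y) ^ 2 +
      Real.cos (π - y) / Real.sin (π - y) - π / (π - y) ^ 2) := by
  rw [theta_eq h0 hy, eq_div_iff hR.ne'] at hθ
  have hs := Real.sin_pos_of_pos_of_lt_pi h0 hy
  have hs' : π - y ≠ 0 := by linarith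
  rw [Real.sin_pi_sub, Real.cos_pi_sub, ← hθ]
  field_simp
  ring

theorem critical_value_of_theta_eq {R t y : ℝ} (hR : 0 < R) (h0 : 0 < y) (hy : y < π)
    (hθ : theta y = t / R) :
    -(π * t) + (t * (π - y) + π * R / (π - y) - R * (π / (π - y) -
      (π - (π - y)) * Real.cos (π - y) / Real.sin (π - y))) = -(R * (y / Real.sin y) ^ 2) := by
  rw [theta_eq h0 hy, eq_div_iff hR.ne'] at hθ
  have hs := Real.sin_pos_of_pos_of_lt_pi h0 hy
  have hs' : π - y ≠ 0 := by linarith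
  rw [Real.sin_pi_sub, Real.cos_pi_sub, ← hθ]
  field_simp
  ring

theorem exists_exp_neg_mul_sqrt_pow_le (m : ℕ) {ε : ℝ} (hε : 0 < ε) : ∃ T : ℝ, 1 ≤ T ∧
    ∀ t, T ≤ t → Real.exp (-t) ≤ ε * (√t ^ m)⁻¹ := by
  have h := (Real.tendsto_pow_mul_exp_neg_atTop_nhds_zero m).eventually (Iic_mem_nhds hε)
  obtain ⟨T, hT⟩ := Filter.eventually_atTop.1 h
  refine ⟨max T 1, le_max_right _ _, fun t ht => ?_⟩
  have h1 : 1 ≤ t := (le_max_right _ _).trans ht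
  have h2 : t ^ m * Real.exp (-t) ≤ ε := hT t ((le_max_left _ _).trans ht)
  have h3 : √t ≤ t := Real.sqrt_le_self_iff.2 (Or.inr h1)
  have h4 : 0 < √t ^ m := by
    have := Real.sqrt_pos.2 (by linarith : 0 < t); positivity
  rw [← div_eq_mul_inv, le_div_iff₀ h4, mul_comm]
  refine le_trans ?_ h2
  gcongr

/-- The leading term of the line integral, up to constants and the power of `t` coming from the
transverse variables. -/
noncomputable def leadingTerm (ν : ℕ) (R t y κ : ℝ) : ℝ :=
  2 * π * (2 * t) ^ ν * Real.exp (-(R * (y / Real.sin y) ^ 2) - κ) * besselItilde ν κ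

set_option maxHeartbeats 1000000 in
theorem exists_integral_lineIntegrand_asymptotics (n k₁ k m : ℕ) (hn : 1 ≤ n) {ε : ℝ}
    (hε : 0 < ε) : ∃ s₀ r T : ℝ, 0 < s₀ ∧ s₀ ≤ 1 ∧ 0 < r ∧ 1 ≤ T ∧ ∀ R t y κ : ℝ, 0 < R → T ≤ t →
      R ≤ r * t → 0 < y → y < π → π - y ≤ s₀ → theta y = t / R → κ = 2 * √(π * t * R) →
      ‖(∫ p : ℝ × EuclideanSpace ℝ (Fin m), lineIntegrand (n + k₁) k₁ k R t ‖p.2‖ p.1) -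
        Complex.I ^ k * (((√t ^ m)⁻¹ : ℝ) * (residueLimit (n + k₁) k₁ m k *
          leadingTerm (n + k₁ - 1) R t y κ))‖ ≤
        ε * ((√t ^ m)⁻¹ * leadingTerm (n + k₁ - 1) R t y κ) := by
  have hπ := Real.pi_pos
  have hπ3 := Real.pi_gt_three
  set ν := n + k₁ - 1 with hν
  set N := n + k₁ with hN
  obtain ⟨C, hC, HC⟩ := exists_integral_lineIntegrand_prod n k₁ k m hn
  obtain ⟨M, hM, hM₀, hM₁, hM₂⟩ := exists_quadratic_bound (r := π) (by linarith)
    differentiableOn_cotRemainder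
  set h₀ : ℝ → ℝ := fun s => π / s - (π - s) * Real.cos s / Real.sin s with hh₀
  set h₁ : ℝ → ℝ := fun s => (π - s) / Real.sin s ^ 2 + Real.cos s / Real.sin s - π / s ^ 2
    with hh₁
  have hn1 : ∀ s : ℝ, 0 < s → s ≤ 1 → ‖(s : ℂ)‖ ≤ 1 := fun s hs hs1 => by
    rwa [Complex.norm_real, Real.norm_of_nonneg hs.le]
  have hb₀ : ∀ s, 0 < s → s ≤ 1 → |h₀ s| ≤ M := fun s hs hs1 => by
    have := hM₀ s (hn1 s hs hs1)
    rwa [cotRemainder_ofReal hs hs1, Complex.norm_real, Real.norm_eq_abs] at this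
  have hb₁ : ∀ s, 0 < s → s ≤ 1 → |h₁ s| ≤ M := fun s hs hs1 => by
    have := hM₁ s (hn1 s hs hs1)
    rwa [deriv_cotRemainder_ofReal hs hs1, Complex.norm_real, Real.norm_eq_abs] at this
  have hb₂ : ∀ s : ℝ, 0 < s → s ≤ 1 → ∀ c : ℂ, ‖c‖ ≤ 1 →
      ‖cotRemainder c - h₀ s - h₁ s * (c - s)‖ ≤ M * ‖c - s‖ ^ 2 := fun s hs hs1 c hc => by
    have := hM₂ s c (hn1 s hs hs1) hc
    rwa [cotRemainder_ofReal hs hs1, deriv_cotRemainder_ofReal hs hs1] at this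
  obtain ⟨s₀, T₁, hs₀, hs₀1, hT₁, H⟩ := exists_phaseIntegral ν
    (tendsto_residueAmplitude N k₁ m k) (measurable_residueAmplitude N k₁ m k)
    measurable_cotRemainder hM hb₁ hb₀ hM₀ hb₂ (half_pos hε)
  have hf0 : (0 : ℝ) < 2 ^ ν * ν.factorial := by
    have : (0 : ℝ) < ν.factorial := by exact_mod_cast ν.factorial_pos
    positivity
  obtain ⟨T₂, hT₂, hexp⟩ := exists_exp_neg_mul_sqrt_pow_le m
    (ε := ε / 2 / (2 ^ ν * ν.factorial) / (C * Real.exp (3 * π / 4))) (by positivity)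
  refine ⟨s₀, 1 / (2 * (M + 1)), max T₁ T₂, hs₀, hs₀1, by positivity, hT₁.trans (le_max_left _ _),
    fun R t y κ hR ht hRt hy0 hyπ hys hθ hκ => ?_⟩
  have htT₁ : T₁ ≤ t := (le_max_left _ _).trans ht
  have htT₂ : T₂ ≤ t := (le_max_right _ _).trans ht
  have ht1 : 1 ≤ t := hT₁.trans htT₁
  have ht0 : 0 < t := by linarith
  have hs : 0 < π - y := by linarith
  have hs1 : π - y ≤ 1 := hys.trans hs₀1
  have hcrit : π * R / (π - y) ^ 2 = t - R * h₁ (π - y) := critical_of_theta_eq hR hy0 hyπ hθ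
  have hval := critical_value_of_theta_eq hR hy0 hyπ hθ
  rw [show π / (π - y) - (π - (π - y)) * Real.cos (π - y) / Real.sin (π - y) = h₀ (π - y) from rfl]
    at hval
  obtain ⟨σ, hσ, hσ1, hmain⟩ := H R t (π - y) κ hR htT₁ hs hys hcrit hκ
  have hrem := HC R t σ hR.le ht1 hσ hσ1
  set S := (√t ^ m)⁻¹ with hS
  have hS0 : 0 < S := by
    have := Real.sqrt_pos.2 ht0; positivity
  set B := besselTerm ν R t (π - y) (h₀ (π - y)) κ with hB
  set E := Real.exp (-(π * t)) with hE
  have hE0 : 0 < E := Real.exp_pos _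
  have hG : leadingTerm ν R t y κ = E * B := by
    rw [leadingTerm, ← hval, hB, besselTerm, hE]
    have : ∀ u : ℝ, Real.exp (-(π * t) + u - κ) = Real.exp (-(π * t)) * Real.exp (u - κ) :=
      fun u => by rw [← Real.exp_add]; congr 1; ring
    rw [this]; ring
  have hcircle : ∫ θ in (-π)..π, circleFactor N k₁ R t σ θ *
      transverse m k t (π - circleMap 0 σ θ) = (E : ℂ) * ∫ θ in (-π)..π,
        phaseIntegrand ν cotRemainder (residueAmplitude N k₁ m k t) R t
          (σ * Complex.exp (θ * Complex.I)) := by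
    rw [← intervalIntegral.integral_const_mul]
    exact intervalIntegral.integral_congr fun θ _ =>
      circleFactor_mul_transverse (by omega) k₁ m k R t hσ hσ1 θ
  rw [hcircle] at hrem
  set J := ∫ θ in (-π)..π, phaseIntegrand ν cotRemainder (residueAmplitude N k₁ m k t) R t
    (σ * Complex.exp (θ * Complex.I)) with hJ
  have hIk : ‖Complex.I ^ k‖ = 1 := by simp
  have hfirst : ‖Complex.I ^ k * ((S : ℝ) * ((E : ℂ) * J)) -
      Complex.I ^ k * ((S : ℝ) * (residueLimit N k₁ m k * (E * B : ℝ)))‖ ≤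
      ε / 2 * (S * (E * B)) := by
    have e1 : Complex.I ^ k * ((S : ℝ) * ((E : ℂ) * J)) -
        Complex.I ^ k * ((S : ℝ) * (residueLimit N k₁ m k * (E * B : ℝ))) =
        Complex.I ^ k * ((S * E : ℝ) * (J - residueLimit N k₁ m k * B)) := by
      push_cast; ring
    rw [e1, norm_mul, hIk, one_mul, norm_mul, Complex.norm_real,
      Real.norm_of_nonneg (by positivity)]
    calc _ ≤ S * E * (ε / 2 * B) := by gcongr
      _ = _ := by ring
  have hlow : Real.exp (-((t - 1 / 2) * (3 * π / 2))) ≤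
      Real.exp (3 * π / 4) * Real.exp (-t) * Real.exp (-(π * t) + (t * (π - y) +
        π * R / (π - y) - R * h₀ (π - y)) - κ) := by
    rw [← Real.exp_add, ← Real.exp_add]
    gcongr
    have h1 := (exponent_sub_mem hR ht0 hs hs1 (hb₁ _ hs hs1) hcrit hκ).1
    have h2 := abs_le.1 (hb₀ _ hs hs1)
    have h3 : R * (M + 1) ≤ t / 2 := by
      calc R * (M + 1) ≤ 1 / (2 * (M + 1)) * t * (M + 1) := by gcongr
        _ = t / 2 := by field_simp
    have h4 : R * h₀ (π - y) ≤ R * (M + 1) :=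
      mul_le_mul_of_nonneg_left (h2.2.trans (le_add_of_nonneg_right zero_le_one)) hR.le
    have h5 : 3 * t ≤ π * t := mul_le_mul_of_nonneg_right hπ3.le ht0.le
    linarith
  have hsecond : C * Real.exp (-((t - 1 / 2) * (3 * π / 2))) ≤ ε / 2 * (S * (E * B)) := by
    have h1 := hexp t htT₂
    rw [div_mul_eq_mul_div, le_div_iff₀ (by positivity)] at h1
    set Q := Real.exp (-(π * t) + (t * (π - y) + π * R / (π - y) - R * h₀ (π - y)) - κ) with hQ
    have hQ0 : 0 < Q := Real.exp_pos _
    have h2 : Q * (1 / (2 ^ ν * ν.factorial)) ≤ E * B := by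
      rw [← hG, leadingTerm, ← hval]
      have h3 : (1 : ℝ) ≤ (2 * t) ^ ν := one_le_pow₀ (by linarith)
      have h4 : 1 ≤ 2 * π * (2 * t) ^ ν := by nlinarith
      have h5 := le_besselItilde ν κ
      have h6 : Q ≤ 2 * π * (2 * t) ^ ν * Q := by nlinarith
      gcongr
    calc C * Real.exp (-((t - 1 / 2) * (3 * π / 2)))
        ≤ C * (Real.exp (3 * π / 4) * Real.exp (-t) * Q) := by gcongr
      _ = (Real.exp (-t) * (C * Real.exp (3 * π / 4))) * Q := by ring
      _ ≤ (ε / 2 / (2 ^ ν * ν.factorial) * S) * Q := by gcongr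
      _ = ε / 2 * (S * (Q * (1 / (2 ^ ν * ν.factorial)))) := by ring
      _ ≤ _ := by gcongr
  rw [hG]
  calc _ ≤ C * Real.exp (-((t - 1 / 2) * (3 * π / 2))) + ε / 2 * (S * (E * B)) :=
        (norm_sub_le_norm_sub_add_norm_sub _ _ _).trans (add_le_add hrem hfirst)
    _ ≤ _ := by linarith

theorem leading_constant_eq {n m k₁ k₂ ν : ℕ} (hν : n + k₁ = ν + 1) {t : ℝ} (ht : 0 < t) :
    π ^ (k₁ + k₂) / (2 : ℝ) ^ ((n : ℝ) - (k₁ : ℝ) + 1 + (((m + 1 : ℕ) : ℝ) - 1) / 2) *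
        t ^ ((n : ℝ) + (k₁ : ℝ) - (((m + 1 : ℕ) : ℝ) + 1) / 2) =
      (√t ^ m)⁻¹ * (π ^ (n + k₁) * π * ((2 * π ^ 2) ^ ((m : ℝ) / 2) * (π ^ k₂ / π))) *
        (2 * π * (2 * t) ^ ν) / ((4 * π) ^ n * (2 * π) ^ (m + 1)) := by
  have hπ := Real.pi_pos
  set a : ℝ := (2 : ℝ) ^ ((m : ℝ) / 2) with ha
  have ha0 : 0 < a := by positivity
  have ha2 : a * a = 2 ^ m := by
    rw [ha, ← Real.rpow_add (by norm_num), add_halves, Real.rpow_natCast]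
  have h1 : (2 : ℝ) ^ ((n : ℝ) - (k₁ : ℝ) + 1 + (((m + 1 : ℕ) : ℝ) - 1) / 2) =
      2 ^ n / 2 ^ k₁ * 2 * a := by
    rw [Real.rpow_add (by norm_num), Real.rpow_add (by norm_num), Real.rpow_sub (by norm_num),
      Real.rpow_natCast, Real.rpow_natCast, Real.rpow_one, ha]
    push_cast
    ring_nf
  have h2 : (2 * π ^ 2) ^ ((m : ℝ) / 2) = a * π ^ m := by
    rw [Real.mul_rpow (by norm_num) (by positivity), ← Real.rpow_natCast π 2,
      ← Real.rpow_mul hπ.le, ← Real.rpow_natCast π m]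
    congr 2
    push_cast; ring
  have h3 : t ^ ((n : ℝ) + (k₁ : ℝ) - (((m + 1 : ℕ) : ℝ) + 1) / 2) = t ^ ν * (√t ^ m)⁻¹ := by
    have hc : (n : ℝ) + k₁ = ν + 1 := by exact_mod_cast hν
    have hr : √t ^ m = t ^ ((m : ℝ) / 2) := by
      rw [Real.sqrt_eq_rpow, ← Real.rpow_natCast, ← Real.rpow_mul ht.le]
      congr 1; ring
    rw [hc, hr, ← Real.rpow_neg ht.le, ← Real.rpow_natCast, ← Real.rpow_add ht]
    congr 1
    push_cast; ring
  have h4 : (2 : ℝ) ^ n * 2 ^ k₁ = 2 ^ ν * 2 := by rw [← pow_add, hν, pow_succ]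
  have hs : 0 < √t ^ m := by
    have := Real.sqrt_pos.2 ht; positivity
  have h5 : (4 : ℝ) ^ n = 2 ^ n * 2 ^ n := by rw [← mul_pow]; norm_num
  rw [h1, h2, h3, mul_pow, mul_pow, mul_pow, h5, pow_add π n k₁, pow_add π k₁ k₂, pow_succ π m,
    pow_succ (2 : ℝ) m, ← ha2]
  field_simp
  linear_combination h4

/-- The main term of the asymptotics is the leading term of the residue integral. -/
theorem main_term_eq {n m k₁ k₂ ν : ℕ} (hν : n + k₁ = ν + 1) {R t y κ : ℝ} (ht : 0 < t) :
    (((-1 : ℝ) ^ k₂ * π ^ (k₁ + k₂) /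
        (2 : ℝ) ^ ((n : ℝ) - (k₁ : ℝ) + 1 + (((m + 1 : ℕ) : ℝ) - 1) / 2) *
        t ^ ((n : ℝ) + (k₁ : ℝ) - (((m + 1 : ℕ) : ℝ) + 1) / 2) *
        Real.exp (-(R * (y / Real.sin y) ^ 2)) * Real.exp (-κ) * besselItilde ν κ : ℝ) : ℂ) =
      (-1 : ℂ) ^ k₁ * Complex.I ^ k₂ / ((4 * (π : ℂ)) ^ n * (2 * (π : ℂ)) ^ (m + 1)) *
        (Complex.I ^ k₂ * (((√t ^ m)⁻¹ : ℝ) * (residueLimit (n + k₁) k₁ m k₂ *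
          leadingTerm ν R t y κ))) := by
  have hc := leading_constant_eq (m := m) (k₂ := k₂) hν ht
  have h1 : ((-1 : ℝ) ^ k₂ * π ^ (k₁ + k₂) /
        (2 : ℝ) ^ ((n : ℝ) - (k₁ : ℝ) + 1 + (((m + 1 : ℕ) : ℝ) - 1) / 2) *
        t ^ ((n : ℝ) + (k₁ : ℝ) - (((m + 1 : ℕ) : ℝ) + 1) / 2) *
        Real.exp (-(R * (y / Real.sin y) ^ 2)) * Real.exp (-κ) * besselItilde ν κ) =
      (-1 : ℝ) ^ k₂ * ((√t ^ m)⁻¹ *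
        (π ^ (n + k₁) * π * ((2 * π ^ 2) ^ ((m : ℝ) / 2) * (π ^ k₂ / π))) *
        (2 * π * (2 * t) ^ ν) / ((4 * π) ^ n * (2 * π) ^ (m + 1))) *
        (Real.exp (-(R * (y / Real.sin y) ^ 2) - κ) * besselItilde ν κ) := by
    rw [← hc, sub_eq_add_neg (-(R * (y / Real.sin y) ^ 2)), Real.exp_add]
    ring
  have hI : Complex.I ^ k₂ * Complex.I ^ k₂ = (-1) ^ k₂ := by
    rw [← mul_pow, Complex.I_mul_I]
  rw [h1, residueLimit, leadingTerm, Complex.ofReal_mul, Complex.ofReal_mul]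
  set a : ℝ := (2 * π ^ 2) ^ ((m : ℝ) / 2)
  set S : ℝ := (√t ^ m)⁻¹
  set q : ℝ := Real.exp (-(R * (y / Real.sin y) ^ 2) - κ)
  push_cast
  rw [← hI]
  rcases neg_one_pow_eq_or ℂ k₁ with hk | hk <;> rw [hk] <;> ring

theorem residueLimit_ne_zero (N k₁ m k : ℕ) : residueLimit N k₁ m k ≠ 0 := by
  have hπ : (π : ℂ) ≠ 0 := by exact_mod_cast Real.pi_ne_zero
  have ha : (((2 * π ^ 2) ^ ((m : ℝ) / 2) : ℝ) : ℂ) ≠ 0 := by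
    have : 0 < (2 * π ^ 2) ^ ((m : ℝ) / 2) := by
      have := Real.pi_pos; positivity
    exact_mod_cast this.ne'
  unfold residueLimit
  refine mul_ne_zero (mul_ne_zero (mul_ne_zero (pow_ne_zero _ hπ) (by simp)) hπ)
    (mul_ne_zero ha (div_ne_zero (pow_ne_zero _ hπ) hπ))

theorem leadingTerm_pos (ν : ℕ) (R y κ : ℝ) {t : ℝ} (ht : 0 < t) : 0 < leadingTerm ν R t y κ := by
  have := besselItilde_pos ν κ
  have := Real.pi_pos
  unfold leadingTerm
  positivity

end HeatKernelAsymptotics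

/-- Unified asymptotics of p_{1,k₁,k₂} on H-type groups when (x,t) → ∞ and δ → 0⁺:
there is a real-analytic ρ with ρ(0) = 1, ρ′(0) = 0 such that
p_{1,k₁,k₂}(x,t) ~ ((−1)^{k₂}π^{k₁+k₂}/2^{n−k₁+1+(m−1)/2}) |t|^{n+k₁−(m+1)/2}
e^{−d²/4} e^{−κρ(δ)} Ĩ_{n+k₁−1}(κρ(δ)). -/
theorem htype_unified_asymptotics (n m k₁ k₂ : ℕ) (hn : 1 ≤ n) (hm : 0 < m) :
    ∃ δ₁ : ℝ, 0 < δ₁ ∧ ∃ ρ : ℝ → ℝ,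
      AnalyticOnNhd ℝ ρ (Set.Ioo (-δ₁) δ₁) ∧ ρ 0 = 1 ∧ deriv ρ 0 = 0 ∧
      ∀ ε : ℝ, 0 < ε → ∃ δ₀ : ℝ, δ₀ ∈ Set.Ioo (0 : ℝ) δ₁ ∧ ∃ M : ℝ, 0 < M ∧
        ∀ (x : EuclideanSpace ℝ (Fin (2 * n))) (t : EuclideanSpace ℝ (Fin m))
          (yω δ κ d P : ℝ),
          x ≠ 0 → t ≠ 0 → M ≤ ‖x‖ ^ 2 + ‖t‖ →
          yω ∈ Set.Ico 0 π → theta yω = 4 * ‖t‖ / ‖x‖ ^ 2 →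
          δ = Real.sqrt ((‖x‖ ^ 2 / 4) / (π * ‖t‖)) →
          κ = 2 * Real.sqrt (π * ‖t‖ * (‖x‖ ^ 2 / 4)) →
          d = ‖x‖ * yω / Real.sin yω →
          P = ((-1 : ℝ) ^ k₂ * π ^ (k₁ + k₂) /
                (2 : ℝ) ^ ((n : ℝ) - (k₁ : ℝ) + 1 + ((m : ℝ) - 1) / 2)) *
              ‖t‖ ^ ((n : ℝ) + (k₁ : ℝ) - ((m : ℝ) + 1) / 2) *
              Real.exp (-d ^ 2 / 4) * Real.exp (-(κ * ρ δ)) *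
              besselItilde (n + k₁ - 1) (κ * ρ δ) →
          δ ≤ δ₀ →
          ‖pT n m k₁ k₂ hm x t - (P : ℂ)‖ ≤ ε * |P| := by
  obtain ⟨m, rfl⟩ : ∃ l, m = l + 1 := ⟨m - 1, by omega⟩
  have hπ := Real.pi_pos
  have hπ4 := Real.pi_lt_d2
  refine ⟨1, one_pos, fun _ => 1, analyticOnNhd_const, rfl, by simp, fun ε hε => ?_⟩
  have hL0 : 0 < ‖residueLimit (n + k₁) k₁ m k₂‖ := norm_pos_iff.2 (residueLimit_ne_zero _ _ _ _)
  obtain ⟨s₀, r, T, hs₀, hs₀1, hr, hT, H⟩ := exists_integral_lineIntegrand_asymptotics n k₁ k₂ m hn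
    (ε := ε * ‖residueLimit (n + k₁) k₁ m k₂‖) (by positivity)
  refine ⟨min (s₀ / 8) r, ⟨by positivity, lt_of_le_of_lt (min_le_left _ _) (by linarith)⟩,
    2 * T, by linarith, ?_⟩
  intro x t yω δ κ d P hx ht hM hy hθ hδ hκ hd hP hδ₀
  set R := ‖x‖ ^ 2 / 4 with hR
  set τ := ‖t‖ with hτ
  have hx0 : 0 < ‖x‖ := norm_pos_iff.2 hx
  have hR0 : 0 < R := by positivity
  have hτ0 : 0 < τ := norm_pos_iff.2 ht
  have hθ' : theta yω = τ / R := by rw [hθ, hR]; field_simp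
  have hδ1 : δ ≤ s₀ / 8 := hδ₀.trans (min_le_left _ _)
  have hδ2 : δ ≤ r := hδ₀.trans (min_le_right _ _)
  have hδ0 : 0 ≤ δ := by rw [hδ]; positivity
  have hRδ : R = π * τ * δ ^ 2 := by
    rw [hδ, Real.sq_sqrt (by positivity)]; field_simp
  have hδ8 : δ ≤ 1 / 8 := by linarith
  have hRr : R ≤ r * τ := by
    have h1 : π * δ ^ 2 ≤ r := by nlinarith
    rw [hRδ]; nlinarith
  have hR4 : R ≤ τ / 4 := by
    have h1 : π * δ ^ 2 ≤ 1 / 4 := by nlinarith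
    rw [hRδ]; nlinarith
  have hTτ : T ≤ τ := by
    have : ‖x‖ ^ 2 = 4 * R := by rw [hR]; ring
    linarith
  obtain ⟨hy0, hys⟩ := pi_sub_le_of_theta_eq hR0 hτ0 hy hθ' hs₀ hs₀1 (hδ ▸ hδ1)
  have key := H R τ yω κ hR0 hTτ hRr hy0 hy.2 hys hθ' hκ
  have hd' : -d ^ 2 / 4 = -(R * (yω / Real.sin yω) ^ 2) := by rw [hd, hR]; ring
  have hPc := main_term_eq (n := n) (m := m) (k₁ := k₁) (k₂ := k₂) (ν := n + k₁ - 1) (by omega)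
    (R := R) (y := yω) (κ := κ) hτ0
  rw [hd', mul_one] at hP
  rw [← hP] at hPc
  have hpT := pT_eq_integral_prod n m k₁ k₂ x t
  have hG := leadingTerm_pos (n + k₁ - 1) R yω κ hτ0
  have hS : 0 ≤ (√τ ^ m)⁻¹ := by positivity
  have hnorm : ‖Complex.I ^ k₂ * (((√τ ^ m)⁻¹ : ℝ) * (residueLimit (n + k₁) k₁ m k₂ *
      leadingTerm (n + k₁ - 1) R τ yω κ))‖ =
      (√τ ^ m)⁻¹ * (‖residueLimit (n + k₁) k₁ m k₂‖ * leadingTerm (n + k₁ - 1) R τ yω κ) := by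
    rw [norm_mul, norm_mul, norm_mul, Complex.norm_real, Complex.norm_real,
      Real.norm_of_nonneg hS, Real.norm_of_nonneg hG.le, norm_pow, Complex.norm_I, one_pow, one_mul]
  rw [← Real.norm_eq_abs, ← Complex.norm_real P, hPc, hpT, ← mul_sub, norm_mul, norm_mul _
    (Complex.I ^ k₂ * _), hnorm, mul_left_comm ε]
  refine mul_le_mul_of_nonneg_left (key.trans_eq ?_) (norm_nonneg _)
  ring
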